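/- Let (X,d,m) be a length PI space having the deformation property, let E ⊆ X be a volume-constrained minimizer of the perimeter, and let B ⊆ X be a bounded set. Then there exist constants r̄ > 0 and C̃ ≥ 1 such that P(E, B_{2r}(x)) ≤ C̃·P(E, B_r(x)) for every x ∈ ∂^e E ∩ B and every r ∈ (0, r̄/2). -/

import Mathlib

open MeasureTheory Metric Set Filter Topology ENNReal Bornology
open scoped symmDiff

noncomputable section

variable {X : Type*}

/-- The slope (pointwise Lipschitz constant) of `f` at `x`, computed within `Ω`.
It vanishes at points that are isolated in `Ω`. -/
def slopeOn [MetricSpace X] (Ω : Set X) (f : X → ℝ) (x : X) : ℝ≥0∞ :=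
  Filter.limsup (fun y => ENNReal.ofReal (|f x - f y| / dist x y)) (𝓝[Ω \ {x}] x)

/-- The slope of `f`. -/
def mSlope [MetricSpace X] (f : X → ℝ) (x : X) : ℝ≥0∞ := slopeOn Set.univ f x

/-- `f` is locally Lipschitz on `Ω`. -/
def LocLipOn [MetricSpace X] (Ω : Set X) (f : X → ℝ) : Prop :=
  ∀ x ∈ Ω, ∃ r > (0:ℝ), ∃ K : NNReal, LipschitzOnWith K f (Metric.ball x r ∩ Ω)

/-- Convergence `fn → f` in `L¹_loc(Ω)` w.r.t. the measure `m`. -/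
def TendstoL1loc [MetricSpace X] [MeasurableSpace X] (m : Measure X) (Ω : Set X)
    (fn : ℕ → X → ℝ) (f : X → ℝ) : Prop :=
  ∀ K : Set X, K ⊆ Ω → IsCompact K →
    Tendsto (fun n => ∫⁻ x in K, ENNReal.ofReal |fn n x - f x| ∂m) atTop (𝓝 0)

/-- The total variation `|Df|(B)` of `f : X → ℝ` on the set `B`. -/
def totVar [MetricSpace X] [MeasurableSpace X] (m : Measure X) (f : X → ℝ) (B : Set X) : ℝ≥0∞ :=
  ⨅ (Ω : Set X) (_ : IsOpen Ω) (_ : B ⊆ Ω),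
    ⨅ (fn : ℕ → X → ℝ) (_ : ∀ n, LocLipOn Ω (fn n)) (_ : TendstoL1loc m Ω fn f),
      Filter.liminf (fun n => ∫⁻ x in Ω, slopeOn Ω (fn n) x ∂m) atTop

/-- The perimeter `P(E, B)` of a set `E` in `B`. -/
def Per [MetricSpace X] [MeasurableSpace X] (m : Measure X) (E B : Set X) : ℝ≥0∞ :=
  totVar m (Set.indicator E fun _ => (1:ℝ)) B

/-- `E` has locally finite perimeter. -/
def HasLocFinPer [MetricSpace X] [MeasurableSpace X] (m : Measure X) (E : Set X) : Prop :=
  ∀ x : X, ∃ r > (0:ℝ), Per m E (Metric.ball x r) < ∞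

/-- `E` has finite perimeter. -/
def HasFinPer [MetricSpace X] [MeasurableSpace X] (m : Measure X) (E : Set X) : Prop :=
  Per m E Set.univ < ∞

/-- `m` is finite on bounded sets. -/
def BoundedlyFinite [MetricSpace X] [MeasurableSpace X] (m : Measure X) : Prop :=
  ∀ B : Set X, Bornology.IsBounded B → m B < ∞

/-- Uniformly locally doubling with doubling function `C_D`. -/
def UnifLocDoublingWith [MetricSpace X] [MeasurableSpace X] (C_D : ℝ → ℝ) (m : Measure X) : Prop :=
  ∀ R : ℝ, 0 < R → ∀ x : X, ∀ r : ℝ, 0 < r → r < R →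
    m (Metric.ball x (2 * r)) ≤ ENNReal.ofReal (C_D R) * m (Metric.ball x r)

/-- Weak local (1,1)-Poincaré inequality with dilation `lam` and constant function `C_P`. -/
def WeakPoincareWith [MetricSpace X] [MeasurableSpace X] (lam : ℝ) (C_P : ℝ → ℝ)
    (m : Measure X) : Prop :=
  ∀ f : X → ℝ, LocLipOn Set.univ f → ∀ R : ℝ, 0 < R → ∀ x : X, ∀ r : ℝ, 0 < r → r < R →
    (∫⁻ y in Metric.ball x r,
        ENNReal.ofReal |f y - ⨍ z in Metric.ball x r, f z ∂m| ∂m) / m (Metric.ball x r)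
      ≤ ENNReal.ofReal (C_P R * r) *
          ((∫⁻ y in Metric.ball x (lam * r), mSlope f y ∂m) / m (Metric.ball x (lam * r)))

/-- `(X, d, m)` is a PI space. -/
def IsPIspace [MetricSpace X] [MeasurableSpace X] (m : Measure X) : Prop :=
  (∃ C_D : ℝ → ℝ, (∀ R, 0 < R → 0 < C_D R) ∧ UnifLocDoublingWith C_D m) ∧
  (∃ lam : ℝ, 1 ≤ lam ∧ ∃ C_P : ℝ → ℝ, (∀ R, 0 < R → 0 < C_P R) ∧ WeakPoincareWith lam C_P m)

/-- `(X, d)` is a length space: the distance between two points is the infimum of the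
lengths of continuous curves joining them. -/
def IsLengthSpace (X : Type*) [MetricSpace X] : Prop :=
  ∀ p q : X, ENNReal.ofReal (dist p q) =
    ⨅ (γ : ℝ → X) (_ : ContinuousOn γ (Set.Icc 0 1)) (_ : γ 0 = p) (_ : γ 1 = q),
      eVariationOn γ (Set.Icc 0 1)

/-- Essential interior `E^{(1)}`. -/
def essInt [MetricSpace X] [MeasurableSpace X] (m : Measure X) (E : Set X) : Set X :=
  { x | Tendsto (fun r : ℝ => m (E ∩ Metric.ball x r) / m (Metric.ball x r)) (𝓝[>] 0) (𝓝 1) }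

/-- Essential exterior `E^{(0)}`. -/
def essExt [MetricSpace X] [MeasurableSpace X] (m : Measure X) (E : Set X) : Set X :=
  { x | Tendsto (fun r : ℝ => m (E ∩ Metric.ball x r) / m (Metric.ball x r)) (𝓝[>] 0) (𝓝 0) }

/-- Essential boundary `∂^e E`. -/
def essBdry [MetricSpace X] [MeasurableSpace X] (m : Measure X) (E : Set X) : Set X :=
  (essInt m E ∪ essExt m E)ᶜ

/-- The two deformation inequalities hold for `E` at `x` with radius `R` and constant `C`. -/
def DeformIneq [MetricSpace X] [MeasurableSpace X] (m : Measure X) (E : Set X) (x : X)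
    (R C : ℝ) : Prop :=
  ∀ y ∈ Metric.ball x R, ∀ r ∈ Set.Ioo (0:ℝ) R,
    Per m (E \ Metric.ball y r) (Metric.ball x (2 * R)) ≤
      ENNReal.ofReal C * m (Metric.ball y r ∩ E) / ENNReal.ofReal r +
        Per m E (Metric.ball x (2 * R)) ∧
    Per m (E ∪ Metric.ball y r) (Metric.ball x (2 * R)) ≤
      ENNReal.ofReal C * m (Metric.ball y r \ E) / ENNReal.ofReal r +
        Per m E (Metric.ball x (2 * R))

/-- The deformation inequalities hold for `E` at `x` with radius `R` and some constant. -/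
def DeformAt [MetricSpace X] [MeasurableSpace X] (m : Measure X) (E : Set X) (x : X)
    (R : ℝ) : Prop :=
  0 < R ∧ R ≤ 1 ∧ ∃ C : ℝ, 0 ≤ C ∧ DeformIneq m E x R C

/-- `R_x(E)`: the maximal radius in `(0,1]` for which the deformation inequalities hold. -/
def deformRadius [MetricSpace X] [MeasurableSpace X] (m : Measure X) (E : Set X) (x : X) : ℝ :=
  sSup { R : ℝ | DeformAt m E x R }

/-- `(X, d, m)` has the deformation property. -/
def DeformationProperty [MetricSpace X] [MeasurableSpace X] (m : Measure X) : Prop :=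
  ∀ E : Set X, MeasurableSet E → HasLocFinPer m E → ∀ x : X, ∃ R : ℝ, DeformAt m E x R

/-- `E` is a volume-constrained minimizer of the perimeter. -/
def VolConstMin [MetricSpace X] [MeasurableSpace X] (m : Measure X) (E : Set X) : Prop :=
  MeasurableSet E ∧ HasLocFinPer m E ∧
    ∀ F K : Set X, MeasurableSet F → IsCompact K →
      m ((E ∆ F) \ K) = 0 → m (E ∩ K) = m (F ∩ K) → Per m E K ≤ Per m F K

/-- `E` is an isoperimetric set. -/
def IsIsoperimetricSet [MetricSpace X] [MeasurableSpace X] (m : Measure X) (E : Set X) : Prop :=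
  MeasurableSet E ∧ HasFinPer m E ∧ 0 < m E ∧ m E < ∞ ∧
    ∀ F : Set X, MeasurableSet F → m F = m E → Per m E Set.univ ≤ Per m F Set.univ



set_option linter.unusedSectionVars false


section LimitLemmas

lemma ennreal_limsup_add_le {ι : Type*} {l : Filter ι} (a b : ι → ℝ≥0∞) :
    limsup (fun i => a i + b i) l ≤ limsup a l + limsup b l := by
  by_cases hA : limsup a l = ∞
  · simp [hA]
  by_cases hB : limsup b l = ∞
  · simp [hB]
  refine ENNReal.le_of_forall_pos_le_add fun ε hε _ => ?_
  have hε2 : (ε / 2 : ℝ≥0∞) ≠ 0 := by simp [hε.ne']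
  have h1 : ∀ᶠ i in l, a i < limsup a l + ε / 2 :=
    eventually_lt_of_limsup_lt (ENNReal.lt_add_right hA hε2)
  have h2 : ∀ᶠ i in l, b i < limsup b l + ε / 2 :=
    eventually_lt_of_limsup_lt (ENNReal.lt_add_right hB hε2)
  refine limsup_le_of_le (h := ?_)
  filter_upwards [h1, h2] with i hi1 hi2
  calc a i + b i ≤ (limsup a l + ε / 2) + (limsup b l + ε / 2) := add_le_add hi1.le hi2.le
    _ = limsup a l + limsup b l + (ε / 2 + ε / 2) := by ring
    _ = _ := by rw [ENNReal.add_halves]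

lemma ennreal_add_liminf_le (a b : ℕ → ℝ≥0∞) :
    liminf a atTop + liminf b atTop ≤ liminf (fun i => a i + b i) atTop := by
  simp only [liminf_eq_iSup_iInf_of_nat]
  rw [ENNReal.iSup_add_iSup_of_monotone]
  · refine iSup_mono fun n => ?_
    refine le_iInf₂ fun i hi => ?_
    exact add_le_add (iInf₂_le i hi) (iInf₂_le i hi)
  · intro n k hnk
    exact le_iInf₂ fun i hi => iInf₂_le i (hnk.trans hi)
  · intro n k hnk
    exact le_iInf₂ fun i hi => iInf₂_le i (hnk.trans hi)

end LimitLemmas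

section Slope

variable [MetricSpace X]

lemma slopeOn_eq_mSlope {Ω : Set X} (hΩ : IsOpen Ω) {x : X} (hx : x ∈ Ω) (f : X → ℝ) :
    slopeOn Ω f x = mSlope f x := by
  have : 𝓝[Ω \ {x}] x = 𝓝[univ \ {x}] x := by
    rw [show Ω \ {x} = (univ \ {x}) ∩ Ω by ext; simp [and_comm]]
    exact nhdsWithin_inter_of_mem' (mem_nhdsWithin_of_mem_nhds (hΩ.mem_nhds hx))
  simp only [mSlope, slopeOn, this]

lemma mSlope_congr {f g : X → ℝ} {x : X} (h : f =ᶠ[𝓝 x] g) : mSlope f x = mSlope g x := by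
  have hx := h.eq_of_nhds
  refine limsup_congr ?_
  filter_upwards [mem_nhdsWithin_of_mem_nhds h] with y hy
  rw [hx, show f y = g y from hy]

lemma mSlope_const (c : ℝ) (x : X) : mSlope (fun _ => c) x = 0 := by
  refine le_antisymm (limsup_le_of_le (h := ?_)) bot_le
  simp

/-- The interpolation of two functions by a cutoff. -/
def mix (φ u v : X → ℝ) (x : X) : ℝ := φ x * u x + (1 - φ x) * v x

lemma mSlope_mix_le {φ u v : X → ℝ} {L : NNReal} (hφ : LipschitzWith L φ) {x : X}
    (h0 : 0 ≤ φ x) (h1 : φ x ≤ 1) (hu : ContinuousAt u x) (hv : ContinuousAt v x) :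
    mSlope (mix φ u v) x ≤ ENNReal.ofReal (φ x) * mSlope u x +
      ENNReal.ofReal (1 - φ x) * mSlope v x + L * ENNReal.ofReal |u x - v x| := by
  set l := 𝓝[univ \ {x}] x with hl
  have key : ∀ᶠ y in l, ENNReal.ofReal (|mix φ u v x - mix φ u v y| / dist x y) ≤
      ENNReal.ofReal (φ x) * ENNReal.ofReal (|u x - u y| / dist x y) +
      ENNReal.ofReal (1 - φ x) * ENNReal.ofReal (|v x - v y| / dist x y) +
      L * ENNReal.ofReal |u y - v y| := by
    filter_upwards [self_mem_nhdsWithin] with y hy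
    have hd : 0 < dist x y := dist_pos.2 (fun h => hy.2 h.symm)
    rw [← ENNReal.ofReal_mul h0, ← ENNReal.ofReal_mul (by linarith), ← ENNReal.ofReal_coe_nnreal,
      ← ENNReal.ofReal_mul (by positivity), ← ENNReal.ofReal_add (by positivity)
        (mul_nonneg (by linarith) (by positivity)), ← ENNReal.ofReal_add
        (add_nonneg (by positivity) (mul_nonneg (by linarith) (by positivity))) (by positivity)]
    refine ENNReal.ofReal_le_ofReal ?_
    have hL : |φ x - φ y| ≤ L * dist x y := by
      simpa [Real.dist_eq] using hφ.dist_le_mul x y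
    have e : mix φ u v x - mix φ u v y =
        φ x * (u x - u y) + (1 - φ x) * (v x - v y) + (φ x - φ y) * (u y - v y) := by
      simp only [mix]; ring
    have : |mix φ u v x - mix φ u v y| ≤ φ x * |u x - u y| + (1 - φ x) * |v x - v y| +
        L * dist x y * |u y - v y| := by
      rw [e]
      refine (abs_add_three _ _ _).trans ?_
      rw [abs_mul, abs_mul, abs_mul, abs_of_nonneg h0, abs_of_nonneg (by linarith : 0 ≤ 1 - φ x)]
      gcongr
    calc _ ≤ (φ x * |u x - u y| + (1 - φ x) * |v x - v y| +
        L * dist x y * |u y - v y|) / dist x y := by gcongr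
      _ = _ := by field_simp
  have hlim : limsup (fun y => (L : ℝ≥0∞) * ENNReal.ofReal |u y - v y|) l ≤
      L * ENNReal.ofReal |u x - v x| := by
    rcases l.eq_or_neBot with h | h
    · simp [h]
    · refine (Tendsto.limsup_eq ?_).le
      refine ENNReal.Tendsto.const_mul ?_ (Or.inr (by simp))
      refine (ENNReal.continuous_ofReal.tendsto _).comp ?_
      exact (((hu.sub hv).abs).tendsto).mono_left nhdsWithin_le_nhds
  calc mSlope (mix φ u v) x ≤ _ := limsup_le_limsup key
    _ ≤ _ := ennreal_limsup_add_le _ _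
    _ ≤ _ := add_le_add (ennreal_limsup_add_le _ _) hlim
    _ = _ := by
      rw [ENNReal.limsup_const_mul_of_ne_top (by simp), ENNReal.limsup_const_mul_of_ne_top (by simp)]
      rfl

lemma LocLipOn.continuousAt {Ω : Set X} (hΩ : IsOpen Ω) {f : X → ℝ} (hf : LocLipOn Ω f) {x : X}
    (hx : x ∈ Ω) : ContinuousAt f x := by
  obtain ⟨r, hr, K, hK⟩ := hf x hx
  exact hK.continuousOn.continuousAt (inter_mem (ball_mem_nhds x hr) (hΩ.mem_nhds hx))

lemma LocLipOn.mono {Ω Ω' : Set X} {f : X → ℝ} (hf : LocLipOn Ω f) (h : Ω' ⊆ Ω) :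
    LocLipOn Ω' f := fun x hx => by
  obtain ⟨r, hr, K, hK⟩ := hf x (h hx)
  exact ⟨r, hr, K, hK.mono (inter_subset_inter_right _ h)⟩

lemma LocLipOn.of_nhds {Ω : Set X} {f : X → ℝ}
    (h : ∀ x ∈ Ω, ∃ s ∈ 𝓝 x, ∃ K : NNReal, LipschitzOnWith K f s) : LocLipOn Ω f := fun x hx => by
  obtain ⟨s, hs, K, hK⟩ := h x hx
  obtain ⟨r, hr, hrs⟩ := Metric.mem_nhds_iff.1 hs
  exact ⟨r, hr, K, hK.mono (inter_subset_left.trans hrs)⟩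

lemma LocLipOn.nhds {Ω : Set X} (hΩ : IsOpen Ω) {f : X → ℝ} (hf : LocLipOn Ω f) {x : X}
    (hx : x ∈ Ω) : ∃ s ∈ 𝓝 x, ∃ K : NNReal, LipschitzOnWith K f s := by
  obtain ⟨r, hr, K, hK⟩ := hf x hx
  exact ⟨_, inter_mem (ball_mem_nhds x hr) (hΩ.mem_nhds hx), K, hK⟩

lemma locLipOn_const (Ω : Set X) (c : ℝ) : LocLipOn Ω (fun _ => c) := fun _ _ =>
  ⟨1, one_pos, 0, LipschitzOnWith.of_dist_le_mul (by simp)⟩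

lemma LocLipOn.one_sub {Ω : Set X} {f : X → ℝ} (hf : LocLipOn Ω f) :
    LocLipOn Ω (fun x => 1 - f x) := fun x hx => by
  obtain ⟨r, hr, K, hK⟩ := hf x hx
  refine ⟨r, hr, K, LipschitzOnWith.of_dist_le_mul fun y hy z hz => ?_⟩
  rw [dist_sub_left]
  exact hK.dist_le_mul y hy z hz

lemma exists_lipschitzOnWith_mix {φ u v : X → ℝ} {L : NNReal} (hφ : LipschitzWith L φ)
    (h0 : ∀ x, 0 ≤ φ x) (h1 : ∀ x, φ x ≤ 1) {x : X}
    (hu : ∃ s ∈ 𝓝 x, ∃ K : NNReal, LipschitzOnWith K u s)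
    (hv : ∃ s ∈ 𝓝 x, ∃ K : NNReal, LipschitzOnWith K v s) :
    ∃ s ∈ 𝓝 x, ∃ K : NNReal, LipschitzOnWith K (mix φ u v) s := by
  obtain ⟨s, hs, K, hK⟩ := hu
  obtain ⟨t, ht, K', hK'⟩ := hv
  have hc : ContinuousAt (fun y => |u y - v y|) x :=
    ((hK.continuousOn.continuousAt hs).sub (hK'.continuousOn.continuousAt ht)).abs
  have hb : ∀ᶠ y in 𝓝 x, |u y - v y| < |u x - v x| + 1 :=
    hc.eventually (gt_mem_nhds (by linarith))
  set M : NNReal := ⟨|u x - v x| + 1, by positivity⟩ with hM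
  refine ⟨s ∩ t ∩ {y | |u y - v y| < |u x - v x| + 1}, inter_mem (inter_mem hs ht) hb,
    K + K' + L * M, LipschitzOnWith.of_dist_le_mul fun y hy z hz => ?_⟩
  have e : mix φ u v y - mix φ u v z =
      φ y * (u y - u z) + (1 - φ y) * (v y - v z) + (φ y - φ z) * (u z - v z) := by
    simp only [mix]; ring
  have a1 := hK.dist_le_mul y hy.1.1 z hz.1.1
  have a2 := hK'.dist_le_mul y hy.1.2 z hz.1.2
  have a3 := hφ.dist_le_mul y z
  have a4 : |u z - v z| ≤ M := le_of_lt hz.2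
  simp only [Real.dist_eq] at a1 a2 a3 ⊢
  rw [e]
  refine (abs_add_three _ _ _).trans ?_
  rw [abs_mul, abs_mul, abs_mul, abs_of_nonneg (h0 y),
    abs_of_nonneg (by linarith [h1 y] : 0 ≤ 1 - φ y)]
  push_cast
  calc _ ≤ 1 * (K * dist y z) + 1 * (K' * dist y z) + (L * dist y z) * M := by
        gcongr
        · exact h1 y
        · linarith [h0 y]
    _ = _ := by ring

lemma measurable_indicator_slopeOn [MeasurableSpace X] [BorelSpace X] {Ω : Set X}
    (hΩ : IsOpen Ω) {f : X → ℝ} (hf : ContinuousOn f Ω) :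
    Measurable (Ω.indicator (slopeOn Ω f)) := by
  set S : ℕ → X → ℝ≥0∞ := fun n x => ⨆ y ∈ ball x (1 / ((n : ℝ) + 1)) ∩ (Ω \ {x}),
    ENNReal.ofReal (|f x - f y| / dist x y) with hS
  have hb : ∀ x, slopeOn Ω f x = ⨅ n, S n x := by
    intro x
    have := (nhds_basis_ball_inv_nat_succ (x := x)).inf_principal (Ω \ {x})
    exact (this.limsup_eq_iInf_iSup).trans (by simp [hS])
  have hm : ∀ n, Measurable (Ω.indicator (S n)) := by
    intro n
    refine measurable_of_Ioi fun a => ?_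
    have : Ω.indicator (S n) ⁻¹' Ioi a = {x | x ∈ Ω ∧ a < S n x} := by
      ext x
      by_cases hx : x ∈ Ω <;> simp [hx]
    rw [this]
    refine IsOpen.measurableSet ?_
    rw [isOpen_iff_mem_nhds]
    rintro x ⟨hx, hax⟩
    simp only [hS, lt_iSup_iff] at hax
    obtain ⟨y, ⟨hy1, hy2, hy3⟩, hay⟩ := hax
    have hyx : y ≠ x := hy3
    have c1 : ∀ᶠ z in 𝓝 x, y ∈ ball z (1 / ((n : ℝ) + 1)) := by
      have : ContinuousAt (fun z => dist y z) x := by fun_prop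
      exact this.eventually (gt_mem_nhds hy1)
    have c2 : ∀ᶠ z in 𝓝 x, a < ENNReal.ofReal (|f z - f y| / dist z y) := by
      have hfx : ContinuousAt f x := hf.continuousAt (hΩ.mem_nhds hx)
      have : ContinuousAt (fun z => ENNReal.ofReal (|f z - f y| / dist z y)) x := by
        refine ENNReal.continuous_ofReal.continuousAt.comp (f := fun z => |f z - f y| / dist z y) ?_
        refine ContinuousAt.div (hfx.sub continuousAt_const).abs (by fun_prop) ?_
        exact dist_ne_zero.2 hyx.symm
      exact this.eventually (lt_mem_nhds hay)
    filter_upwards [c1, c2, hΩ.mem_nhds hx, isOpen_ne.mem_nhds hyx.symm] with z h1 h2 h3 h4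
    refine ⟨h3, h2.trans_le ?_⟩
    exact le_iSup₂_of_le y ⟨h1, hy2, fun h => h4 (by simpa using h.symm)⟩ le_rfl
  have : Ω.indicator (slopeOn Ω f) = fun x => ⨅ n, Ω.indicator (S n) x := by
    ext x
    by_cases hx : x ∈ Ω
    · simp [hx, hb]
    · simp [hx]
  rw [this]
  exact Measurable.iInf hm

lemma LocLipOn.continuousOn {Ω : Set X} (hΩ : IsOpen Ω) {f : X → ℝ} (hf : LocLipOn Ω f) :
    ContinuousOn f Ω := fun _ hx => (hf.continuousAt hΩ hx).continuousWithinAt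

end Slope



section Relaxation

variable [MetricSpace X] [MeasurableSpace X] [BorelSpace X]

lemma totVar_mono (m : Measure X) (f : X → ℝ) {A B : Set X} (h : A ⊆ B) :
    totVar m f A ≤ totVar m f B := by
  refine le_iInf fun Ω => le_iInf fun hΩ => le_iInf fun hB => ?_
  exact iInf_le_of_le Ω (iInf_le_of_le hΩ (iInf_le_of_le (h.trans hB) le_rfl))

lemma totVar_le_liminf {m : Measure X} {f : X → ℝ} {Ω : Set X} (hΩ : IsOpen Ω)
    {u : ℕ → X → ℝ} (hu : ∀ n, LocLipOn Ω (u n)) (huf : TendstoL1loc m Ω u f) :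
    totVar m f Ω ≤ liminf (fun n => ∫⁻ x in Ω, slopeOn Ω (u n) x ∂m) atTop :=
  iInf_le_of_le Ω (iInf_le_of_le hΩ (iInf_le_of_le subset_rfl
    (iInf_le_of_le u (iInf_le_of_le hu (iInf_le_of_le huf le_rfl)))))

lemma TendstoL1loc.mono {m : Measure X} {Ω Ω' : Set X} {u : ℕ → X → ℝ} {f : X → ℝ}
    (h : TendstoL1loc m Ω u f) (hs : Ω' ⊆ Ω) : TendstoL1loc m Ω' u f :=
  fun K hK hc => h K (hK.trans hs) hc

lemma tendstoL1loc_congr_ae {m : Measure X} {Ω : Set X} {u : ℕ → X → ℝ}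
    {f g : X → ℝ} (h : ∀ᵐ x ∂m, x ∈ Ω → f x = g x) (hf : TendstoL1loc m Ω u f) :
    TendstoL1loc m Ω u g := by
  intro K hK hc
  refine (hf K hK hc).congr fun n => ?_
  refine setLIntegral_congr_fun_ae hc.measurableSet ?_
  filter_upwards [h] with x hx hxK
  rw [hx (hK hxK)]

lemma totVar_congr_ae_aux {m : Measure X} {f g : X → ℝ}
    (h : ∀ᵐ x ∂m, f x = g x) (B : Set X) : totVar m f B ≤ totVar m g B := by
  refine le_iInf fun Ω => le_iInf fun hΩ => le_iInf fun hB => ?_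
  refine iInf_le_of_le Ω (iInf_le_of_le hΩ (iInf_le_of_le hB ?_))
  refine le_iInf fun u => le_iInf fun hu => le_iInf fun huf => ?_
  exact iInf_le_of_le u (iInf_le_of_le hu (iInf_le_of_le (tendstoL1loc_congr_ae
    (h.mono fun x hx _ => hx.symm) huf) le_rfl))

lemma totVar_congr_ae {m : Measure X} {f g : X → ℝ}
    (h : ∀ᵐ x ∂m, f x = g x) (B : Set X) : totVar m f B = totVar m g B :=
  le_antisymm (totVar_congr_ae_aux h B) (totVar_congr_ae_aux (h.mono fun _ hx => hx.symm) B)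

lemma slopeOn_one_sub (Ω : Set X) (f : X → ℝ) (x : X) :
    slopeOn Ω (fun y => 1 - f y) x = slopeOn Ω f x := by
  simp only [slopeOn]
  congr 1
  ext y
  rw [show 1 - f x - (1 - f y) = -(f x - f y) by ring, abs_neg]

lemma totVar_one_sub_le (m : Measure X) (f : X → ℝ) (B : Set X) :
    totVar m (fun x => 1 - f x) B ≤ totVar m f B := by
  refine le_iInf fun Ω => le_iInf fun hΩ => le_iInf fun hB => ?_
  refine iInf_le_of_le Ω (iInf_le_of_le hΩ (iInf_le_of_le hB ?_))
  refine le_iInf fun u => le_iInf fun hu => le_iInf fun huf => ?_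
  refine iInf_le_of_le (fun n x => 1 - u n x) (iInf_le_of_le (fun n => (hu n).one_sub)
    (iInf_le_of_le ?_ ?_))
  · intro K hK hc
    refine (huf K hK hc).congr fun n => ?_
    refine lintegral_congr fun x => ?_
    rw [show 1 - u n x - (1 - f x) = -(u n x - f x) by ring, abs_neg]
  · simp only [slopeOn_one_sub]
    exact le_rfl

lemma Per_compl_le (m : Measure X) (E B : Set X) : Per m Eᶜ B ≤ Per m E B := by
  have : (Eᶜ.indicator fun _ => (1:ℝ)) = fun x => 1 - E.indicator (fun _ => (1:ℝ)) x := by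
    ext x
    by_cases hx : x ∈ E <;> simp [hx]
  rw [Per, this]
  exact totVar_one_sub_le m _ B

lemma Per_compl (m : Measure X) (E B : Set X) : Per m Eᶜ B = Per m E B :=
  le_antisymm (Per_compl_le m E B) (by simpa using Per_compl_le m Eᶜ B)

lemma Per_mono (m : Measure X) (E : Set X) {A B : Set X} (h : A ⊆ B) : Per m E A ≤ Per m E B :=
  totVar_mono m _ h

lemma indicator_one_congr_ae {m : Measure X} {E F : Set X} (h : E =ᵐ[m] F) :
    ∀ᵐ x ∂m, E.indicator (fun _ => (1:ℝ)) x = F.indicator (fun _ => (1:ℝ)) x := by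
  filter_upwards [h] with x hx
  have : x ∈ E ↔ x ∈ F := iff_of_eq hx
  by_cases hxE : x ∈ E
  · simp [hxE, this.1 hxE]
  · simp [hxE, mt this.2 hxE]

lemma Per_congr_ae {m : Measure X} {E F : Set X} (h : E =ᵐ[m] F) (B : Set X) :
    Per m E B = Per m F B :=
  totVar_congr_ae (indicator_one_congr_ae h) B

lemma exists_compact_exhaustion [ProperSpace X] {Ω : Set X} (hΩ : IsOpen Ω) :
    ∃ K : ℕ → Set X, (∀ n, IsCompact (K n)) ∧ (∀ n, K n ⊆ Ω) ∧ Monotone K ∧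
      ∀ T ⊆ Ω, IsCompact T → ∃ n, T ⊆ K n := by
  have : LocallyCompactSpace Ω := hΩ.locallyCompactSpace
  have c : CompactExhaustion Ω := CompactExhaustion.choice Ω
  refine ⟨fun n => Subtype.val '' c n, fun n => (c.isCompact n).image continuous_subtype_val,
    fun n => by rintro _ ⟨x, -, rfl⟩; exact x.2, fun a b hab => image_mono (c.subset hab), ?_⟩
  intro T hT hTc
  have h1 : IsCompact (Subtype.val ⁻¹' T : Set Ω) :=
    Topology.IsInducing.subtypeVal.isCompact_preimage_iff (by simpa using hT) |>.2 hTc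
  obtain ⟨n, hn⟩ := c.exists_superset_of_isCompact h1
  refine ⟨n, fun x hx => ⟨⟨x, hT hx⟩, hn hx, rfl⟩⟩

lemma setLIntegral_slopeOn {m : Measure X} {Ω : Set X} (hΩ : IsOpen Ω) (f : X → ℝ) :
    ∫⁻ x in Ω, slopeOn Ω f x ∂m = ∫⁻ x in Ω, mSlope f x ∂m :=
  setLIntegral_congr_fun hΩ.measurableSet fun _ hx => slopeOn_eq_mSlope hΩ hx f

lemma tendstoL1loc_of_exhaustion {m : Measure X} {Ω : Set X} {u : ℕ → X → ℝ} {f : X → ℝ}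
    {K : ℕ → Set X} (hKm : Monotone K) (hKT : ∀ T ⊆ Ω, IsCompact T → ∃ n, T ⊆ K n)
    (h : ∀ n : ℕ, ∫⁻ x in K n, ENNReal.ofReal |u n x - f x| ∂m ≤ ((n : ℝ≥0∞) + 1)⁻¹) :
    TendstoL1loc m Ω u f := by
  intro T hT hTc
  obtain ⟨n, hn⟩ := hKT T hT hTc
  have h0 : Tendsto (fun n : ℕ => ((n : ℝ≥0∞) + 1)⁻¹) atTop (𝓝 0) := by
    have := (tendsto_add_atTop_iff_nat 1).2 ENNReal.tendsto_inv_nat_nhds_zero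
    simpa using this
  refine tendsto_of_tendsto_of_tendsto_of_le_of_le' tendsto_const_nhds h0
    (Eventually.of_forall fun _ => bot_le) ?_
  filter_upwards [eventually_ge_atTop n] with k hk
  exact (lintegral_mono_set (hn.trans (hKm hk))).trans (h k)

lemma exists_approx {m : Measure X} {f : X → ℝ} {Ω : Set X}
    {c : ℝ≥0∞} (hc : totVar m f Ω < c) {K : Set X} (hK : IsCompact K) (hKΩ : K ⊆ Ω)
    {ε : ℝ≥0∞} (hε : 0 < ε) :
    ∃ u, LocLipOn Ω u ∧ ∫⁻ x in K, ENNReal.ofReal |u x - f x| ∂m < ε ∧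
      ∫⁻ x in Ω, mSlope u x ∂m < c := by
  simp only [totVar, iInf_lt_iff] at hc
  obtain ⟨Ω', hΩ', hs, u, hu, huf, hlt⟩ := hc
  have h1 := frequently_lt_of_liminf_lt (by isBoundedDefault) hlt
  have h2 := (huf K (hKΩ.trans hs) hK).eventually (gt_mem_nhds hε)
  obtain ⟨n, hn1, hn2⟩ := (h1.and_eventually h2).exists
  refine ⟨u n, (hu n).mono hs, hn2, lt_of_le_of_lt ?_ hn1⟩
  rw [setLIntegral_slopeOn hΩ']
  exact lintegral_mono_set hs

/-- Recovery sequences for the total variation on an open set. -/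
lemma exists_recovery [ProperSpace X] {m : Measure X} {f : X → ℝ} {Ω : Set X} (hΩ : IsOpen Ω)
    (hf : totVar m f Ω ≠ ∞) :
    ∃ u : ℕ → X → ℝ, (∀ n, LocLipOn Ω (u n)) ∧ TendstoL1loc m Ω u f ∧
      ∀ n : ℕ, ∫⁻ x in Ω, mSlope (u n) x ∂m ≤ totVar m f Ω + ((n : ℝ≥0∞) + 1)⁻¹ := by
  obtain ⟨K, hKc, hKΩ, hKm, hKT⟩ := exists_compact_exhaustion hΩ
  have h : ∀ n : ℕ, ∃ u, LocLipOn Ω u ∧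
      ∫⁻ x in K n, ENNReal.ofReal |u x - f x| ∂m < ((n : ℝ≥0∞) + 1)⁻¹ ∧
      ∫⁻ x in Ω, mSlope u x ∂m < totVar m f Ω + ((n : ℝ≥0∞) + 1)⁻¹ := fun n =>
    exists_approx (ENNReal.lt_add_right hf (by simp)) (hKc n) (hKΩ n) (by simp)
  choose u hu1 hu2 hu3 using h
  exact ⟨u, hu1, tendstoL1loc_of_exhaustion hKm hKT fun n => (hu2 n).le, fun n => (hu3 n).le⟩

lemma totVar_le_liminf_totVar [ProperSpace X] {m : Measure X} {f : ℕ → X → ℝ} {g : X → ℝ}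
    {Ω : Set X} (hΩ : IsOpen Ω) (hf : ∀ n, Measurable (f n)) (hg : Measurable g)
    (h : TendstoL1loc m Ω f g) :
    totVar m g Ω ≤ liminf (fun n => totVar m (f n) Ω) atTop := by
  refine le_of_forall_gt_imp_ge_of_dense fun c hc => ?_
  obtain ⟨K, hKc, hKΩ, hKm, hKT⟩ := exists_compact_exhaustion hΩ
  have hfr := frequently_lt_of_liminf_lt (by isBoundedDefault) hc
  have h : ∀ n : ℕ, ∃ u, LocLipOn Ω u ∧
      ∫⁻ x in K n, ENNReal.ofReal |u x - g x| ∂m ≤ ((n : ℝ≥0∞) + 1)⁻¹ ∧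
      ∫⁻ x in Ω, mSlope u x ∂m < c := by
    intro n
    have he : (0 : ℝ≥0∞) < ((n : ℝ≥0∞) + 1)⁻¹ / 2 := by simp
    obtain ⟨k, hk1, hk2⟩ := (hfr.and_eventually ((h _ (hKΩ n) (hKc n)).eventually
      (gt_mem_nhds he))).exists
    obtain ⟨u, hu1, hu2, hu3⟩ := exists_approx hk1 (hKc n) (hKΩ n) he
    refine ⟨u, hu1, ?_, hu3⟩
    calc ∫⁻ x in K n, ENNReal.ofReal |u x - g x| ∂m
        ≤ ∫⁻ x in K n, (ENNReal.ofReal |u x - f k x| + ENNReal.ofReal |f k x - g x|) ∂m := by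
          refine lintegral_mono fun x => ?_
          rw [← ENNReal.ofReal_add (abs_nonneg _) (abs_nonneg _)]
          exact ENNReal.ofReal_le_ofReal (abs_sub_le _ _ _)
      _ = _ := lintegral_add_right _ (by have := hf k; fun_prop)
      _ ≤ ((n : ℝ≥0∞) + 1)⁻¹ / 2 + ((n : ℝ≥0∞) + 1)⁻¹ / 2 := add_le_add hu2.le hk2.le
      _ = _ := ENNReal.add_halves _
  choose u hu1 hu2 hu3 using h
  refine (totVar_le_liminf hΩ hu1 (tendstoL1loc_of_exhaustion hKm hKT hu2)).trans ?_
  refine (liminf_le_liminf (Eventually.of_forall fun n => ?_)).trans (liminf_const c).le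
  rw [setLIntegral_slopeOn hΩ]
  exact (hu3 n).le

end Relaxation


section Gluing

variable [MetricSpace X]

/-- Compatibility of a cutoff `φ` with gluing a function defined on `V₁` (used where `φ = 1`) and
a function defined on `V₂` (used where `φ = 0`), with transition region `T`. -/
def GlueOn (T V₁ V₂ : Set X) (φ : X → ℝ) (W : Set X) : Prop :=
  ∀ x ∈ W, x ∈ T ∨ (x ∈ V₁ ∧ ∀ᶠ y in 𝓝 x, φ y = 1) ∨ (x ∈ V₂ ∧ ∀ᶠ y in 𝓝 x, φ y = 0)

variable {T V₁ V₂ W W' : Set X} {φ u v : X → ℝ} {L : NNReal}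

lemma mix_eventuallyEq_left {x : X} (h : ∀ᶠ y in 𝓝 x, φ y = 1) : mix φ u v =ᶠ[𝓝 x] u := by
  filter_upwards [h] with y hy
  simp [mix, hy]

lemma mix_eventuallyEq_right {x : X} (h : ∀ᶠ y in 𝓝 x, φ y = 0) : mix φ u v =ᶠ[𝓝 x] v := by
  filter_upwards [h] with y hy
  simp [mix, hy]

lemma exists_lipschitzOnWith_congr {f g : X → ℝ} {x : X} (h : f =ᶠ[𝓝 x] g)
    (hg : ∃ s ∈ 𝓝 x, ∃ K : NNReal, LipschitzOnWith K g s) :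
    ∃ s ∈ 𝓝 x, ∃ K : NNReal, LipschitzOnWith K f s := by
  obtain ⟨s, hs, K, hK⟩ := hg
  refine ⟨s ∩ {y | f y = g y}, inter_mem hs h, K, fun y hy z hz => ?_⟩
  rw [show f y = g y from hy.2, show f z = g z from hz.2]
  exact hK hy.1 hz.1

lemma GlueOn.locLipOn (hG : GlueOn T V₁ V₂ φ W) (hφ : LipschitzWith L φ)
    (h0 : ∀ x, 0 ≤ φ x) (h1 : ∀ x, φ x ≤ 1) (hV₁ : IsOpen V₁) (hV₂ : IsOpen V₂)
    (hT₁ : T ⊆ V₁) (hT₂ : T ⊆ V₂) (hu : LocLipOn V₁ u) (hv : LocLipOn V₂ v) :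
    LocLipOn W (mix φ u v) := by
  refine LocLipOn.of_nhds fun x hx => ?_
  rcases hG x hx with h | ⟨h, hn⟩ | ⟨h, hn⟩
  · exact exists_lipschitzOnWith_mix hφ h0 h1 (hu.nhds hV₁ (hT₁ h)) (hv.nhds hV₂ (hT₂ h))
  · exact exists_lipschitzOnWith_congr (mix_eventuallyEq_left hn) (hu.nhds hV₁ h)
  · exact exists_lipschitzOnWith_congr (mix_eventuallyEq_right hn) (hv.nhds hV₂ h)

lemma GlueOn.mSlope_le (hG : GlueOn T V₁ V₂ φ W) (hφ : LipschitzWith L φ)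
    (h0 : ∀ x, 0 ≤ φ x) (h1 : ∀ x, φ x ≤ 1) (hV₁ : IsOpen V₁) (hV₂ : IsOpen V₂)
    (hT₁ : T ⊆ V₁) (hT₂ : T ⊆ V₂) (hu : LocLipOn V₁ u) (hv : LocLipOn V₂ v) (x : X) :
    W.indicator (mSlope (mix φ u v)) x ≤ ENNReal.ofReal (φ x) * V₁.indicator (mSlope u) x +
      ENNReal.ofReal (1 - φ x) * V₂.indicator (mSlope v) x +
      L * T.indicator (fun y => ENNReal.ofReal |u y - v y|) x := by
  by_cases hx : x ∈ W
  swap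
  · simp [hx]
  rw [indicator_of_mem hx]
  rcases hG x hx with h | ⟨h, hn⟩ | ⟨h, hn⟩
  · rw [indicator_of_mem (hT₁ h), indicator_of_mem (hT₂ h), indicator_of_mem h]
    exact mSlope_mix_le hφ (h0 x) (h1 x) (hu.continuousAt hV₁ (hT₁ h))
      (hv.continuousAt hV₂ (hT₂ h))
  · rw [mSlope_congr (mix_eventuallyEq_left hn), hn.self_of_nhds, indicator_of_mem h]
    simp
  · rw [mSlope_congr (mix_eventuallyEq_right hn), hn.self_of_nhds, indicator_of_mem h]
    simp

variable [MeasurableSpace X] [BorelSpace X]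

lemma GlueOn.tendstoL1loc {m : Measure X} (hG : GlueOn T V₁ V₂ φ W)
    (h0 : ∀ x, 0 ≤ φ x) (h1 : ∀ x, φ x ≤ 1) (hT₁ : T ⊆ V₁) (hT₂ : T ⊆ V₂)
    {u v : ℕ → X → ℝ} {f g : X → ℝ} (hu : TendstoL1loc m V₁ u f) (hv : TendstoL1loc m V₂ v g)
    (hf : Measurable f) (hV₁ : IsOpen V₁) (huc : ∀ n, LocLipOn V₁ (u n)) :
    TendstoL1loc m W (fun n => mix φ (u n) (v n)) (mix φ f g) := by
  intro K hK hKc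
  set K₁ := K ∩ closure {x | φ x ≠ 0}
  set K₂ := K ∩ closure {x | φ x ≠ 1}
  have hK₁ : IsCompact K₁ := hKc.inter_right isClosed_closure
  have hK₂ : IsCompact K₂ := hKc.inter_right isClosed_closure
  have e0 : ∀ x, (∀ᶠ y in 𝓝 x, φ y = 0) → x ∉ closure {x | φ x ≠ 0} := by
    intro x hx hc
    exact absurd (hx.and_frequently (mem_closure_iff_frequently.1 hc)).exists (by simp)
  have e1 : ∀ x, (∀ᶠ y in 𝓝 x, φ y = 1) → x ∉ closure {x | φ x ≠ 1} := by
    intro x hx hc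
    exact absurd (hx.and_frequently (mem_closure_iff_frequently.1 hc)).exists (by simp)
  have hs₁ : K₁ ⊆ V₁ := by
    rintro x ⟨hx, hxc⟩
    rcases hG x (hK hx) with h | ⟨h, hn⟩ | ⟨h, hn⟩
    · exact hT₁ h
    · exact h
    · exact absurd hxc (e0 x hn)
  have hs₂ : K₂ ⊆ V₂ := by
    rintro x ⟨hx, hxc⟩
    rcases hG x (hK hx) with h | ⟨h, hn⟩ | ⟨h, hn⟩
    · exact hT₂ h
    · exact absurd hxc (e1 x hn)
    · exact h
  have hlim := (hu K₁ hs₁ hK₁).add (hv K₂ hs₂ hK₂)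
  rw [add_zero] at hlim
  refine tendsto_of_tendsto_of_tendsto_of_le_of_le tendsto_const_nhds hlim (fun _ => bot_le) ?_
  intro n
  have hmeas : AEMeasurable (K₁.indicator fun x => ENNReal.ofReal |u n x - f x|)
      (m.restrict K) := by
    refine AEMeasurable.restrict ?_
    refine (aemeasurable_indicator_iff hK₁.measurableSet).2 ?_
    have : AEMeasurable (u n) (m.restrict K₁) :=
      (((huc n).continuousOn hV₁).mono hs₁).aemeasurable hK₁.measurableSet
    fun_prop
  calc ∫⁻ x in K, ENNReal.ofReal |mix φ (u n) (v n) x - mix φ f g x| ∂m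
      ≤ ∫⁻ x in K, (K₁.indicator (fun x => ENNReal.ofReal |u n x - f x|) x +
          K₂.indicator (fun x => ENNReal.ofReal |v n x - g x|) x) ∂m := by
        refine setLIntegral_mono' hKc.measurableSet fun x hx => ?_
        have e : mix φ (u n) (v n) x - mix φ f g x =
          φ x * (u n x - f x) + (1 - φ x) * (v n x - g x) := by simp only [mix]; ring
        have hb : ENNReal.ofReal |mix φ (u n) (v n) x - mix φ f g x| ≤
            ENNReal.ofReal (φ x) * ENNReal.ofReal |u n x - f x| +
            ENNReal.ofReal (1 - φ x) * ENNReal.ofReal |v n x - g x| := by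
          have h1x : 0 ≤ 1 - φ x := by linarith [h1 x]
          rw [← ENNReal.ofReal_mul (h0 x), ← ENNReal.ofReal_mul h1x,
            ← ENNReal.ofReal_add (mul_nonneg (h0 x) (abs_nonneg _))
              (mul_nonneg h1x (abs_nonneg _)), e]
          refine ENNReal.ofReal_le_ofReal ((abs_add_le _ _).trans ?_)
          rw [abs_mul, abs_mul, abs_of_nonneg (h0 x), abs_of_nonneg h1x]
        refine hb.trans (add_le_add ?_ ?_)
        · by_cases h : φ x = 0
          · simp [h]
          · have : x ∈ K₁ := ⟨hx, subset_closure h⟩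
            rw [indicator_of_mem this]
            exact mul_le_of_le_one_left bot_le (by simpa using h1 x)
        · by_cases h : φ x = 1
          · simp [h]
          · have : x ∈ K₂ := ⟨hx, subset_closure h⟩
            rw [indicator_of_mem this]
            exact mul_le_of_le_one_left bot_le (by simpa using h0 x)
    _ = _ := lintegral_add_left' hmeas _
    _ ≤ _ := by
      refine add_le_add ?_ ?_
      · rw [lintegral_indicator hK₁.measurableSet, Measure.restrict_restrict hK₁.measurableSet]
        exact lintegral_mono_set inter_subset_left
      · rw [lintegral_indicator hK₂.measurableSet, Measure.restrict_restrict hK₂.measurableSet]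
        exact lintegral_mono_set inter_subset_left

/-- Gluing two functions by a cutoff and the complementary cutoff costs, in total, only the sum of
the two variations and a transition term. -/
lemma totVar_gluing [ProperSpace X] {m : Measure X} (hφ : LipschitzWith L φ)
    (h0 : ∀ x, 0 ≤ φ x) (h1 : ∀ x, φ x ≤ 1) (hV₁ : IsOpen V₁) (hV₂ : IsOpen V₂)
    (hW : IsOpen W) (hW' : IsOpen W') (hT : IsCompact T)
    (hT₁ : T ⊆ V₁) (hT₂ : T ⊆ V₂) {f g : X → ℝ} (hf : Measurable f) (hg : Measurable g)
    (hG : GlueOn T V₁ V₂ φ W) (hG' : GlueOn T V₁ V₂ (fun x => 1 - φ x) W') :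
    totVar m (mix φ f g) W + totVar m (mix (fun x => 1 - φ x) f g) W' ≤
      totVar m f V₁ + totVar m g V₂ + 2 * L * ∫⁻ x in T, ENNReal.ofReal |f x - g x| ∂m := by
  by_cases hft : totVar m f V₁ = ∞
  · simp [hft]
  by_cases hgt : totVar m g V₂ = ∞
  · simp [hgt]
  obtain ⟨u, hu, huf, hus⟩ := exists_recovery hV₁ hft
  obtain ⟨v, hv, hvg, hvs⟩ := exists_recovery hV₂ hgt
  have hφ' : LipschitzWith L (fun x => 1 - φ x) := LipschitzWith.of_dist_le_mul fun x y => by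
    rw [dist_sub_left]; exact hφ.dist_le_mul x y
  have h0' : ∀ x, 0 ≤ 1 - φ x := fun x => by linarith [h1 x]
  have h1' : ∀ x, 1 - φ x ≤ 1 := fun x => by linarith [h0 x]
  set ε : ℕ → ℝ≥0∞ := fun n => ((n : ℝ≥0∞) + 1)⁻¹ with hε
  have hεlim : Tendsto ε atTop (𝓝 0) := by
    have := (tendsto_add_atTop_iff_nat 1).2 ENNReal.tendsto_inv_nat_nhds_zero
    simpa using this
  set a : ℕ → ℝ≥0∞ := fun n => ∫⁻ x in T, ENNReal.ofReal |u n x - f x| ∂m with ha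
  set b : ℕ → ℝ≥0∞ := fun n => ∫⁻ x in T, ENNReal.ofReal |v n x - g x| ∂m with hb
  set I := ∫⁻ x in T, ENNReal.ofReal |f x - g x| ∂m with hI
  have halim : Tendsto a atTop (𝓝 0) := huf T hT₁ hT
  have hblim : Tendsto b atTop (𝓝 0) := hvg T hT₂ hT
  set R : ℕ → ℝ≥0∞ := fun n => (totVar m f V₁ + ε n) + (totVar m g V₂ + ε n) +
    2 * L * (a n + (I + b n)) with hR
  have hRlim : Tendsto R atTop (𝓝 (totVar m f V₁ + totVar m g V₂ + 2 * L * I)) := by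
    have e1 := (((tendsto_const_nhds (x := totVar m f V₁)).add hεlim).add
      ((tendsto_const_nhds (x := totVar m g V₂)).add hεlim)).add
      (ENNReal.Tendsto.const_mul (a := 2 * (L : ℝ≥0∞))
        (halim.add ((tendsto_const_nhds (x := I)).add hblim)) (Or.inr (by finiteness)))
    simpa using e1
  have hmu : ∀ n, Measurable (V₁.indicator (mSlope (u n))) := fun n => by
    have := measurable_indicator_slopeOn hV₁ ((hu n).continuousOn hV₁)
    rwa [indicator_congr fun x hx => slopeOn_eq_mSlope hV₁ hx (u n)] at this
  have hmv : ∀ n, Measurable (V₂.indicator (mSlope (v n))) := fun n => by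
    have := measurable_indicator_slopeOn hV₂ ((hv n).continuousOn hV₂)
    rwa [indicator_congr fun x hx => slopeOn_eq_mSlope hV₂ hx (v n)] at this
  have hbound : ∀ n, (∫⁻ x in W, slopeOn W (mix φ (u n) (v n)) x ∂m) +
      (∫⁻ x in W', slopeOn W' (mix (fun x => 1 - φ x) (u n) (v n)) x ∂m) ≤ R n := by
    intro n
    have hcont : AEMeasurable (u n) (m.restrict T) :=
      (((hu n).continuousOn hV₁).mono hT₁).aemeasurable hT.measurableSet
    rw [setLIntegral_slopeOn hW, setLIntegral_slopeOn hW', ← lintegral_indicator hW.measurableSet,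
      ← lintegral_indicator hW'.measurableSet]
    refine (le_lintegral_add _ _).trans ?_
    have hTn : ∫⁻ x in T, ENNReal.ofReal |u n x - v n x| ∂m ≤ a n + (I + b n) := by
      calc ∫⁻ x in T, ENNReal.ofReal |u n x - v n x| ∂m ≤
          ∫⁻ x in T, (ENNReal.ofReal |u n x - f x| + (ENNReal.ofReal |f x - g x| +
            ENNReal.ofReal |v n x - g x|)) ∂m := by
            refine lintegral_mono fun x => ?_
            rw [← ENNReal.ofReal_add (by positivity) (by positivity),
              ← ENNReal.ofReal_add (by positivity) (by positivity)]
            refine ENNReal.ofReal_le_ofReal ?_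
            calc |u n x - v n x| = |(u n x - f x) + (f x - g x) + (g x - v n x)| := by ring_nf
              _ ≤ |u n x - f x| + |f x - g x| + |g x - v n x| := abs_add_three _ _ _
              _ = _ := by rw [abs_sub_comm (g x)]; ring
        _ = a n + (I + b n) := by
            rw [lintegral_add_left' (by fun_prop), lintegral_add_left (by fun_prop)]
    calc ∫⁻ x, W.indicator (mSlope (mix φ (u n) (v n))) x +
          W'.indicator (mSlope (mix (fun x => 1 - φ x) (u n) (v n))) x ∂m
        ≤ ∫⁻ x, (V₁.indicator (mSlope (u n)) x + V₂.indicator (mSlope (v n)) x +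
            2 * L * T.indicator (fun y => ENNReal.ofReal |u n y - v n y|) x) ∂m := by
          refine lintegral_mono fun x => ?_
          refine (add_le_add (hG.mSlope_le hφ h0 h1 hV₁ hV₂ hT₁ hT₂ (hu n) (hv n) x)
            (hG'.mSlope_le hφ' h0' h1' hV₁ hV₂ hT₁ hT₂ (hu n) (hv n) x)).trans (le_of_eq ?_)
          have e : ENNReal.ofReal (φ x) + ENNReal.ofReal (1 - φ x) = 1 := by
            rw [← ENNReal.ofReal_add (h0 x) (h0' x)]; simp
          rw [show 1 - (1 - φ x) = φ x by ring]
          set A := V₁.indicator (mSlope (u n)) x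
          set B := V₂.indicator (mSlope (v n)) x
          set Z := T.indicator (fun y => ENNReal.ofReal |u n y - v n y|) x
          calc _ = (ENNReal.ofReal (φ x) + ENNReal.ofReal (1 - φ x)) * A +
                (ENNReal.ofReal (φ x) + ENNReal.ofReal (1 - φ x)) * B + 2 * L * Z := by ring
            _ = _ := by rw [e, one_mul, one_mul]
      _ = (∫⁻ x in V₁, mSlope (u n) x ∂m) + (∫⁻ x in V₂, mSlope (v n) x ∂m) +
            2 * L * ∫⁻ x in T, ENNReal.ofReal |u n x - v n x| ∂m := by
          rw [lintegral_add_left (f := fun x => V₁.indicator (mSlope (u n)) x +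
            V₂.indicator (mSlope (v n)) x) ((hmu n).add (hmv n)), lintegral_add_left (hmu n),
            lintegral_indicator hV₁.measurableSet, lintegral_indicator hV₂.measurableSet,
            lintegral_const_mul' _ _ (by finiteness), lintegral_indicator hT.measurableSet]
      _ ≤ R n := by
          refine add_le_add (add_le_add (hus n) (hvs n)) ?_
          gcongr
  calc _ ≤ _ := add_le_add
        (totVar_le_liminf hW (fun n => hG.locLipOn hφ h0 h1 hV₁ hV₂ hT₁ hT₂ (hu n) (hv n))
          (hG.tendstoL1loc h0 h1 hT₁ hT₂ huf hvg hf hV₁ hu))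
        (totVar_le_liminf hW' (fun n => hG'.locLipOn hφ' h0' h1' hV₁ hV₂ hT₁ hT₂ (hu n) (hv n))
          (hG'.tendstoL1loc h0' h1' hT₁ hT₂ huf hvg hf hV₁ hu))
    _ ≤ _ := ennreal_add_liminf_le _ _
    _ ≤ liminf R atTop := liminf_le_liminf (Eventually.of_forall hbound)
    _ = _ := hRlim.liminf_eq

end Gluing


section Cutoff

variable [MetricSpace X]

/-- The cutoff that is `1` where `h ≤ a`, `0` where `b ≤ h`, and affine in `h` in between. -/
def cut (h : X → ℝ) (a b : ℝ) (x : X) : ℝ := max 0 (min 1 ((b - h x) / (b - a)))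

variable {h : X → ℝ} {a b : ℝ}

lemma cut_nonneg (h : X → ℝ) (a b : ℝ) (x : X) : 0 ≤ cut h a b x := le_max_left _ _

lemma cut_le_one (h : X → ℝ) (a b : ℝ) (x : X) : cut h a b x ≤ 1 :=
  max_le zero_le_one (min_le_left _ _)

lemma cut_eq_one (hab : a < b) {x : X} (hx : h x ≤ a) : cut h a b x = 1 := by
  have : 1 ≤ (b - h x) / (b - a) := by
    rw [le_div_iff₀ (by linarith)]; linarith
  simp [cut, this]

lemma cut_eq_zero (hab : a < b) {x : X} (hx : b ≤ h x) : cut h a b x = 0 := by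
  have : (b - h x) / (b - a) ≤ 0 := div_nonpos_of_nonpos_of_nonneg (by linarith) (by linarith)
  exact max_eq_left ((min_le_right _ _).trans this)

lemma lipschitzWith_cut (hh : LipschitzWith 1 h) (hab : a < b) :
    LipschitzWith (Real.toNNReal (b - a)⁻¹) (cut h a b) := by
  have hpos : 0 < b - a := by linarith
  have h1 : LipschitzWith (Real.toNNReal (b - a)⁻¹) fun x => (b - h x) / (b - a) := by
    refine LipschitzWith.of_dist_le_mul fun x y => ?_
    have := hh.dist_le_mul x y
    rw [Real.coe_toNNReal _ (by positivity), Real.dist_eq, ← sub_div, abs_div, abs_of_pos hpos,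
      show b - h x - (b - h y) = -(h x - h y) by ring, abs_neg, div_eq_inv_mul]
    gcongr
    simpa [Real.dist_eq] using this
  exact (h1.const_min 1).const_max 0

lemma cut_eventually_eq_one (hh : Continuous h) (hab : a < b) {x : X} (hx : h x < a) :
    ∀ᶠ y in 𝓝 x, cut h a b y = 1 :=
  (hh.continuousAt.eventually (gt_mem_nhds hx)).mono fun _ hy => cut_eq_one hab hy.le

lemma cut_eventually_eq_zero (hh : Continuous h) (hab : a < b) {x : X} (hx : b < h x) :
    ∀ᶠ y in 𝓝 x, cut h a b y = 0 :=
  (hh.continuousAt.eventually (lt_mem_nhds hx)).mono fun _ hy => cut_eq_zero hab hy.le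

lemma eventually_one_sub_eq_zero {φ : X → ℝ} {x : X} (h : ∀ᶠ y in 𝓝 x, φ y = 1) :
    ∀ᶠ y in 𝓝 x, 1 - φ y = 0 := h.mono fun y hy => by rw [hy, sub_self]

lemma eventually_one_sub_eq_one {φ : X → ℝ} {x : X} (h : ∀ᶠ y in 𝓝 x, φ y = 0) :
    ∀ᶠ y in 𝓝 x, 1 - φ y = 1 := h.mono fun y hy => by rw [hy, sub_zero]

lemma isCompact_annulus [ProperSpace X] (c : X) (a b : ℝ) :
    IsCompact {x : X | a ≤ dist x c ∧ dist x c ≤ b} := by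
  refine (isCompact_closedBall c b).of_isClosed_subset ?_ fun x hx => hx.2
  have hd : Continuous fun x : X => dist x c := by fun_prop
  exact (isClosed_le continuous_const hd).inter (isClosed_le hd continuous_const)

end Cutoff

section PerimeterSwap

variable [MetricSpace X] [MeasurableSpace X] [BorelSpace X]

lemma totVar_exists_open {m : Measure X} {f : X → ℝ} {B : Set X} {c : ℝ≥0∞}
    (hc : totVar m f B < c) : ∃ Ω, IsOpen Ω ∧ B ⊆ Ω ∧ totVar m f Ω < c := by
  have hc' := hc
  simp only [totVar, iInf_lt_iff] at hc
  obtain ⟨Ω, hΩ, hs, u, hu, huf, hlt⟩ := hc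
  exact ⟨Ω, hΩ, hs, (totVar_le_liminf hΩ hu huf).trans_lt hlt⟩

lemma measurable_indicator_one {E : Set X} (hE : MeasurableSet E) :
    Measurable (E.indicator fun _ => (1:ℝ)) := measurable_const.indicator hE

/-- Swapping two sets along an annulus where they coincide does not increase the total
perimeter. -/
lemma Per_swap [ProperSpace X] {m : Measure X} {V₁ V₂ F₁ F₂ G G' : Set X} {c : X} {a b : ℝ}
    (hV₁ : IsOpen V₁) (hV₂ : IsOpen V₂) (hab : a < b) (hb₁ : closedBall c b ⊆ V₁)
    (hb₂ : closedBall c b ⊆ V₂) (hF₁ : MeasurableSet F₁) (hF₂ : MeasurableSet F₂)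
    (hGi : ∀ x, dist x c ≤ b → (x ∈ G ↔ x ∈ F₁)) (hGo : ∀ x, a ≤ dist x c → (x ∈ G ↔ x ∈ F₂))
    (hGi' : ∀ x, dist x c ≤ b → (x ∈ G' ↔ x ∈ F₂))
    (hGo' : ∀ x, a ≤ dist x c → (x ∈ G' ↔ x ∈ F₁)) :
    Per m G V₂ + Per m G' V₁ ≤ Per m F₁ V₁ + Per m F₂ V₂ := by
  set h : X → ℝ := fun x => dist x c with hh
  have hhl : LipschitzWith 1 h := LipschitzWith.dist_left c
  set φ := cut h a b with hφ
  set T : Set X := {x | a ≤ dist x c ∧ dist x c ≤ b} with hT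
  have hTc : T ⊆ closedBall c b := fun x hx => hx.2
  have hG : GlueOn T V₁ V₂ φ V₂ := by
    intro x hx
    rcases lt_or_ge (h x) a with h1 | h1
    · exact Or.inr (Or.inl ⟨hb₁ (le_of_lt (h1.trans hab)),
        cut_eventually_eq_one hhl.continuous hab h1⟩)
    rcases lt_or_ge b (h x) with h2 | h2
    · exact Or.inr (Or.inr ⟨hx, cut_eventually_eq_zero hhl.continuous hab h2⟩)
    · exact Or.inl ⟨h1, h2⟩
  have hG' : GlueOn T V₁ V₂ (fun x => 1 - φ x) V₁ := by
    intro x hx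
    rcases lt_or_ge (h x) a with h1 | h1
    · exact Or.inr (Or.inr ⟨hb₂ (le_of_lt (h1.trans hab)),
        eventually_one_sub_eq_zero (cut_eventually_eq_one hhl.continuous hab h1)⟩)
    rcases lt_or_ge b (h x) with h2 | h2
    · exact Or.inr (Or.inl ⟨hx,
        eventually_one_sub_eq_one (cut_eventually_eq_zero hhl.continuous hab h2)⟩)
    · exact Or.inl ⟨h1, h2⟩
  have key := totVar_gluing (m := m) (lipschitzWith_cut hhl hab) (cut_nonneg h a b)
    (cut_le_one h a b) hV₁ hV₂ hV₂ hV₁ (isCompact_annulus c a b) (hTc.trans hb₁) (hTc.trans hb₂)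
    (measurable_indicator_one hF₁) (measurable_indicator_one hF₂) hG hG'
  have e : ∀ {A C : Set X} {x : X}, (x ∈ A ↔ x ∈ C) →
      A.indicator (fun _ => (1:ℝ)) x = C.indicator (fun _ => (1:ℝ)) x := by
    intro A C x hx
    by_cases hA : x ∈ A
    · simp [hA, hx.1 hA]
    · simp [hA, mt hx.2 hA]
  have e1 : mix φ (F₁.indicator fun _ => (1:ℝ)) (F₂.indicator fun _ => (1:ℝ)) =
      G.indicator fun _ => (1:ℝ) := by
    ext x
    rcases lt_or_ge (h x) a with h1 | h1
    · rw [mix, hφ, cut_eq_one hab h1.le, e (hGi x (h1.trans hab).le)]; ring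
    rcases lt_or_ge b (h x) with h2 | h2
    · rw [mix, hφ, cut_eq_zero hab h2.le, e (hGo x h1)]; ring
    · rw [mix, ← e (hGi x h2), ← e (hGo x h1)]; ring
  have e2 : mix (fun x => 1 - φ x) (F₁.indicator fun _ => (1:ℝ)) (F₂.indicator fun _ => (1:ℝ)) =
      G'.indicator fun _ => (1:ℝ) := by
    ext x
    rcases lt_or_ge (h x) a with h1 | h1
    · rw [mix, hφ, cut_eq_one hab h1.le, e (hGi' x (h1.trans hab).le)]; ring
    rcases lt_or_ge b (h x) with h2 | h2
    · rw [mix, hφ, cut_eq_zero hab h2.le, e (hGo' x h1)]; ring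
    · rw [mix, ← e (hGi' x h2), ← e (hGo' x h1)]; ring
  have e3 : ∫⁻ x in T, ENNReal.ofReal
      |F₁.indicator (fun _ => (1:ℝ)) x - F₂.indicator (fun _ => (1:ℝ)) x| ∂m = 0 := by
    rw [setLIntegral_congr_fun (isCompact_annulus c a b).measurableSet (g := fun _ => 0)]
    · simp
    · intro x hx
      simp only
      rw [← e (hGi x hx.2), ← e (hGo x hx.1)]
      simp
  rw [e1, e2, e3, mul_zero, add_zero] at key
  exact key

lemma totVar_const (m : Measure X) (c : ℝ) (B : Set X) : totVar m (fun _ => c) B = 0 := by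
  refine le_antisymm ((totVar_mono m _ (subset_univ B)).trans ?_) bot_le
  refine (totVar_le_liminf isOpen_univ (u := fun _ _ => c) (fun _ => locLipOn_const _ c) ?_).trans
    ?_
  · intro K _ _
    simp
  · simp only [setLIntegral_slopeOn isOpen_univ, mSlope_const]
    simp

lemma exists_open_Per_lt_top_union [ProperSpace X] {m : Measure X} [IsLocallyFiniteMeasure m]
    {E K₁ K₂ U₁ U₂ : Set X} (hE : MeasurableSet E)
    (hK₁ : IsCompact K₁) (hK₂ : IsCompact K₂) (hU₁ : IsOpen U₁) (hU₂ : IsOpen U₂)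
    (h₁ : K₁ ⊆ U₁) (h₂ : K₂ ⊆ U₂) (hP₁ : Per m E U₁ < ∞) (hP₂ : Per m E U₂ < ∞) :
    ∃ U, IsOpen U ∧ K₁ ∪ K₂ ⊆ U ∧ Per m E U < ∞ := by
  rcases K₁.eq_empty_or_nonempty with rfl | hne
  · exact ⟨U₂, hU₂, by simpa using h₂, hP₂⟩
  obtain ⟨δ, hδ, hδU⟩ := hK₁.exists_cthickening_subset_open hU₁ h₁
  obtain ⟨ε, hε, hεU⟩ := hK₂.exists_cthickening_subset_open hU₂ h₂
  set h : X → ℝ := fun x => infDist x K₁ with hh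
  have hhl : LipschitzWith 1 h := lipschitz_infDist_pt K₁
  have hab : δ / 2 < δ := by linarith
  set φ := cut h (δ / 2) δ with hφ
  set T : Set X := cthickening ε K₂ ∩ {x | h x ≤ δ} with hT
  have hTcpt : IsCompact T :=
    hK₂.cthickening.inter_right (isClosed_le hhl.continuous continuous_const)
  have hmem : ∀ x, h x ≤ δ → x ∈ cthickening δ K₁ := fun x hx => by
    rw [mem_cthickening_iff]
    rw [ENNReal.le_ofReal_iff_toReal_le (infEDist_ne_top hne) hδ.le]
    exact hx
  have hT₁ : T ⊆ U₁ := fun x hx => hδU (hmem x hx.2)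
  have hT₂ : T ⊆ U₂ := fun x hx => hεU hx.1
  set W := {x | h x < δ / 2} ∪ thickening ε K₂ with hW
  have hWo : IsOpen W := (isOpen_lt hhl.continuous continuous_const).union isOpen_thickening
  have hG : GlueOn T U₁ U₂ φ W := by
    intro x hx
    rcases lt_or_ge (h x) (δ / 2) with h1 | h1
    · exact Or.inr (Or.inl ⟨hδU (hmem x (h1.trans hab).le),
        cut_eventually_eq_one hhl.continuous hab h1⟩)
    have hx2 : x ∈ cthickening ε K₂ := by
      rcases hx with hx | hx
      · exact absurd hx (not_lt.2 h1)
      · exact thickening_subset_cthickening _ _ hx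
    rcases lt_or_ge δ (h x) with h2 | h2
    · exact Or.inr (Or.inr ⟨hεU hx2, cut_eventually_eq_zero hhl.continuous hab h2⟩)
    · exact Or.inl ⟨hx2, h2⟩
  refine ⟨W, hWo, union_subset (fun x hx => Or.inl ?_)
    ((self_subset_thickening hε K₂).trans subset_union_right), ?_⟩
  · change infDist x K₁ < δ / 2
    rw [infDist_zero_of_mem hx]
    linarith
  have key := totVar_gluing (m := m) (W' := ∅) (lipschitzWith_cut hhl hab) (cut_nonneg h _ _)
    (cut_le_one h _ _) hU₁ hU₂ hWo isOpen_empty hTcpt hT₁ hT₂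
    (measurable_indicator_one hE) (measurable_indicator_one hE) hG (fun x hx => absurd hx (by simp))
  have e1 : mix φ (E.indicator fun _ => (1:ℝ)) (E.indicator fun _ => (1:ℝ)) =
      E.indicator fun _ => (1:ℝ) := by
    ext x; simp only [mix]; ring
  rw [e1] at key
  simp only [sub_self, abs_zero, ENNReal.ofReal_zero, lintegral_zero, mul_zero, add_zero] at key
  exact (le_self_add.trans key).trans_lt (ENNReal.add_lt_top.2 ⟨hP₁, hP₂⟩)

lemma Per_ball_lt_top [ProperSpace X] {m : Measure X} [IsLocallyFiniteMeasure m]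
    {E : Set X} (hE : MeasurableSet E) (hP : HasLocFinPer m E) (x : X) (r : ℝ) :
    Per m E (closedBall x r) < ∞ := by
  have : ∃ K, IsCompact K ∧ closedBall x r ⊆ K ∧ ∃ U, IsOpen U ∧ K ⊆ U ∧ Per m E U < ∞ := by
    refine (isCompact_closedBall x r).induction_on
      (p := fun s => ∃ K, IsCompact K ∧ s ⊆ K ∧ ∃ U, IsOpen U ∧ K ⊆ U ∧ Per m E U < ∞) ?_ ?_ ?_ ?_
    · obtain ⟨δ, hδ, h⟩ := hP x
      exact ⟨∅, isCompact_empty, subset_rfl, _, isOpen_ball, empty_subset _, h⟩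
    · rintro s t hst ⟨K, hK, h1, h2⟩
      exact ⟨K, hK, hst.trans h1, h2⟩
    · rintro s t ⟨K₁, hK₁, hs, U₁, hU₁, h₁, hP₁⟩ ⟨K₂, hK₂, ht, U₂, hU₂, h₂, hP₂⟩
      exact ⟨K₁ ∪ K₂, hK₁.union hK₂, union_subset_union hs ht,
        exists_open_Per_lt_top_union hE hK₁ hK₂ hU₁ hU₂ h₁ h₂ hP₁ hP₂⟩
    · intro y _
      obtain ⟨δ, hδ, h⟩ := hP y
      refine ⟨_, mem_nhdsWithin_of_mem_nhds (ball_mem_nhds y (half_pos hδ)), closedBall y (δ / 2),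
        isCompact_closedBall _ _, ball_subset_closedBall, ball y δ, isOpen_ball,
        closedBall_subset_ball (by linarith), h⟩
  obtain ⟨K, -, hK, U, -, hKU, hPU⟩ := this
  exact (Per_mono m E (hK.trans hKU)).trans_lt hPU

/-- A volume-constrained minimizer has least perimeter in open balls among competitors that differ
from it only well inside the ball. -/
lemma VolConstMin.Per_ball_le [ProperSpace X] {m : Measure X} [IsLocallyFiniteMeasure m]
    {E F : Set X} (hE : VolConstMin m E) (hF : MeasurableSet F) {p : X} {c ρ : ℝ} (hc : c < ρ)
    (hFE : ∀ x, c < dist x p → (x ∈ F ↔ x ∈ E))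
    (hvol : m (E ∩ closedBall p ρ) = m (F ∩ closedBall p ρ)) :
    Per m E (ball p ρ) ≤ Per m F (ball p ρ) := by
  set K := closedBall p ρ
  have hEF : Per m E K ≤ Per m F K := by
    refine hE.2.2 F K hF (isCompact_closedBall p ρ) ?_ hvol
    rw [show (E ∆ F) \ K = ∅ from ?_, measure_empty]
    ext x
    simp only [mem_empty_iff_false, iff_false]
    rintro ⟨hx, hxK⟩
    have : x ∈ F ↔ x ∈ E := hFE x (hc.trans (not_le.1 hxK))
    rcases hx with ⟨h1, h2⟩ | ⟨h1, h2⟩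
    · exact h2 (this.2 h1)
    · exact h2 (this.1 h1)
  have hfin : Per m E K ≠ ∞ := (Per_ball_lt_top hE.1 hE.2.1 p ρ).ne
  refine ENNReal.le_of_forall_pos_le_add fun ε hε _ => ?_
  obtain ⟨Ω, hΩ, hKΩ, hΩP⟩ := totVar_exists_open (m := m)
    (f := E.indicator fun _ => (1:ℝ)) (B := K) (c := Per m E K + ε)
    (ENNReal.lt_add_right hfin (by simpa using hε.ne'))
  obtain ⟨a, hca, haρ⟩ := exists_between hc
  obtain ⟨b, hab, hbρ⟩ := exists_between haρ
  have hsw := Per_swap (m := m) (V₁ := ball p ρ) (V₂ := Ω) (F₁ := F) (F₂ := E) (G := F) (G' := E)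
    (c := p) isOpen_ball hΩ hab (closedBall_subset_ball hbρ)
    ((closedBall_subset_closedBall hbρ.le).trans hKΩ) hF hE.1 (fun _ _ => Iff.rfl)
    (fun x hx => hFE x (hca.trans_le hx)) (fun _ _ => Iff.rfl)
    (fun x hx => (hFE x (hca.trans_le hx)).symm)
  have h3 : Per m E K + Per m E (ball p ρ) ≤ Per m E K + (Per m F (ball p ρ) + ε) := by
    calc Per m E K + Per m E (ball p ρ) ≤ Per m F Ω + Per m E (ball p ρ) :=
          add_le_add (hEF.trans (Per_mono m F hKΩ)) le_rfl
      _ ≤ Per m F (ball p ρ) + Per m E Ω := hsw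
      _ ≤ Per m F (ball p ρ) + (Per m E K + ε) := add_le_add le_rfl hΩP.le
      _ = _ := by ring
  exact (ENNReal.add_le_add_iff_left hfin).1 h3

end PerimeterSwap


section CutLemma

lemma exists_dyadic_nested (M : ℝ → ℝ → ℝ≥0∞)
    (hM : ∀ a c b, a < c → c < b → M a c + M c b = M a b) {r₁ r₂ : ℝ} (h : r₁ < r₂) :
    ∃ (a b : ℕ → ℝ) (s : ℝ), s ∈ Icc r₁ r₂ ∧ (∀ n, r₁ ≤ a n) ∧ (∀ n, b n ≤ r₂) ∧ (∀ n, a n ≤ s) ∧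
      (∀ n, s ≤ b n) ∧ (∀ n, b n - a n = (r₂ - r₁) / 2 ^ n) ∧
      ∀ n, M (a n) (b n) ≤ M r₁ r₂ / 2 ^ n := by
  classical
  set step : ℝ × ℝ → ℝ × ℝ := fun p =>
    if M p.1 ((p.1 + p.2) / 2) ≤ M p.1 p.2 / 2 then (p.1, (p.1 + p.2) / 2)
    else ((p.1 + p.2) / 2, p.2) with hstep
  set p : ℕ → ℝ × ℝ := fun n => step^[n] (r₁, r₂) with hp
  have hps : ∀ n, p (n + 1) = step (p n) := fun n => Function.iterate_succ_apply' _ _ _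
  have hlen : ∀ n, (p n).2 - (p n).1 = (r₂ - r₁) / 2 ^ n := by
    intro n
    induction n with
    | zero => simp [hp]
    | succ n ih =>
      rw [hps, hstep]
      simp only
      rw [pow_succ, ← div_div, ← ih]
      split_ifs <;> simp only <;> ring
  have hlt : ∀ n, (p n).1 < (p n).2 := fun n => by
    have : 0 < (r₂ - r₁) / 2 ^ n := div_pos (by linarith) (by positivity)
    linarith [hlen n]
  have ha : Monotone fun n => (p n).1 := monotone_nat_of_le_succ fun n => by
    have := hlt n
    rw [hps, hstep]
    simp only
    split_ifs <;> simp only <;> linarith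
  have hb : Antitone fun n => (p n).2 := antitone_nat_of_succ_le fun n => by
    have := hlt n
    rw [hps, hstep]
    simp only
    split_ifs <;> simp only <;> linarith
  have hMn : ∀ n, M (p n).1 (p n).2 ≤ M r₁ r₂ / 2 ^ n := by
    intro n
    induction n with
    | zero => simp [hp]
    | succ n ih =>
      have h2 : M (p n).1 (p n).2 / 2 ≤ M r₁ r₂ / 2 ^ (n + 1) := by
        rw [pow_succ, ENNReal.div_eq_inv_mul, ENNReal.div_eq_inv_mul,
          ENNReal.mul_inv (Or.inr (by simp)) (Or.inr (by simp)), mul_comm (2 ^ n)⁻¹, mul_assoc]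
        gcongr
        rwa [← ENNReal.div_eq_inv_mul]
      refine le_trans ?_ h2
      have hlt' := hlt n
      rw [hps, hstep]
      simp only
      split_ifs with hc
      · exact hc
      · simp only
        by_contra hcon
        push Not at hc hcon
        have e := hM (p n).1 (((p n).1 + (p n).2) / 2) (p n).2 (by linarith) (by linarith)
        have := ENNReal.add_lt_add hc hcon
        rw [ENNReal.add_halves, e] at this
        exact lt_irrefl _ this
  have hab : ∀ k n, (p k).1 ≤ (p n).2 := fun k n =>
    (ha (le_max_left k n)).trans ((hlt _).le.trans (hb (le_max_right k n)))
  have hbdd : BddAbove (range fun n => (p n).1) := ⟨r₂, by rintro _ ⟨k, rfl⟩; exact hab k 0⟩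
  refine ⟨fun n => (p n).1, fun n => (p n).2, ⨆ n, (p n).1,
    ⟨le_ciSup hbdd 0, ciSup_le fun k => hab k 0⟩, fun n => ha (Nat.zero_le n),
    fun n => hb (Nat.zero_le n), fun n => le_ciSup hbdd n, fun n => ciSup_le fun k => hab k n,
    hlen, hMn⟩

variable [MetricSpace X] [MeasurableSpace X] [BorelSpace X]

lemma ennreal_div_two_pow_tendsto {c : ℝ≥0∞} (hc : c ≠ ∞) :
    Tendsto (fun n : ℕ => c / 2 ^ n) atTop (𝓝 0) := by
  have h : Tendsto (fun n : ℕ => ((2 : ℝ≥0∞)⁻¹) ^ n) atTop (𝓝 0) :=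
    ENNReal.tendsto_pow_atTop_nhds_zero_of_lt_one (by simp)
  have := ENNReal.Tendsto.const_mul (a := c) h (Or.inr hc)
  simpa [ENNReal.div_eq_inv_mul, mul_comm, ENNReal.inv_pow] using this

/-- There is a good radius along which the boundary created by cutting `E` with a ball is
controlled by the volume of `E`. -/
lemma exists_Per_cut_le [ProperSpace X] {m : Measure X} [IsLocallyFiniteMeasure m]
    {E V : Set X} (hE : MeasurableSet E) (hV : IsOpen V) {x : X} {r₁ r₂ : ℝ} (h : r₁ < r₂)
    (hxV : closedBall x r₂ ⊆ V) :
    ∃ s ∈ Icc r₁ r₂, Per m (E ∩ ball x s) V + Per m (E \ ball x s) V ≤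
      Per m E V + ENNReal.ofReal (6 / (r₂ - r₁)) * m (E ∩ ball x r₂) := by
  set A : ℝ → ℝ → Set X := fun a b => E ∩ {y | a ≤ dist y x ∧ dist y x < b} with hA
  have hd : Continuous fun y : X => dist y x := by fun_prop
  have hAm : ∀ a b, MeasurableSet (A a b) := fun a b =>
    hE.inter ((isClosed_le continuous_const hd).measurableSet.inter
      (isOpen_lt hd continuous_const).measurableSet)
  obtain ⟨a, b, s, hs, har, hbr, has, hsb, hlen, hmass⟩ :=
    exists_dyadic_nested (fun a b => m (A a b)) (fun a c b hac hcb => by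
      rw [← measure_union _ (hAm c b)]
      · congr 1
        ext y
        simp only [hA, mem_union, mem_inter_iff, mem_ofPred_eq]
        constructor
        · rintro (⟨h1, h2, h3⟩ | ⟨h1, h2, h3⟩)
          · exact ⟨h1, h2, h3.trans hcb⟩
          · exact ⟨h1, hac.le.trans h2, h3⟩
        · rintro ⟨h1, h2, h3⟩
          rcases lt_or_ge (dist y x) c with h4 | h4
          · exact Or.inl ⟨h1, h2, h4⟩
          · exact Or.inr ⟨h1, h4, h3⟩
      · rw [Set.disjoint_left]
        rintro y ⟨-, -, h1⟩ ⟨-, h2, -⟩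
        exact absurd h1 (not_lt.2 h2)) h
  set M₀ := m (A r₁ r₂) with hM₀
  have hM₀le : M₀ ≤ m (E ∩ ball x r₂) := measure_mono fun y hy => ⟨hy.1, hy.2.2⟩
  have hM₀fin : M₀ ≠ ∞ := ne_top_of_le_ne_top
    ((measure_mono (inter_subset_right.trans ball_subset_closedBall)).trans_lt
      (isCompact_closedBall x r₂).measure_lt_top).ne hM₀le
  refine ⟨s, hs, ?_⟩
  set χ : X → ℝ := E.indicator fun _ => (1:ℝ) with hχ
  set f : X → ℝ := fun y => dist y x with hf
  have hfl : LipschitzWith 1 f := LipschitzWith.dist_left x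
  have hpos : ∀ n, 0 < b n - a n := fun n => by
    rw [hlen]; exact div_pos (by linarith) (by positivity)
  set a' : ℕ → ℝ := fun n => a n + (b n - a n) / 3 with ha'
  set b' : ℕ → ℝ := fun n => b n - (b n - a n) / 3 with hb'
  have hab' : ∀ n, a' n < b' n := fun n => by simp only [ha', hb']; linarith [hpos n]
  set φ : ℕ → X → ℝ := fun n => cut f (a' n) (b' n) with hφ
  set u : ℕ → X → ℝ := fun n => mix (φ n) χ fun _ => 0 with hu
  set v : ℕ → X → ℝ := fun n => mix (fun y => 1 - φ n y) χ fun _ => 0 with hv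
  have hφc : ∀ n, Continuous (φ n) := fun n => (lipschitzWith_cut hfl (hab' n)).continuous
  have hχm : Measurable χ := measurable_indicator_one hE
  have hum : ∀ n, Measurable (u n) := fun n => by
    have := (hφc n).measurable
    simp only [hu]; unfold mix; fun_prop
  have hvm : ∀ n, Measurable (v n) := fun n => by
    have := (hφc n).measurable
    simp only [hv]; unfold mix; fun_prop
  have hcmp : ∀ n, totVar m (u n) V + totVar m (v n) V ≤
      Per m E V + ENNReal.ofReal (6 / (r₂ - r₁)) * M₀ := by
    intro n
    set T : Set X := {y | a' n ≤ dist y x ∧ dist y x ≤ b' n} with hT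
    have hTV : T ⊆ V := fun y hy => hxV (by
      have h1 : dist y x ≤ b' n := hy.2
      have : b' n ≤ r₂ := by simp only [hb']; linarith [hpos n, hbr n]
      exact h1.trans this)
    have hcV : ∀ y, f y < a' n → y ∈ V := fun y hy => hxV (by
      have : b' n ≤ r₂ := by simp only [hb']; linarith [hpos n, hbr n]
      exact (hy.trans (hab' n)).le.trans this)
    have hG : GlueOn T V univ (φ n) V := by
      intro y hy
      rcases lt_or_ge (f y) (a' n) with h1 | h1
      · exact Or.inr (Or.inl ⟨hy, cut_eventually_eq_one hfl.continuous (hab' n) h1⟩)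
      rcases lt_or_ge (b' n) (f y) with h2 | h2
      · exact Or.inr (Or.inr ⟨trivial, cut_eventually_eq_zero hfl.continuous (hab' n) h2⟩)
      · exact Or.inl ⟨h1, h2⟩
    have hG' : GlueOn T V univ (fun y => 1 - φ n y) V := by
      intro y hy
      rcases lt_or_ge (f y) (a' n) with h1 | h1
      · exact Or.inr (Or.inr ⟨trivial, eventually_one_sub_eq_zero
          (cut_eventually_eq_one hfl.continuous (hab' n) h1)⟩)
      rcases lt_or_ge (b' n) (f y) with h2 | h2
      · exact Or.inr (Or.inl ⟨hy, eventually_one_sub_eq_one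
          (cut_eventually_eq_zero hfl.continuous (hab' n) h2)⟩)
      · exact Or.inl ⟨h1, h2⟩
    have key := totVar_gluing (m := m) (lipschitzWith_cut hfl (hab' n)) (cut_nonneg f _ _)
      (cut_le_one f _ _) hV isOpen_univ hV hV (isCompact_annulus x _ _) hTV (subset_univ _)
      hχm (measurable_const (a := (0:ℝ))) hG hG'
    rw [totVar_const, add_zero] at key
    refine key.trans (add_le_add le_rfl ?_)
    have hTi : ∫⁻ y in T, ENNReal.ofReal |χ y - 0| ∂m ≤ M₀ / 2 ^ n := by
      have e : ∀ y, ENNReal.ofReal |χ y - 0| = E.indicator (fun _ => (1:ℝ≥0∞)) y := fun y => by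
        by_cases hy : y ∈ E <;> simp [hχ, hy]
      simp only [e]
      rw [lintegral_indicator hE, setLIntegral_const, one_mul,
        Measure.restrict_apply hE]
      refine (measure_mono fun y hy => ?_).trans (hmass n)
      refine ⟨hy.1, ?_, ?_⟩
      · have : a' n ≤ dist y x := hy.2.1
        simp only [ha'] at this
        linarith [hpos n]
      · have : dist y x ≤ b' n := hy.2.2
        simp only [hb'] at this
        linarith [hpos n]
    have hL : 2 * ((Real.toNNReal (b' n - a' n)⁻¹ : NNReal) : ℝ≥0∞) =
        ENNReal.ofReal (6 / (r₂ - r₁)) * 2 ^ n := by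
      have e : (b' n - a' n)⁻¹ = 3 / (r₂ - r₁) * 2 ^ n := by
        have : b' n - a' n = (b n - a n) / 3 := by simp only [ha', hb']; ring
        rw [this, hlen]
        have : r₂ - r₁ ≠ 0 := by linarith
        field_simp
      have h2 : (2 : ℝ≥0∞) ^ n = ENNReal.ofReal (2 ^ n) := by
        rw [ENNReal.ofReal_pow (by norm_num)]; simp
      have h3 : 0 ≤ 6 / (r₂ - r₁) := div_nonneg (by norm_num) (by linarith)
      rw [show ((Real.toNNReal (b' n - a' n)⁻¹ : NNReal) : ℝ≥0∞) =
        ENNReal.ofReal (b' n - a' n)⁻¹ from rfl, e, h2, ← ENNReal.ofReal_mul h3,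
        show (2 : ℝ≥0∞) = ENNReal.ofReal 2 by simp, ← ENNReal.ofReal_mul (by norm_num)]
      congr 1
      ring
    calc _ ≤ ENNReal.ofReal (6 / (r₂ - r₁)) * 2 ^ n * (M₀ / 2 ^ n) := by
          rw [← hL]; gcongr
      _ = _ := by
        rw [mul_assoc, ENNReal.mul_div_cancel (by simp) (by finiteness)]
  have hconv : ∀ (w : ℕ → X → ℝ) (G : Set X),
      (∀ n y, ENNReal.ofReal |w n y - G.indicator (fun _ => (1:ℝ)) y| ≤
        (A (a n) (b n)).indicator (fun _ => (1:ℝ≥0∞)) y) →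
      TendstoL1loc m V w (G.indicator fun _ => (1:ℝ)) := by
    intro w G hw K _ _
    refine tendsto_of_tendsto_of_tendsto_of_le_of_le tendsto_const_nhds
      (ennreal_div_two_pow_tendsto hM₀fin) (fun _ => bot_le) fun n => ?_
    calc _ ≤ ∫⁻ y, ENNReal.ofReal |w n y - G.indicator (fun _ => (1:ℝ)) y| ∂m :=
          setLIntegral_le_lintegral _ _
      _ ≤ ∫⁻ y, (A (a n) (b n)).indicator (fun _ => (1:ℝ≥0∞)) y ∂m := lintegral_mono (hw n)
      _ = m (A (a n) (b n)) := by rw [lintegral_indicator (hAm _ _)]; simp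
      _ ≤ _ := hmass n
  have hcases : ∀ n y, (y ∈ E ∧ y ∉ A (a n) (b n)) →
      (dist y x < s ∧ φ n y = 1) ∨ (¬ dist y x < s ∧ φ n y = 0) := by
    rintro n y ⟨hyE, hyA⟩
    have hyA' : a n ≤ dist y x → b n ≤ dist y x := fun h1 => by
      by_contra h2
      exact hyA ⟨hyE, h1, not_le.1 h2⟩
    rcases lt_or_ge (dist y x) (a n) with h1 | h1
    · refine Or.inl ⟨h1.trans_le (has n), cut_eq_one (hab' n) ?_⟩
      simp only [ha', hf]; linarith [hpos n]
    · have h2 := hyA' h1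
      refine Or.inr ⟨not_lt.2 ((hsb n).trans h2), cut_eq_zero (hab' n) ?_⟩
      simp only [hb', hf]; linarith [hpos n]
  have hui := hconv u (E ∩ ball x s) fun n y => by
    by_cases hyE : y ∈ E
    swap
    · simp [hu, mix, hχ, hyE]
    by_cases hyA : y ∈ A (a n) (b n)
    · rw [indicator_of_mem hyA, ENNReal.ofReal_le_one, abs_le]
      have h0 := cut_nonneg f (a' n) (b' n) y
      have h1 := cut_le_one f (a' n) (b' n) y
      by_cases hs : y ∈ ball x s
      · simp only [hu, mix, hχ, hφ, indicator_of_mem hyE, indicator_of_mem (show y ∈ E ∩ ball x s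
          from ⟨hyE, hs⟩)]
        constructor <;> linarith
      · simp only [hu, mix, hχ, hφ, indicator_of_mem hyE, indicator_of_notMem
          (show y ∉ E ∩ ball x s from fun h => hs h.2)]
        constructor <;> linarith
    · rcases hcases n y ⟨hyE, hyA⟩ with ⟨h1, h2⟩ | ⟨h1, h2⟩
      · have : y ∈ ball x s := h1
        simp [hu, mix, hχ, hyE, h2, this]
      · have : y ∉ ball x s := h1
        simp [hu, mix, hχ, hyE, h2, this]
  have hvi := hconv v (E \ ball x s) fun n y => by
    by_cases hyE : y ∈ E
    swap
    · simp [hv, mix, hχ, hyE]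
    by_cases hyA : y ∈ A (a n) (b n)
    · rw [indicator_of_mem hyA, ENNReal.ofReal_le_one, abs_le]
      have h0 := cut_nonneg f (a' n) (b' n) y
      have h1 := cut_le_one f (a' n) (b' n) y
      by_cases hs : y ∈ ball x s
      · simp only [hv, mix, hχ, hφ, indicator_of_mem hyE, indicator_of_notMem
          (show y ∉ E \ ball x s from fun h => h.2 hs)]
        constructor <;> linarith
      · simp only [hv, mix, hχ, hφ, indicator_of_mem hyE, indicator_of_mem
          (show y ∈ E \ ball x s from ⟨hyE, hs⟩)]
        constructor <;> linarith
    · rcases hcases n y ⟨hyE, hyA⟩ with ⟨h1, h2⟩ | ⟨h1, h2⟩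
      · have : y ∈ ball x s := h1
        simp [hv, mix, hχ, hyE, h2, this]
      · have : y ∉ ball x s := h1
        simp [hv, mix, hχ, hyE, h2, this]
  have hm1 : Measurable ((E ∩ ball x s).indicator fun _ => (1:ℝ)) :=
    measurable_indicator_one (hE.inter measurableSet_ball)
  have hm2 : Measurable ((E \ ball x s).indicator fun _ => (1:ℝ)) :=
    measurable_indicator_one (hE.diff measurableSet_ball)
  calc _ ≤ _ := add_le_add (totVar_le_liminf_totVar hV hum hm1 hui)
        (totVar_le_liminf_totVar hV hvm hm2 hvi)
    _ ≤ _ := ennreal_add_liminf_le _ _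
    _ ≤ liminf (fun _ : ℕ => Per m E V + ENNReal.ofReal (6 / (r₂ - r₁)) * M₀) atTop :=
        liminf_le_liminf (Eventually.of_forall hcmp)
    _ = _ := liminf_const _
    _ ≤ _ := by gcongr

end CutLemma


section Poincare

variable [MetricSpace X] [MeasurableSpace X]

/-- The quantitative local doubling and Poincaré properties at scales below `1`, together with
positivity and finiteness of the measure of balls. -/
structure PIConst (m : Measure X) (D lam Cp : ℝ) : Prop where
  two_le_D : 2 ≤ D
  one_le_lam : 1 ≤ lam
  Cp_pos : 0 < Cp
  ball_lt_top : ∀ x r, m (ball x r) < ∞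
  ball_pos : ∀ x r, 0 < r → 0 < m (ball x r)
  doubling : ∀ x r, 0 < r → r < 1 → m (ball x (2 * r)) ≤ ENNReal.ofReal D * m (ball x r)
  poincare : ∀ f : X → ℝ, LocLipOn univ f → ∀ x r, 0 < r → r < 1 →
    ∫⁻ y in ball x r, ENNReal.ofReal |f y - ⨍ z in ball x r, f z ∂m| ∂m ≤
      ENNReal.ofReal (Cp * r) * ∫⁻ y in ball x (lam * r), mSlope f y ∂m

variable {m : Measure X} {D lam Cp : ℝ}

lemma PIConst.doubling_iter (h : PIConst m D lam Cp) (x : X) {r : ℝ} (hr : 0 < r) (k : ℕ)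
    (hk : 2 ^ k * r ≤ 1) : m (ball x (2 ^ k * r)) ≤ ENNReal.ofReal D ^ k * m (ball x r) := by
  induction k with
  | zero => simp
  | succ k ih =>
    have h2 : (0:ℝ) < 2 ^ k * r := by positivity
    have hk' : 2 ^ k * r < 1 := by rw [pow_succ] at hk; linarith
    calc m (ball x (2 ^ (k + 1) * r)) = m (ball x (2 * (2 ^ k * r))) := by rw [pow_succ]; ring_nf
      _ ≤ ENNReal.ofReal D * m (ball x (2 ^ k * r)) := h.doubling _ _ h2 hk'
      _ ≤ ENNReal.ofReal D * (ENNReal.ofReal D ^ k * m (ball x r)) := by gcongr; exact ih hk'.le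
      _ = _ := by rw [pow_succ]; ring

variable [BorelSpace X]

lemma PIConst.poincare_local [ProperSpace X] (h : PIConst m D lam Cp) {Ω : Set X} (hΩ : IsOpen Ω)
    {u : X → ℝ} (hu : LocLipOn Ω u) {x : X} {r : ℝ} (hr : 0 < r) (hr1 : r < 1)
    (hx : closedBall x (2 * lam * r) ⊆ Ω) :
    ∃ c : ℝ, ∫⁻ y in ball x r, ENNReal.ofReal |u y - c| ∂m ≤
      ENNReal.ofReal (Cp * r) * ∫⁻ y in ball x (lam * r), mSlope u y ∂m := by
  set d : X → ℝ := fun y => dist y x with hd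
  have hdL : LipschitzWith 1 d := LipschitzWith.dist_left x
  have hlr : 0 < lam * r := mul_pos (by linarith [h.one_le_lam]) hr
  have hab : lam * r < 2 * lam * r := by linarith
  set φ := cut d (lam * r) (2 * lam * r)
  set v := mix φ u fun _ => 0 with hv
  have hG : GlueOn {y | lam * r ≤ dist y x ∧ dist y x ≤ 2 * lam * r} Ω univ φ univ := by
    intro y _
    rcases lt_or_ge (dist y x) (lam * r) with h1 | h1
    · exact Or.inr (Or.inl ⟨hx (by simp only [mem_closedBall]; linarith),
        cut_eventually_eq_one hdL.continuous hab h1⟩)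
    rcases le_or_gt (dist y x) (2 * lam * r) with h2 | h2
    · exact Or.inl ⟨h1, h2⟩
    · exact Or.inr (Or.inr ⟨mem_univ _, cut_eventually_eq_zero hdL.continuous hab h2⟩)
  have hvL : LocLipOn univ v := hG.locLipOn (lipschitzWith_cut hdL hab) (cut_nonneg _ _ _)
    (cut_le_one _ _ _) hΩ isOpen_univ (fun y hy => hx hy.2) (subset_univ _) hu
    (locLipOn_const _ _)
  have heq : ∀ y ∈ ball x (lam * r), v =ᶠ[𝓝 y] u := fun y hy =>
    mix_eventuallyEq_left (cut_eventually_eq_one hdL.continuous hab hy)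
  refine ⟨⨍ z in ball x r, v z ∂m, ?_⟩
  have hsub : ball x r ⊆ ball x (lam * r) := ball_subset_ball (by nlinarith [h.one_le_lam])
  calc _ = ∫⁻ y in ball x r, ENNReal.ofReal |v y - ⨍ z in ball x r, v z ∂m| ∂m :=
        setLIntegral_congr_fun measurableSet_ball fun y hy => by
          simp only [(heq y (hsub hy)).eq_of_nhds]
    _ ≤ _ := h.poincare v hvL x r hr hr1
    _ = _ := by
      congr 1
      exact setLIntegral_congr_fun measurableSet_ball fun y hy => mSlope_congr (heq y hy)

lemma PIConst.min_le_approx [ProperSpace X] (h : PIConst m D lam Cp) {Ω F : Set X} (hΩ : IsOpen Ω)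
    (hF : MeasurableSet F) {u : X → ℝ} (hu : LocLipOn Ω u) {x : X} {r : ℝ} (hr : 0 < r)
    (hr1 : r < 1) (hx : closedBall x (2 * lam * r) ⊆ Ω) :
    min (m (F ∩ ball x r)) (m (ball x r \ F)) ≤
      ∫⁻ y in ball x r, ENNReal.ofReal |u y - F.indicator (fun _ => (1:ℝ)) y| ∂m +
      ENNReal.ofReal (Cp * r) * ∫⁻ y in ball x (lam * r), mSlope u y ∂m := by
  obtain ⟨c, hc⟩ := h.poincare_local hΩ hu hr hr1 hx
  set χ := F.indicator fun _ => (1:ℝ) with hχ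
  have hsub : ball x r ⊆ Ω := fun y hy => hx (by
    have : dist y x < r := hy
    simp only [mem_closedBall]; nlinarith [h.one_le_lam])
  have hum : AEMeasurable u (m.restrict (ball x r)) :=
    ((hu.continuousOn hΩ).mono hsub).aemeasurable measurableSet_ball
  have hsplit : ∫⁻ y in ball x r, ENNReal.ofReal |χ y - c| ∂m =
      ENNReal.ofReal |1 - c| * m (F ∩ ball x r) + ENNReal.ofReal |c| * m (ball x r \ F) := by
    rw [← lintegral_inter_add_sdiff _ (ball x r) hF]
    congr 1
    · rw [setLIntegral_congr_fun (g := fun _ => ENNReal.ofReal |1 - c|)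
        (measurableSet_ball.inter hF) fun y hy => by simp [hχ, hy.2], setLIntegral_const,
        inter_comm]
    · rw [setLIntegral_congr_fun (g := fun _ => ENNReal.ofReal |c|)
        (measurableSet_ball.diff hF) fun y hy => by simp [hχ, hy.2], setLIntegral_const]
  have h1 : (1 : ℝ≥0∞) ≤ ENNReal.ofReal |1 - c| + ENNReal.ofReal |c| := by
    rw [← ENNReal.ofReal_add (abs_nonneg _) (abs_nonneg _), ENNReal.one_le_ofReal]
    have := abs_add_le (1 - c) c
    simpa using this
  set M := min (m (F ∩ ball x r)) (m (ball x r \ F))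
  calc M = 1 * M := (one_mul _).symm
    _ ≤ (ENNReal.ofReal |1 - c| + ENNReal.ofReal |c|) * M := by gcongr
    _ ≤ ENNReal.ofReal |1 - c| * m (F ∩ ball x r) + ENNReal.ofReal |c| * m (ball x r \ F) := by
      rw [add_mul]; gcongr
      · exact min_le_left _ _
      · exact min_le_right _ _
    _ = ∫⁻ y in ball x r, ENNReal.ofReal |χ y - c| ∂m := hsplit.symm
    _ ≤ ∫⁻ y in ball x r, (ENNReal.ofReal |u y - χ y| + ENNReal.ofReal |u y - c|) ∂m := by
      refine lintegral_mono fun y => ?_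
      rw [← ENNReal.ofReal_add (abs_nonneg _) (abs_nonneg _)]
      refine ENNReal.ofReal_le_ofReal ?_
      have := abs_add_le (χ y - u y) (u y - c)
      rw [abs_sub_comm (χ y)] at this
      simpa using this
    _ = _ := lintegral_add_left' (by
        have := (measurable_indicator_one hF).aemeasurable (μ := m.restrict (ball x r))
        exact ((hum.sub this).abs).ennreal_ofReal) _
    _ ≤ _ := by gcongr

lemma PIConst.min_le_Per [ProperSpace X] (h : PIConst m D lam Cp) {Ω F : Set X} (hΩ : IsOpen Ω)
    (hF : MeasurableSet F) {x : X} {r : ℝ} (hr : 0 < r)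
    (hr1 : r < 1) (hx : closedBall x (2 * lam * r) ⊆ Ω) :
    min (m (F ∩ ball x r)) (m (ball x r \ F)) ≤ ENNReal.ofReal (Cp * r) * Per m F Ω := by
  have hpos : ENNReal.ofReal (Cp * r) ≠ 0 := by
    simpa using mul_pos h.Cp_pos hr
  by_cases hP : Per m F Ω = ∞
  · rw [hP, ENNReal.mul_top hpos]; exact le_top
  obtain ⟨u, hu, huF, hun⟩ := exists_recovery hΩ hP
  have hsub : closedBall x r ⊆ Ω :=
    (closedBall_subset_closedBall (by nlinarith [h.one_le_lam])).trans hx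
  have hlam : ball x (lam * r) ⊆ Ω := fun y hy => hx (by
    have : dist y x < lam * r := hy
    simp only [mem_closedBall]; nlinarith [h.one_le_lam])
  have ht := huF _ hsub (isCompact_closedBall x r)
  have hlim : Tendsto (fun n : ℕ => ∫⁻ y in closedBall x r,
      ENNReal.ofReal |u n y - F.indicator (fun _ => (1:ℝ)) y| ∂m +
      ENNReal.ofReal (Cp * r) * (Per m F Ω + ((n : ℝ≥0∞) + 1)⁻¹)) atTop
      (𝓝 (0 + ENNReal.ofReal (Cp * r) * (Per m F Ω + 0))) := by
    refine ht.add (ENNReal.Tendsto.const_mul (tendsto_const_nhds.add ?_) (Or.inr (by simp)))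
    have := ENNReal.tendsto_inv_nat_nhds_zero.comp (tendsto_add_atTop_nat 1)
    simpa [Function.comp_def] using this
  rw [zero_add, add_zero] at hlim
  refine ge_of_tendsto' hlim fun n => (h.min_le_approx hΩ hF (hu n) hr hr1 hx).trans ?_
  gcongr
  · exact ball_subset_closedBall
  · exact (lintegral_mono_set hlam).trans (hun n)

end Poincare

section Isoperimetric

variable [MetricSpace X] [MeasurableSpace X] [BorelSpace X] [ProperSpace X]
  {m : Measure X} [IsLocallyFiniteMeasure m] {D lam Cp : ℝ}

lemma measurableSet_dist_lt (R : ℝ) : MeasurableSet {p : X × X | dist p.2 p.1 < R} :=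
  (isOpen_lt (by fun_prop) continuous_const).measurableSet

lemma measurable_measure_ball (R : ℝ) : Measurable fun z => m (ball z R) :=
  measurable_measure_prodMk_left (measurableSet_dist_lt R)

lemma lintegral_ball_average_swap {Z : Set X} {g : X → ℝ≥0∞} (hg : Measurable g) (ρ R : ℝ) :
    ∫⁻ z in Z, (m (ball z ρ))⁻¹ * ∫⁻ w in ball z R, g w ∂m ∂m =
      ∫⁻ w, g w * ∫⁻ z in ball w R, (m (ball z ρ))⁻¹ ∂(m.restrict Z) ∂m := by
  have hmeas : Measurable fun z => (m (ball z ρ))⁻¹ := (measurable_measure_ball ρ).inv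
  have e1 : ∀ z, (m (ball z ρ))⁻¹ * ∫⁻ w in ball z R, g w ∂m =
      ∫⁻ w, {p : X × X | dist p.2 p.1 < R}.indicator
        (fun p => (m (ball p.1 ρ))⁻¹ * g p.2) (z, w) ∂m := fun z => by
    rw [← lintegral_const_mul _ hg, ← lintegral_indicator measurableSet_ball]
    rfl
  have e2 : ∀ w, g w * ∫⁻ z in ball w R, (m (ball z ρ))⁻¹ ∂(m.restrict Z) =
      ∫⁻ z in Z, {p : X × X | dist p.2 p.1 < R}.indicator
        (fun p => (m (ball p.1 ρ))⁻¹ * g p.2) (z, w) ∂m := fun w => by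
    rw [← lintegral_const_mul _ hmeas, ← lintegral_indicator measurableSet_ball]
    refine lintegral_congr fun z => ?_
    by_cases hz : dist z w < R
    · have h' : dist w z < R := by rwa [dist_comm]
      simp [indicator, hz, h', mul_comm]
    · have h' : ¬ dist w z < R := by rwa [dist_comm]
      simp [indicator, hz, h']
  simp only [e1, e2]
  refine lintegral_lintegral_swap (f := fun z w => {p : X × X | dist p.2 p.1 < R}.indicator
        (fun p => (m (ball p.1 ρ))⁻¹ * g p.2) (z, w)) ?_
  exact (((hmeas.comp measurable_fst).mul (hg.comp measurable_snd)).indicator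
    (measurableSet_dist_lt R)).aemeasurable

lemma PIConst.lintegral_inv_le (h : PIConst m D lam Cp) {ρ R : ℝ} (hρ : 0 < ρ) (hR : 0 < R)
    {k : ℕ} (hk : 2 * R ≤ 2 ^ k * ρ) (hk1 : 2 ^ k * ρ ≤ 1) (Z : Set X) (w : X) :
    ∫⁻ z in ball w R, (m (ball z ρ))⁻¹ ∂(m.restrict Z) ≤ ENNReal.ofReal D ^ k := by
  have hb : ∀ z ∈ ball w R, (m (ball z ρ))⁻¹ ≤ ENNReal.ofReal D ^ k * (m (ball w R))⁻¹ := by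
    intro z hz
    have h1 : m (ball w R) ≤ ENNReal.ofReal D ^ k * m (ball z ρ) :=
      (measure_mono (ball_subset_ball' (ε₂ := 2 ^ k * ρ) (by
        have : dist z w < R := hz
        rw [dist_comm] at this; linarith))).trans (h.doubling_iter z hρ k hk1)
    have hw0 := (h.ball_pos w R hR).ne'
    have hwt := (h.ball_lt_top w R).ne
    have hz0 := (h.ball_pos z ρ hρ).ne'
    have hzt := (h.ball_lt_top z ρ).ne
    rw [← div_eq_mul_inv, ENNReal.le_div_iff_mul_le (Or.inl hw0) (Or.inl hwt), mul_comm,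
      ← div_eq_mul_inv]
    exact ENNReal.div_le_of_le_mul h1
  calc _ ≤ ∫⁻ z in ball w R, ENNReal.ofReal D ^ k * (m (ball w R))⁻¹ ∂(m.restrict Z) :=
        setLIntegral_mono measurable_const hb
    _ = ENNReal.ofReal D ^ k * (m (ball w R))⁻¹ * m.restrict Z (ball w R) := setLIntegral_const _ _
    _ ≤ ENNReal.ofReal D ^ k * (m (ball w R))⁻¹ * m (ball w R) := by
      gcongr; exact Measure.restrict_le_self
    _ = _ := by rw [mul_assoc, ENNReal.inv_mul_cancel (h.ball_pos w R hR).ne'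
        (h.ball_lt_top w R).ne, mul_one]

lemma PIConst.le_lintegral_inv (h : PIConst m D lam Cp) {ρ : ℝ} (hρ : 0 < ρ) (hρ1 : ρ < 1)
    {Z : Set X} {w : X} (hZ : ball w ρ ⊆ Z) :
    1 ≤ ENNReal.ofReal D * ∫⁻ z in ball w ρ, (m (ball z ρ))⁻¹ ∂(m.restrict Z) := by
  have hρ2 : 0 < 2 * ρ := by linarith
  have hmeas : Measurable fun z => (m (ball z ρ))⁻¹ := (measurable_measure_ball ρ).inv
  have h1 : (m (ball w (2 * ρ)))⁻¹ * m (ball w ρ) ≤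
      ∫⁻ z in ball w ρ, (m (ball z ρ))⁻¹ ∂(m.restrict Z) := by
    rw [Measure.restrict_restrict measurableSet_ball, inter_eq_left.2 hZ, ← setLIntegral_const]
    refine setLIntegral_mono hmeas fun z hz => ENNReal.inv_le_inv.2 (measure_mono
      (ball_subset_ball' ?_))
    have : dist z w < ρ := hz
    linarith
  refine le_trans ?_ (mul_le_mul_right h1 _)
  rw [← mul_assoc, mul_comm (ENNReal.ofReal D), mul_assoc,
    ← ENNReal.inv_mul_cancel (h.ball_pos w _ hρ2).ne' (h.ball_lt_top w _).ne]
  gcongr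
  exact h.doubling w ρ hρ hρ1

lemma PIConst.isoperimetric (h : PIConst m D lam Cp) {F V : Set X} (hF : MeasurableSet F)
    (hV : IsOpen V) {x : X} {r ρ : ℝ} (hρ : 0 < ρ) (hρr : ρ ≤ r) {k : ℕ} (hk : 2 * lam ≤ 2 ^ k)
    (hk1 : 2 ^ k * ρ ≤ 1) (hFx : F ⊆ ball x (2 * r))
    (hsmall : ∀ z ∈ ball x (3 * r), m (F ∩ ball z ρ) ≤ m (ball z ρ \ F))
    (hVx : closedBall x (3 * r + 2 * lam * ρ) ⊆ V) :
    m F ≤ ENNReal.ofReal D ^ (k + 1) * ENNReal.ofReal (Cp * ρ) * Per m F V := by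
  classical
  have hlam := h.one_le_lam
  have hρ1 : ρ < 1 := by nlinarith
  have hD0 : ENNReal.ofReal D ^ (k + 1) * ENNReal.ofReal (Cp * ρ) ≠ 0 := by
    have h1 := mul_pos h.Cp_pos hρ
    have h2 : 0 < D := by linarith [h.two_le_D]
    have : ENNReal.ofReal D ≠ 0 := by simpa using h2
    refine mul_ne_zero (pow_ne_zero _ this) (by simpa using h1)
  by_cases hP : Per m F V = ∞
  · rw [hP, ENNReal.mul_top hD0]; exact le_top
  obtain ⟨u, hu, huF, hun⟩ := exists_recovery hV hP
  set χ := F.indicator fun _ => (1:ℝ) with hχ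
  set Z := ball x (3 * r)
  set K := closedBall x (3 * r + 2 * lam * ρ)
  have hZK : ∀ z ∈ Z, closedBall z (2 * lam * ρ) ⊆ K := fun z hz =>
    closedBall_subset_closedBall' (by have : dist z x < 3 * r := hz; linarith)
  have hlow : m F ≤ ENNReal.ofReal D * ∫⁻ z in Z, (m (ball z ρ))⁻¹ * m (F ∩ ball z ρ) ∂m := by
    have e1 : ∀ z, m (F ∩ ball z ρ) = ∫⁻ w in ball z ρ, F.indicator (fun _ => (1:ℝ≥0∞)) w ∂m :=
      fun z => by
        rw [lintegral_indicator hF, setLIntegral_const, one_mul, Measure.restrict_apply hF]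
    simp only [e1]
    rw [lintegral_ball_average_swap (measurable_const.indicator hF), ← lintegral_const_mul' _ _
      (by simp), ← lintegral_indicator_one hF]
    refine lintegral_mono fun w => ?_
    by_cases hw : w ∈ F
    · simp only [indicator_of_mem hw, Pi.one_apply, one_mul]
      refine h.le_lintegral_inv hρ hρ1 (ball_subset_ball' ?_)
      have : dist w x < 2 * r := hFx hw
      linarith
    · simp [indicator_of_notMem hw]
  have hn : ∀ n, m F ≤ ENNReal.ofReal D ^ (k + 1) *
      (∫⁻ y in K, ENNReal.ofReal |u n y - χ y| ∂m +
        ENNReal.ofReal (Cp * ρ) * (Per m F V + ((n : ℝ≥0∞) + 1)⁻¹)) := by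
    intro n
    set g₁ : X → ℝ≥0∞ := K.indicator fun y => ENNReal.ofReal |u n y - χ y| with hg₁
    set g₂ : X → ℝ≥0∞ := V.indicator (slopeOn V (u n)) with hg₂
    have hKm : MeasurableSet K := isClosed_closedBall.measurableSet
    have hg₁m : Measurable g₁ := by
      have : g₁ = K.indicator fun y => ENNReal.ofReal |K.piecewise (u n) 0 y - χ y| := by
        ext y
        by_cases hy : y ∈ K <;> simp [hg₁, hy]
      rw [this]
      refine Measurable.indicator (Measurable.ennreal_ofReal ?_) hKm
      refine Measurable.abs (Measurable.sub ?_ (measurable_indicator_one hF))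
      exact (((hu n).continuousOn hV).mono hVx).measurable_piecewise continuousOn_const hKm
    have hg₂m : Measurable g₂ := measurable_indicator_slopeOn hV ((hu n).continuousOn hV)
    have hz : ∀ z ∈ Z, (m (ball z ρ))⁻¹ * m (F ∩ ball z ρ) ≤
        (m (ball z ρ))⁻¹ * ∫⁻ w in ball z ρ, g₁ w ∂m +
        ENNReal.ofReal (Cp * ρ) * ((m (ball z ρ))⁻¹ * ∫⁻ w in ball z (lam * ρ), g₂ w ∂m) := by
      intro z hz
      have hb1 : ball z ρ ⊆ K := fun y hy => hZK z hz (by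
        have : dist y z < ρ := hy
        simp only [mem_closedBall]; nlinarith)
      have hb2 : ball z (lam * ρ) ⊆ V := fun y hy => hVx (hZK z hz (by
        have : dist y z < lam * ρ := hy
        simp only [mem_closedBall]; nlinarith))
      have := h.min_le_approx hV hF (hu n) hρ hρ1 ((hZK z hz).trans hVx)
      rw [min_eq_left (hsmall z hz)] at this
      have i1 : ∫⁻ w in ball z ρ, g₁ w ∂m =
          ∫⁻ w in ball z ρ, ENNReal.ofReal |u n w - χ w| ∂m :=
        setLIntegral_congr_fun measurableSet_ball fun w hw => indicator_of_mem (hb1 hw) _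
      have i2 : ∫⁻ w in ball z (lam * ρ), g₂ w ∂m = ∫⁻ w in ball z (lam * ρ), mSlope (u n) w ∂m :=
        setLIntegral_congr_fun measurableSet_ball fun w hw =>
          (indicator_of_mem (hb2 hw) _).trans (slopeOn_eq_mSlope hV (hb2 hw) _)
      rw [i1, i2, mul_left_comm, ← mul_add]
      gcongr
    have hswap : ∀ {g : X → ℝ≥0∞}, Measurable g → ∀ {R : ℝ}, 0 < R → 2 * R ≤ 2 ^ k * ρ →
        ∫⁻ z in Z, (m (ball z ρ))⁻¹ * ∫⁻ w in ball z R, g w ∂m ∂m ≤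
          ENNReal.ofReal D ^ k * ∫⁻ w, g w ∂m := by
      intro g hg R hR hRk
      rw [lintegral_ball_average_swap hg, ← lintegral_const_mul _ hg]
      refine lintegral_mono fun w => ?_
      rw [mul_comm]
      gcongr
      exact h.lintegral_inv_le hρ hR hRk hk1 Z w
    have hmeas : Measurable fun z => (m (ball z ρ))⁻¹ * ∫⁻ w in ball z ρ, g₁ w ∂m := by
      refine (measurable_measure_ball ρ).inv.mul ?_
      have : ∀ z, ∫⁻ w in ball z ρ, g₁ w ∂m = m.withDensity g₁ (ball z ρ) := fun z =>
        (withDensity_apply _ measurableSet_ball).symm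
      simp only [this]
      exact measurable_measure_prodMk_left (measurableSet_dist_lt ρ)
    have hint : ∫⁻ z in Z, (m (ball z ρ))⁻¹ * m (F ∩ ball z ρ) ∂m ≤
        ENNReal.ofReal D ^ k * ∫⁻ w, g₁ w ∂m +
        ENNReal.ofReal (Cp * ρ) * (ENNReal.ofReal D ^ k * ∫⁻ w, g₂ w ∂m) := by
      refine (setLIntegral_mono' measurableSet_ball hz).trans ?_
      rw [lintegral_add_left hmeas, lintegral_const_mul' _ _ (by simp)]
      gcongr
      · exact hswap hg₁m hρ (by nlinarith)
      · exact hswap hg₂m (by positivity) (by nlinarith)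
    have hi1 : ∫⁻ w, g₁ w ∂m = ∫⁻ y in K, ENNReal.ofReal |u n y - χ y| ∂m :=
      lintegral_indicator hKm _
    have hi2 : ∫⁻ w, g₂ w ∂m ≤ Per m F V + ((n : ℝ≥0∞) + 1)⁻¹ := by
      rw [lintegral_indicator hV.measurableSet, setLIntegral_slopeOn hV]
      exact hun n
    calc m F ≤ _ := hlow
      _ ≤ ENNReal.ofReal D * (ENNReal.ofReal D ^ k * ∫⁻ w, g₁ w ∂m +
        ENNReal.ofReal (Cp * ρ) * (ENNReal.ofReal D ^ k * ∫⁻ w, g₂ w ∂m)) := by gcongr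
      _ = ENNReal.ofReal D ^ (k + 1) * (∫⁻ w, g₁ w ∂m +
          ENNReal.ofReal (Cp * ρ) * ∫⁻ w, g₂ w ∂m) := by ring
      _ ≤ _ := by rw [hi1]; gcongr
  have hlim : Tendsto (fun n : ℕ => ENNReal.ofReal D ^ (k + 1) *
      (∫⁻ y in K, ENNReal.ofReal |u n y - χ y| ∂m +
        ENNReal.ofReal (Cp * ρ) * (Per m F V + ((n : ℝ≥0∞) + 1)⁻¹))) atTop
      (𝓝 (ENNReal.ofReal D ^ (k + 1) * (0 + ENNReal.ofReal (Cp * ρ) * (Per m F V + 0)))) := by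
    refine ENNReal.Tendsto.const_mul ((huF K hVx (isCompact_closedBall _ _)).add
      (ENNReal.Tendsto.const_mul (tendsto_const_nhds.add ?_) (Or.inr (by simp)))) (Or.inr ?_)
    · have := ENNReal.tendsto_inv_nat_nhds_zero.comp (tendsto_add_atTop_nat 1)
      simpa [Function.comp_def] using this
    · exact ENNReal.pow_ne_top (by simp)
  rw [zero_add, add_zero, ← mul_assoc] at hlim
  exact ge_of_tendsto' hlim hn

end Isoperimetric


section LengthSpace

variable [MetricSpace X]

lemma IsLengthSpace.exists_curve (hX : IsLengthSpace X) (p q : X) {c : ℝ} (hc : dist p q < c) :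
    ∃ γ : ℝ → X, ContinuousOn γ (Icc 0 1) ∧ γ 0 = p ∧ γ 1 = q ∧
      eVariationOn γ (Icc 0 1) < ENNReal.ofReal c := by
  have h : ENNReal.ofReal (dist p q) < ENNReal.ofReal c :=
    (ENNReal.ofReal_lt_ofReal_iff (dist_nonneg.trans_lt hc)).2 hc
  rw [hX p q] at h
  simp only [iInf_lt_iff] at h
  obtain ⟨γ, h1, h2, h3, h4⟩ := h
  exact ⟨γ, h1, h2, h3, h4⟩

lemma IsLengthSpace.preconnectedSpace (hX : IsLengthSpace X) : PreconnectedSpace X := by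
  refine ⟨isPreconnected_of_forall_pair fun p _ q _ => ?_⟩
  obtain ⟨γ, hγ, rfl, rfl, -⟩ := hX.exists_curve p q (lt_add_one _)
  exact ⟨γ '' Icc 0 1, subset_univ _, mem_image_of_mem _ (by simp), mem_image_of_mem _ (by simp),
    isPreconnected_Icc.image _ hγ⟩

/-- Almost between points at a prescribed distance from the second end point. -/
lemma IsLengthSpace.exists_between (hX : IsLengthSpace X) (p q : X) {δ η : ℝ} (hδ : 0 ≤ δ)
    (hδd : δ ≤ dist p q) (hη : 0 < η) :
    ∃ z, dist z q = δ ∧ dist p z + dist z q < dist p q + η := by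
  obtain ⟨γ, hγ, rfl, rfl, hl⟩ := hX.exists_curve p q (lt_add_of_pos_right _ hη)
  have hd : ContinuousOn (fun t => dist (γ t) (γ 1)) (Icc 0 1) := (continuous_id.dist continuous_const).comp_continuousOn hγ
  obtain ⟨t, ht, htd⟩ := intermediate_value_Icc' (zero_le_one) hd
    (show δ ∈ Icc (dist (γ 1) (γ 1)) (dist (γ 0) (γ 1)) by simp [hδ, hδd])
  refine ⟨γ t, htd, ?_⟩
  have h1 := eVariationOn.edist_le γ (s := Icc 0 t) (x := 0) (y := t) (by simp [ht.1])
    (by simp [ht.1])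
  have h2 := eVariationOn.edist_le γ (s := Icc t 1) (x := t) (y := 1) (by simp [ht.2])
    (by simp [ht.2])
  have h3 := eVariationOn.Icc_add_Icc γ (s := univ) ht.1 ht.2 (mem_univ _)
  simp only [univ_inter] at h3
  have h4 := ((add_le_add h1 h2).trans h3.le).trans_lt hl
  rw [edist_dist, edist_dist, ← ENNReal.ofReal_add dist_nonneg dist_nonneg] at h4
  exact (ENNReal.ofReal_lt_ofReal_iff (by positivity)).1 h4

end LengthSpace

section Doubling

variable [MetricSpace X] [MeasurableSpace X] {m : Measure X}

lemma UnifLocDoublingWith.iter {C : ℝ → ℝ} (h : UnifLocDoublingWith C m) (x : X) {r R : ℝ}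
    (hr : 0 < r) (k : ℕ) (hk : 2 ^ k * r ≤ R) :
    m (ball x (2 ^ k * r)) ≤ ENNReal.ofReal (C R) ^ k * m (ball x r) := by
  induction k with
  | zero => simp
  | succ k ih =>
    have h2 : (0:ℝ) < 2 ^ k * r := by positivity
    have hk' : 2 ^ k * r < R := by rw [pow_succ] at hk; linarith
    calc m (ball x (2 ^ (k + 1) * r)) = m (ball x (2 * (2 ^ k * r))) := by rw [pow_succ]; ring_nf
      _ ≤ ENNReal.ofReal (C R) * m (ball x (2 ^ k * r)) := h R (h2.trans hk') _ _ h2 hk'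
      _ ≤ ENNReal.ofReal (C R) * (ENNReal.ofReal (C R) ^ k * m (ball x r)) := by
        gcongr; exact ih hk'.le
      _ = _ := by rw [pow_succ]; ring

lemma UnifLocDoublingWith.measure_eq_zero {C : ℝ → ℝ} (h : UnifLocDoublingWith C m) {x : X}
    {r : ℝ} (hr : 0 < r) (h0 : m (ball x r) = 0) : m = 0 := by
  rw [← Measure.measure_univ_eq_zero]
  have hu : (univ : Set X) = ⋃ k : ℕ, ball x (2 ^ k * r) := by
    refine (eq_univ_of_forall fun y => mem_iUnion.2 ?_).symm
    obtain ⟨k, hk⟩ := pow_unbounded_of_one_lt (dist y x / r) (one_lt_two (α := ℝ))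
    exact ⟨k, (div_lt_iff₀ hr).1 hk⟩
  rw [hu, measure_iUnion_null_iff]
  intro k
  have := h.iter x hr k le_rfl
  rwa [h0, mul_zero, nonpos_iff_eq_zero] at this

lemma UnifLocDoublingWith.properSpace [CompleteSpace X] [BorelSpace X] {C : ℝ → ℝ}
    (h : UnifLocDoublingWith C m) (hfin : ∀ x r, m (ball x r) < ∞)
    (hpos : ∀ x r, 0 < r → 0 < m (ball x r)) : ProperSpace X := by
  refine ⟨fun x R => ?_⟩
  refine isCompact_iff_totallyBounded_isComplete.2 ⟨?_, isClosed_closedBall.isComplete⟩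
  rw [Metric.totallyBounded_iff]
  intro ε hε
  rcases lt_or_ge R 0 with hR | hR
  · exact ⟨∅, finite_empty, by simp [closedBall_eq_empty.2 hR]⟩
  obtain ⟨t, ht⟩ := zorn_subset
    {N : Set X | N ⊆ closedBall x R ∧ N.Pairwise fun a b => ε ≤ dist a b} (by
      intro c hc hch
      refine ⟨⋃₀ c, ⟨sUnion_subset fun s hs => (hc hs).1, ?_⟩, fun s hs => subset_sUnion_of_mem hs⟩
      exact (pairwise_sUnion hch.directedOn).2 fun s hs => (hc hs).2)
  refine ⟨t, ?_, ?_⟩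
  · have hε2 : 0 < ε / 2 := by linarith
    obtain ⟨k, hk⟩ := pow_unbounded_of_one_lt ((2 * R + ε) / (ε / 2)) (one_lt_two (α := ℝ))
    rw [div_lt_iff₀ hε2] at hk
    set S := 2 ^ k * (ε / 2) with hS
    set c := m (ball x (R + ε)) / ENNReal.ofReal (C S) ^ k with hc
    have hc0 : 0 < c := ENNReal.div_pos (hpos x _ (by linarith)).ne'
      (ENNReal.pow_ne_top ENNReal.ofReal_ne_top)
    have hsub : ∀ y ∈ t, ball y (ε / 2) ⊆ ball x (R + ε) := fun y hy =>
      ball_subset_ball' (by have : dist y x ≤ R := ht.prop.1 hy; linarith)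
    have hle : ∀ y ∈ t, c ≤ m (ball y (ε / 2)) := fun y hy => by
      refine ENNReal.div_le_of_le_mul' ((measure_mono (ball_subset_ball' ?_)).trans
        (h.iter y hε2 k le_rfl))
      have : dist y x ≤ R := ht.prop.1 hy
      rw [dist_comm] at this
      linarith
    have := Measure.finite_const_le_meas_of_disjoint_iUnion m hc0
      (As := fun y : t => ball (y : X) (ε / 2)) (fun _ => measurableSet_ball)
      (fun a b hab => ball_disjoint_ball (by
        have := ht.prop.2 a.2 b.2 (fun e => hab (Subtype.ext e))
        linarith))
      (((measure_mono (iUnion_subset fun y : t => hsub y y.2)).trans_lt (hfin _ _)).ne)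
    have hfu : {i : t | c ≤ m (ball (i : X) (ε / 2))} = univ :=
      eq_univ_of_forall fun y => hle y y.2
    rw [hfu] at this
    exact finite_coe_iff.1 (finite_univ_iff.1 this)
  · intro y hy
    by_contra hcon
    simp only [mem_iUnion, mem_ball, not_exists, not_lt] at hcon
    have hyt : y ∉ t := fun hyt => by
      have := hcon y hyt
      rw [dist_self] at this
      linarith
    refine hyt (ht.le_of_ge (y := insert y t) ⟨insert_subset hy ht.prop.1, ?_⟩
      (subset_insert _ _) (mem_insert _ _))
    refine pairwise_insert.2
      ⟨ht.prop.2, fun b hb _ => ⟨hcon b hb, by rw [dist_comm]; exact hcon b hb⟩⟩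

lemma piConst_of_isPI (hfin : ∀ x r, m (ball x r) < ∞) (hpos : ∀ x r, 0 < r → 0 < m (ball x r))
    (h : IsPIspace m) : ∃ D lam Cp : ℝ, PIConst m D lam Cp := by
  obtain ⟨⟨C, hC, hd⟩, lam, hlam, P, hP, hp⟩ := h
  refine ⟨max 2 (C 1), lam, P 1, le_max_left _ _, hlam, hP 1 one_pos, hfin, hpos, ?_, ?_⟩
  · intro x r hr hr1
    exact (hd 1 one_pos x r hr hr1).trans (by gcongr; exact le_max_right _ _)
  · intro f hf x r hr hr1
    have h1 := hp f hf 1 one_pos x r hr hr1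
    have hb0 := (hpos x r hr).ne'
    have hbt := (hfin x r).ne
    rw [ENNReal.div_le_iff hb0 hbt] at h1
    refine h1.trans ?_
    rw [mul_assoc]
    gcongr
    rw [div_eq_mul_inv, mul_assoc]
    refine mul_le_of_le_one_right' ?_
    rw [mul_comm, ← div_eq_mul_inv]
    exact ENNReal.div_le_of_le_mul (by
      rw [one_mul]; exact measure_mono (ball_subset_ball (by nlinarith)))

end Doubling

section Regularity

variable [MetricSpace X] [MeasurableSpace X] [BorelSpace X] {m : Measure X} {D lam Cp : ℝ}

lemma PIConst.isLocallyFiniteMeasure (h : PIConst m D lam Cp) : IsLocallyFiniteMeasure m :=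
  ⟨fun x => ⟨ball x 1, ball_mem_nhds x one_pos, h.ball_lt_top x 1⟩⟩

lemma PIConst.isUnifLocDoublingMeasure (h : PIConst m D lam Cp) : IsUnifLocDoublingMeasure m := by
  refine ⟨(Real.toNNReal D) ^ 2, ?_⟩
  filter_upwards [Ioo_mem_nhdsGT (show (0:ℝ) < 1 / 4 by norm_num)] with ε hε x
  have h1 := h.doubling_iter x hε.1 2 (by linarith [hε.2])
  refine (measure_mono (closedBall_subset_ball (by linarith [hε.1]))).trans (h1.trans ?_)
  rw [ENNReal.coe_pow]
  exact mul_le_mul_right (measure_mono ball_subset_closedBall) _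

/-- The regularity of the space used in the proofs: doubling and Poincaré inequalities, and
spheres and points being negligible. -/
structure RegularPI (m : Measure X) (D lam Cp : ℝ) : Prop extends PIConst m D lam Cp where
  sphere_null : ∀ x r, 0 < r → m (sphere x r) = 0
  point_null : ∀ x, m {x} = 0

lemma PIConst.sphere_null [ProperSpace X] (h : PIConst m D lam Cp) (hX : IsLengthSpace X) (p : X)
    {t : ℝ} (ht : 0 < t) : m (sphere p t) = 0 := by
  have := h.isLocallyFiniteMeasure
  have := h.isUnifLocDoublingMeasure
  have hae := IsUnifLocDoublingMeasure.ae_tendsto_measure_inter_div m (sphere p t) 4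
  by_contra hne
  have : (ae (m.restrict (sphere p t))).NeBot := by
    rw [ae_neBot]
    simpa using hne
  obtain ⟨x, hx, hxS⟩ := (hae.and (ae_restrict_mem isClosed_sphere.measurableSet)).exists
  have hxp : dist x p = t := hxS
  have hex : ∀ r : ℝ, ∃ z, 0 < r → 4 * r ≤ t → dist z x = 4 * r ∧ dist p z < t - r := by
    intro r
    by_cases hr : 0 < r ∧ 4 * r ≤ t
    · obtain ⟨z, hz1, hz2⟩ := hX.exists_between p x (δ := 4 * r) (η := r) (by linarith [hr.1])
        (by rw [dist_comm, hxp]; exact hr.2) hr.1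
      refine ⟨z, fun _ _ => ⟨hz1, ?_⟩⟩
      rw [dist_comm p x, hxp] at hz2
      linarith [hr.1]
    · exact ⟨x, fun h1 h2 => absurd ⟨h1, h2⟩ hr⟩
  choose w hw using hex
  have hev : ∀ᶠ r : ℝ in 𝓝[>] 0, 0 < r ∧ 4 * r ≤ t := by
    filter_upwards [Ioo_mem_nhdsGT (show (0:ℝ) < t / 4 by linarith)] with r hr
    exact ⟨hr.1, by linarith [hr.2]⟩
  have hlim := hx (l := 𝓝[>] (0:ℝ)) w id tendsto_id (by
    filter_upwards [hev] with r hr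
    rw [mem_closedBall, dist_comm, (hw r hr.1 hr.2).1, id])
  have h0 : ∀ᶠ r : ℝ in 𝓝[>] 0, m (sphere p t ∩ closedBall (w r) (id r)) /
      m (closedBall (w r) (id r)) = 0 := by
    filter_upwards [hev] with r hr
    have : sphere p t ∩ closedBall (w r) (id r) = ∅ := by
      refine eq_empty_of_forall_notMem fun y ⟨hy1, hy2⟩ => ?_
      have e1 : dist y p = t := hy1
      have e2 : dist y (w r) ≤ r := hy2
      have e3 := (hw r hr.1 hr.2).2
      have := dist_triangle y (w r) p
      rw [dist_comm (w r) p] at this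
      linarith
    rw [this, measure_empty, ENNReal.zero_div]
  exact one_ne_zero (tendsto_nhds_unique ((tendsto_congr' h0).1 hlim) tendsto_const_nhds)

lemma PIConst.regularPI [ProperSpace X] [Nontrivial X] (h : PIConst m D lam Cp)
    (hX : IsLengthSpace X) : RegularPI m D lam Cp := by
  refine ⟨h, fun x r hr => h.sphere_null hX x hr, fun x => ?_⟩
  obtain ⟨p, hp⟩ := exists_ne x
  exact measure_mono_null (singleton_subset_iff.2 (mem_sphere.2 rfl))
    (h.sphere_null hX p (dist_pos.2 hp.symm))

/-- `E` has density zero at `x`. -/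
def DensZero (m : Measure X) (E : Set X) (x : X) : Prop :=
  ∀ ε : ℝ≥0∞, 0 < ε → ∃ r₀ > (0:ℝ), ∀ r, 0 < r → r < r₀ → m (E ∩ ball x r) ≤ ε * m (ball x r)

lemma RegularPI.measure_closedBall (h : RegularPI m D lam Cp) (x : X) {r : ℝ} (hr : 0 < r) :
    m (closedBall x r) = m (ball x r) := by
  refine le_antisymm ?_ (measure_mono ball_subset_closedBall)
  rw [← ball_union_sphere]
  exact (measure_union_le _ _).trans (by rw [h.sphere_null x r hr, add_zero])

lemma RegularPI.exists_densZero [ProperSpace X] (h : RegularPI m D lam Cp) {E U : Set X}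
    (hE : MeasurableSet E) (hEU : m (Eᶜ ∩ U) ≠ 0) :
    ∃ x ∈ U, DensZero m E x := by
  have := h.isLocallyFiniteMeasure
  have := h.isUnifLocDoublingMeasure
  have hae := IsUnifLocDoublingMeasure.ae_tendsto_measure_inter_div m Eᶜ 1
  rw [ae_restrict_iff' hE.compl] at hae
  obtain ⟨x, ⟨hxE, hxU⟩, hx⟩ : ∃ x ∈ Eᶜ ∩ U, ∀ {ι : Type} {l : Filter ι} (w : ι → X) (δ : ι → ℝ)
      (_ : Tendsto δ l (𝓝[>] 0)) (_ : ∀ᶠ j in l, x ∈ closedBall (w j) (1 * δ j)),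
      Tendsto (fun j => m (Eᶜ ∩ closedBall (w j) (δ j)) / m (closedBall (w j) (δ j))) l (𝓝 1) := by
    by_contra hcon
    push Not at hcon
    refine hEU (measure_mono_null (fun y hy => ?_) hae)
    intro hyy
    obtain ⟨ι, l, w, δ, h1, h2, h3⟩ := hcon y hy
    exact h3 (hyy hy.1 w δ h1 h2)
  refine ⟨x, hxU, fun ε hε => ?_⟩
  have hlim := hx (l := 𝓝[>] (0:ℝ)) (fun _ => x) id tendsto_id (by
    filter_upwards [self_mem_nhdsWithin] with r hr
    have : (0:ℝ) < r := hr
    simp [this.le])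
  rcases le_or_gt 1 ε with h1 | h1
  · exact ⟨1, one_pos, fun r _ _ => (measure_mono inter_subset_right).trans
      (le_mul_of_one_le_left' h1)⟩
  have hev : ∀ᶠ r : ℝ in 𝓝[>] 0, 1 - ε < m (Eᶜ ∩ closedBall x r) / m (closedBall x r) :=
    hlim.eventually (lt_mem_nhds (ENNReal.sub_lt_self (by simp) one_ne_zero hε.ne'))
  obtain ⟨r₀, hr₀, hr⟩ := mem_nhdsGT_iff_exists_Ioo_subset.1 hev
  refine ⟨r₀, hr₀, fun r h0 hlt => ?_⟩
  have hb : 1 - ε < m (Eᶜ ∩ closedBall x r) / m (closedBall x r) := hr ⟨h0, hlt⟩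
  have hb0 := (h.ball_pos x r h0).ne'
  have hbt := (h.ball_lt_top x r).ne
  rw [h.measure_closedBall x h0, ENNReal.lt_div_iff_mul_lt (Or.inl hb0) (Or.inl hbt)] at hb
  have hc : m (Eᶜ ∩ closedBall x r) ≤ m (Eᶜ ∩ ball x r) := by
    rw [← ball_union_sphere, inter_union_distrib_left]
    refine (measure_union_le _ _).trans ?_
    rw [measure_mono_null inter_subset_right (h.sphere_null x r h0), add_zero]
  have hsum : m (E ∩ ball x r) + m (Eᶜ ∩ ball x r) = m (ball x r) := by
    rw [inter_comm, inter_comm Eᶜ, ← sdiff_eq_compl_inter.trans (inter_comm _ _)]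
    exact measure_inter_add_sdiff _ hE
  have h2 : m (E ∩ ball x r) + (1 - ε) * m (ball x r) ≤ ε * m (ball x r) + (1 - ε) * m (ball x r) := by
    rw [← add_mul, add_tsub_cancel_of_le h1.le, one_mul, ← hsum]
    gcongr
    rw [hsum]
    exact hb.le.trans hc
  exact (ENNReal.add_le_add_iff_right (ENNReal.mul_ne_top (by simp) hbt)).1 h2

lemma RegularPI.continuousOn_measure_ball (h : RegularPI m D lam Cp) {F : Set X}
    (hF : MeasurableSet F) (y : X) : ContinuousOn (fun t => m (F ∩ ball y t)) (Ioi 0) := by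
  intro t ht
  refine ContinuousAt.continuousWithinAt ?_
  have e : ∀ s, m (F ∩ ball y s) = ∫⁻ x, (F ∩ ball y s).indicator 1 x ∂m := fun s =>
    (lintegral_indicator_one (hF.inter measurableSet_ball)).symm
  simp only [ContinuousAt, e]
  refine tendsto_lintegral_filter_of_dominated_convergence ((ball y (t + 1)).indicator 1) ?_ ?_ ?_ ?_
  · exact Eventually.of_forall fun s =>
      measurable_one.indicator (hF.inter measurableSet_ball)
  · filter_upwards [gt_mem_nhds (lt_add_one t)] with s hs
    refine Eventually.of_forall fun x => ?_
    exact indicator_le_indicator_of_subset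
      (inter_subset_right.trans (ball_subset_ball hs.le)) (fun _ => zero_le) x
  · rw [lintegral_indicator_one measurableSet_ball]
    exact (h.ball_lt_top _ _).ne
  · have h0 : ∀ᵐ x ∂m, x ∉ sphere y t := measure_eq_zero_iff_ae_notMem.1 (h.sphere_null y t ht)
    filter_upwards [h0] with x hx
    have hx : dist x y ≠ t := hx
    refine tendsto_const_nhds.congr' ?_
    rcases lt_or_gt_of_ne hx with h1 | h1
    · filter_upwards [lt_mem_nhds h1] with s hs
      by_cases hxF : x ∈ F
      · simp [indicator, hxF, h1, hs]
      · simp [hxF]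
    · filter_upwards [gt_mem_nhds h1] with s hs
      simp [indicator, hs.not_gt, h1.not_gt]

lemma RegularPI.exists_measure_ball_eq (h : RegularPI m D lam Cp) {F : Set X}
    (hF : MeasurableSet F) (y : X) {a b : ℝ} (ha : 0 < a) (hab : a ≤ b) {v : ℝ≥0∞}
    (h1 : m (F ∩ ball y a) ≤ v) (h2 : v ≤ m (F ∩ ball y b)) :
    ∃ t ∈ Icc a b, m (F ∩ ball y t) = v :=
  intermediate_value_Icc hab ((h.continuousOn_measure_ball hF y).mono fun _ ht =>
    ha.trans_le ht.1) ⟨h1, h2⟩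

lemma RegularPI.exists_uniform_small [ProperSpace X] (h : RegularPI m D lam Cp) {B : Set X}
    (hB : IsBounded B) {v : ℝ≥0∞} (hv : 0 < v) : ∃ r₀ > (0:ℝ), ∀ x ∈ B, m (ball x r₀) ≤ v := by
  have := h.isLocallyFiniteMeasure
  have hU : ∀ x : X, ∃ U, IsOpen U ∧ x ∈ U ∧ m U < v := fun x => by
    obtain ⟨U, hxU, hU, hUv⟩ := Set.exists_isOpen_lt_of_lt {x} v (by rwa [h.point_null x])
    exact ⟨U, hU, singleton_subset_iff.1 hxU, hUv⟩
  choose U hU hxU hUv using hU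
  obtain ⟨δ, hδ, hb⟩ := lebesgue_number_lemma_of_metric hB.isCompact_closure hU
    (fun x _ => mem_iUnion.2 ⟨x, hxU x⟩)
  refine ⟨δ, hδ, fun x hx => ?_⟩
  obtain ⟨i, hi⟩ := hb x (subset_closure hx)
  exact (measure_mono hi).trans (hUv i).le

end Regularity


section Compensation

variable [MetricSpace X] [MeasurableSpace X] [BorelSpace X] {m : Measure X}

lemma totVar_congr_ae_on_le {f g : X → ℝ} {Ω : Set X} (hΩ : IsOpen Ω)
    (h : ∀ᵐ x ∂m, x ∈ Ω → f x = g x) : totVar m f Ω ≤ totVar m g Ω := by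
  refine le_iInf fun Ω' => le_iInf fun hΩ' => le_iInf fun hs => le_iInf fun u => le_iInf fun hu =>
    le_iInf fun huf => ?_
  refine (totVar_le_liminf hΩ (fun n => (hu n).mono hs)
    (tendstoL1loc_congr_ae (h.mono fun x hx hxΩ => (hx hxΩ).symm) (huf.mono hs))).trans ?_
  refine liminf_le_liminf (Eventually.of_forall fun n => ?_)
  rw [setLIntegral_slopeOn hΩ, setLIntegral_slopeOn hΩ']
  exact lintegral_mono_set hs

lemma Per_congr_ae_on {E F Ω : Set X} (hΩ : IsOpen Ω)
    (h : ∀ᵐ x ∂m, x ∈ Ω → (x ∈ E ↔ x ∈ F)) : Per m E Ω = Per m F Ω := by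
  have h' : ∀ᵐ x ∂m, x ∈ Ω → E.indicator (fun _ => (1:ℝ)) x = F.indicator (fun _ => (1:ℝ)) x := by
    filter_upwards [h] with x hx hxΩ
    by_cases hxE : x ∈ E
    · simp [hxE, (hx hxΩ).1 hxE]
    · simp [hxE, mt (hx hxΩ).2 hxE]
  exact le_antisymm (totVar_congr_ae_on_le hΩ h')
    (totVar_congr_ae_on_le hΩ (h'.mono fun x hx hxΩ => (hx hxΩ).symm))

variable [ProperSpace X] [IsLocallyFiniteMeasure m] {E : Set X}

lemma Per_open_ball_lt_top (hE : MeasurableSet E) (hP : HasLocFinPer m E) (x : X) (r : ℝ) :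
    Per m E (ball x r) < ∞ :=
  (Per_mono m E ball_subset_closedBall).trans_lt (Per_ball_lt_top hE hP x r)

/-- A perimeter bound for `E ∪ B_t(y)` in one open set transfers to any other open set
containing a neighbourhood of the ball. -/
lemma Per_union_ball_transfer (hE : MeasurableSet E) {U V : Set X} (hU : IsOpen U) (hV : IsOpen V)
    (hEU : Per m E U < ∞) {y : X} {t b : ℝ} (htb : t < b) (hbU : closedBall y b ⊆ U)
    (hbV : closedBall y b ⊆ V) {A : ℝ≥0∞} (hA : Per m (E ∪ ball y t) U ≤ A + Per m E U) :
    Per m (E ∪ ball y t) V ≤ Per m E V + A := by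
  obtain ⟨a, hta, hab⟩ := exists_between htb
  have hG : ∀ x, a ≤ dist x y → (x ∈ E ∪ ball y t ↔ x ∈ E) := fun x hx => by
    have : x ∉ ball y t := by simp only [mem_ball]; linarith
    simp [this]
  have key := Per_swap (m := m) hU hV hab hbU hbV (hE.union measurableSet_ball) hE
    (fun x _ => Iff.rfl) hG (fun x _ => Iff.rfl) (fun x hx => (hG x hx).symm)
  refine (ENNReal.add_le_add_iff_right hEU.ne).1 (key.trans ?_)
  calc _ ≤ A + Per m E U + Per m E V := by gcongr
    _ = _ := by ring

/-- There is a ball, disjoint from `B_R(x)` and compactly inside `B_c(p)`, whose addition to `E`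
increases the volume by `v` at perimeter cost at most `κ v` in `B_ρ(p)`. -/
def Compensates (m : Measure X) (E : Set X) (p : X) (c ρ : ℝ) (x : X) (R : ℝ) (κ v : ℝ≥0∞) :
    Prop :=
  ∃ y b t, t < b ∧ closedBall y b ⊆ closedBall p c ∧ Disjoint (closedBall y b) (ball x R) ∧
    m (ball y t \ E) = v ∧ Per m (E ∪ ball y t) (ball p ρ) ≤ Per m E (ball p ρ) + κ * v

lemma VolConstMin.Per_le_diff_ball (hE : VolConstMin m E) {p x : X} {c ρ s : ℝ} (hc : c < ρ)
    (hx : ball x s ⊆ closedBall p c) {κ : ℝ≥0∞}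
    (h : Compensates m E p c ρ x s κ (m (E ∩ ball x s))) :
    Per m E (ball p ρ) ≤ Per m (E \ ball x s) (ball p ρ) + κ * m (E ∩ ball x s) := by
  obtain ⟨y, b, t, htb, hby, hdis, hv, hP⟩ := h
  obtain ⟨a, hta, hab⟩ := exists_between htb
  have hEm := hE.1
  have hbV : closedBall y b ⊆ ball p ρ := hby.trans (closedBall_subset_ball hc)
  have hout : ∀ z, dist z y ≤ b → z ∉ ball x s := fun z hz hzs =>
    disjoint_left.1 hdis (mem_closedBall.2 hz) hzs
  have hin : ∀ z, a ≤ dist z y → z ∉ ball y t := fun z hz => by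
    simp only [mem_ball]; linarith
  set G := (E \ ball x s) ∪ ball y t
  have key := Per_swap (m := m) (V₁ := ball p ρ) (V₂ := ball p ρ) (F₁ := E ∪ ball y t)
    (F₂ := E \ ball x s) (G := G) (G' := E) isOpen_ball isOpen_ball hab hbV hbV
    (hEm.union measurableSet_ball) (hEm.diff measurableSet_ball)
    (fun z hz => by simp only [G, mem_union, Set.mem_sdiff, hout z hz, not_false_eq_true, and_true])
    (fun z hz => by simp only [G, mem_union, hin z hz, or_false])
    (fun z hz => by simp only [Set.mem_sdiff, hout z hz, not_false_eq_true, and_true])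
    (fun z hz => by simp only [mem_union, hin z hz, or_false])
  have hty : ball y t ⊆ closedBall p c := ((ball_subset_ball htb.le).trans
    ball_subset_closedBall).trans hby
  have hcρ : closedBall p c ⊆ closedBall p ρ := closedBall_subset_closedBall hc.le
  have hGE : ∀ z, c < dist z p → (z ∈ G ↔ z ∈ E) := fun z hz => by
    have h1 : z ∉ ball x s := fun h => not_le.2 hz (hx h)
    have h2 : z ∉ ball y t := fun h => not_le.2 hz (hty h)
    simp only [G, mem_union, Set.mem_sdiff, h1, h2, not_false_eq_true, and_true, or_false]
  have hvol : m (E ∩ closedBall p ρ) = m (G ∩ closedBall p ρ) := by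
    have e1 : E ∩ closedBall p ρ = (E \ ball x s) ∩ closedBall p ρ ∪ E ∩ ball x s := by
      ext z
      have : z ∈ ball x s → z ∈ closedBall p ρ := fun h => hcρ (hx h)
      simp only [mem_inter_iff, mem_union, Set.mem_sdiff]
      tauto
    have e2 : G ∩ closedBall p ρ = (E \ ball x s) ∩ closedBall p ρ ∪ (ball y t \ E) := by
      ext z
      have h1 : z ∈ ball y t → z ∈ closedBall p ρ := fun h => hcρ (hty h)
      have h2 : z ∈ ball y t → z ∉ ball x s := fun h => hout z (by
        have : dist z y < t := h
        linarith)
      simp only [G, mem_inter_iff, mem_union, Set.mem_sdiff]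
      tauto
    rw [e1, e2, measure_union _ (hEm.inter measurableSet_ball),
      measure_union _ (measurableSet_ball.diff hEm), hv]
    · exact disjoint_left.2 fun z hz hz' => hz'.2 hz.1.1
    · exact disjoint_left.2 fun z hz hz' => hz.1.2 hz'.2
  have hM := hE.Per_ball_le ((hEm.diff measurableSet_ball).union measurableSet_ball) hc hGE hvol
  have hfin := Per_open_ball_lt_top hEm hE.2.1 p ρ
  refine (ENNReal.add_le_add_iff_left hfin.ne).1 ?_
  calc _ ≤ Per m G (ball p ρ) + Per m E (ball p ρ) := by gcongr
    _ ≤ _ := key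
    _ ≤ Per m E (ball p ρ) + κ * m (E ∩ ball x s) + Per m (E \ ball x s) (ball p ρ) := by gcongr
    _ = _ := by ring

lemma VolConstMin.exists_Per_inter_le (hE : VolConstMin m E) {p x : X} {c ρ r₁ r₂ : ℝ}
    (hc : c < ρ) (h12 : r₁ < r₂) (hx : closedBall x r₂ ⊆ closedBall p c) {κ : ℝ≥0∞}
    (h : ∀ v, v ≠ 0 → m (E ∩ ball x r₁) ≤ v → v ≤ m (E ∩ ball x r₂) →
      Compensates m E p c ρ x r₂ κ v) :
    ∃ s ∈ Icc r₁ r₂, Per m (E ∩ ball x s) (ball p ρ) ≤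
      ENNReal.ofReal (6 / (r₂ - r₁)) * m (E ∩ ball x r₂) + κ * m (E ∩ ball x s) := by
  have hEm := hE.1
  have hxV : closedBall x r₂ ⊆ ball p ρ := hx.trans (closedBall_subset_ball hc)
  obtain ⟨s, hs, hcut⟩ := exists_Per_cut_le (m := m) hEm isOpen_ball h12 hxV
  refine ⟨s, hs, ?_⟩
  have hPE : Per m E (ball p ρ) ≤ Per m (E \ ball x s) (ball p ρ) + κ * m (E ∩ ball x s) := by
    by_cases h0 : m (E ∩ ball x s) = 0
    · rw [h0, mul_zero, add_zero]
      refine (Per_congr_ae ?_ _).le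
      have : (E \ ball x s : Set X) = E \ (E ∩ ball x s) := by simp
      rw [this]
      exact (sdiff_null_ae_eq_self h0).symm
    · have hsub : ball x s ⊆ ball x r₂ := ball_subset_ball hs.2
      refine hE.Per_le_diff_ball hc (hsub.trans (ball_subset_closedBall.trans hx)) ?_
      obtain ⟨y, b, t, h1, h2, h3, h4⟩ := h (m (E ∩ ball x s)) h0
        (measure_mono (inter_subset_inter_right _ (ball_subset_ball hs.1)))
        (measure_mono (inter_subset_inter_right _ hsub))
      exact ⟨y, b, t, h1, h2, h3.mono_right hsub, h4⟩
  have hfin : Per m (E \ ball x s) (ball p ρ) ≠ ∞ := by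
    have h1 := Per_open_ball_lt_top hEm hE.2.1 p ρ
    have h2 : m (E ∩ ball x r₂) < ∞ := (measure_mono (inter_subset_right.trans
      ball_subset_closedBall)).trans_lt (isCompact_closedBall x r₂).measure_lt_top
    refine ((le_add_self.trans hcut).trans_lt ?_).ne
    exact ENNReal.add_lt_top.2 ⟨h1, ENNReal.mul_lt_top (by simp) h2⟩
  refine (ENNReal.add_le_add_iff_right hfin).1 (hcut.trans ?_)
  calc _ ≤ Per m (E \ ball x s) (ball p ρ) + κ * m (E ∩ ball x s) + _ := by gcongr
    _ = _ := by ring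

end Compensation


section DensityEstimate

variable [MetricSpace X] [MeasurableSpace X] [BorelSpace X] [ProperSpace X] {m : Measure X}
  [IsLocallyFiniteMeasure m] {E : Set X} {D lam Cp : ℝ}

/-- One step of the De Giorgi iteration. -/
lemma PIConst.measure_inter_ball_step (h : PIConst m D lam Cp) (hE : VolConstMin m E) {k : ℕ}
    (hk : 8 + 2 * lam ≤ 2 ^ k) {p x : X} {c ρ r r₁ r₂ σ : ℝ} (hc : c < ρ) (hr : 0 < r)
    (hkr : 2 ^ k * r ≤ 1) (hx : closedBall x (2 ^ k * r) ⊆ closedBall p c)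
    (h12 : r₁ < r₂) (hr₂ : r₂ ≤ 2 * r) (hσ : 0 < σ) (hσr : σ ≤ r) {κ : ℝ≥0∞}
    (hκ : ∀ v, v ≠ 0 → m (E ∩ ball x r₁) ≤ v → v ≤ m (E ∩ ball x r₂) →
      Compensates m E p c ρ x r₂ κ v)
    (hsmall : ∀ z ∈ ball x (3 * r), 2 * m (E ∩ ball x r₂) ≤ m (ball z σ)) :
    m (E ∩ ball x r₁) ≤ ENNReal.ofReal D ^ (k + 1) * ENNReal.ofReal (Cp * σ) *
      ((ENNReal.ofReal (6 / (r₂ - r₁)) + κ) * m (E ∩ ball x r₂)) := by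
  have hlam := h.one_le_lam
  have h8 : 3 * r + 2 * lam * σ ≤ 2 ^ k * r := by nlinarith
  have hr₂x : closedBall x r₂ ⊆ closedBall p c :=
    (closedBall_subset_closedBall (by nlinarith)).trans hx
  obtain ⟨s, hs, hP⟩ := hE.exists_Per_inter_le hc h12 hr₂x hκ
  have hsub : E ∩ ball x s ⊆ E ∩ ball x r₂ := inter_subset_inter_right _ (ball_subset_ball hs.2)
  have hiso := h.isoperimetric (F := E ∩ ball x s) (V := ball p ρ) (x := x) (r := r) (ρ := σ)
    (k := k) (hE.1.inter measurableSet_ball) isOpen_ball hσ hσr (by linarith)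
    ((mul_le_mul_of_nonneg_left hσr (by positivity)).trans hkr)
    (inter_subset_right.trans (ball_subset_ball (hs.2.trans hr₂)))
    (fun z hz => by
      have h1 : m (E ∩ ball x s ∩ ball z σ) ≤ m (E ∩ ball x r₂) :=
        measure_mono (inter_subset_left.trans hsub)
      have hfin : m (E ∩ ball x s ∩ ball z σ) ≠ ∞ :=
        ((measure_mono inter_subset_right).trans_lt (h.ball_lt_top z σ)).ne
      refine (ENNReal.add_le_add_iff_left hfin).1 ?_
      calc _ ≤ m (E ∩ ball x r₂) + m (E ∩ ball x r₂) := by gcongr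
        _ = 2 * m (E ∩ ball x r₂) := by ring
        _ ≤ m (ball z σ) := hsmall z hz
        _ ≤ m (ball z σ ∩ (E ∩ ball x s)) + m (ball z σ \ (E ∩ ball x s)) :=
          measure_le_inter_add_sdiff _ _ _
        _ = _ := by rw [inter_comm (ball z σ)])
    ((closedBall_subset_closedBall h8).trans (hx.trans (closedBall_subset_ball hc)))
  calc m (E ∩ ball x r₁) ≤ m (E ∩ ball x s) :=
        measure_mono (inter_subset_inter_right _ (ball_subset_ball hs.1))
    _ ≤ _ := hiso
    _ ≤ _ := by
        gcongr
        refine hP.trans ?_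
        rw [add_mul]
        gcongr

/-- **Density estimate.** A volume constrained minimizer with small density in `B_{2r}(x)` does
not meet `B_r(x)`, provided volume can be compensated elsewhere at cost `κ` with `r κ` bounded. -/
lemma PIConst.exists_density_threshold (h : PIConst m D lam Cp) {k : ℕ}
    (hk : 8 + 2 * lam ≤ 2 ^ k) {M : ℝ} (hM : 0 ≤ M) :
    ∃ ε : ℝ≥0∞, 0 < ε ∧ ∀ E : Set X, VolConstMin m E → ∀ (p x : X) (c ρ r : ℝ) (κ : ℝ≥0∞), c < ρ →
      0 < r → 2 ^ k * r ≤ 1 → closedBall x (2 ^ k * r) ⊆ closedBall p c →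
      ENNReal.ofReal r * κ ≤ ENNReal.ofReal M →
      (∀ v, v ≠ 0 → m (E ∩ ball x r) ≤ v → v ≤ m (E ∩ ball x (2 * r)) →
        Compensates m E p c ρ x (2 * r) κ v) →
      m (E ∩ ball x (2 * r)) ≤ ε * m (ball x (2 * r)) → m (E ∩ ball x r) = 0 := by
  have hD0 : (0:ℝ) < D := by linarith [h.two_le_D]
  have hCp := h.Cp_pos
  obtain ⟨K, hK⟩ : ∃ K : ℕ, D ^ (k + 1) * (Cp * (1 / 2) ^ K * (12 + M)) ≤ (D ^ 2)⁻¹ := by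
    have : Tendsto (fun K : ℕ => D ^ (k + 1) * (Cp * (1 / 2 : ℝ) ^ K * (12 + M))) atTop
        (𝓝 (D ^ (k + 1) * (Cp * 0 * (12 + M)))) :=
      (((_root_.tendsto_pow_atTop_nhds_zero_of_lt_one (by norm_num) (by norm_num)).const_mul
        Cp).mul_const _).const_mul _
    simp only [mul_zero, zero_mul] at this
    exact (this.eventually_le_const (by positivity)).exists
  set a := ENNReal.ofReal D with ha
  have ha0 : a ≠ 0 := by simpa [ha] using hD0
  have hat : a ≠ ∞ := by simp [ha]
  refine ⟨2⁻¹ * a⁻¹ ^ (3 + K), by simp [pos_iff_ne_zero, hat], ?_⟩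
  intro E hE p x c ρ r κ hc hr hkr hx hκM hκ hε
  have hfin := h.ball_lt_top x (2 * r)
  set f : ℕ → ℝ≥0∞ := fun j => m (E ∩ ball x (r * (1 + (1 / 2) ^ j))) with hf
  have hp1 : ∀ j : ℕ, (1 / 2 : ℝ) ^ j ≤ 1 := fun j => pow_le_one₀ (by norm_num) (by norm_num)
  have hp0 : ∀ j : ℕ, (0:ℝ) < (1 / 2) ^ j := fun j => by positivity
  have hlam := h.one_le_lam
  have key : ∀ j : ℕ, f j ≤ 2⁻¹ * a⁻¹ ^ (3 + K + 2 * j) * m (ball x (2 * r)) := by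
    intro j
    induction j with
    | zero => simpa [hf, show r * (1 + 1) = 2 * r by ring] using hε
    | succ j ih =>
      have hσ : 0 < r * (1 / 2) ^ (K + 2 * j) := mul_pos hr (hp0 _)
      have hσr : r * (1 / 2) ^ (K + 2 * j) ≤ r := mul_le_of_le_one_right hr.le (hp1 _)
      have hstep := h.measure_inter_ball_step hE hk (p := p) (x := x) (c := c) (ρ := ρ) (r := r)
        (r₁ := r * (1 + (1 / 2) ^ (j + 1))) (r₂ := r * (1 + (1 / 2) ^ j))
        (σ := r * (1 / 2) ^ (K + 2 * j)) (κ := κ) hc hr hkr hx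
        (by rw [pow_succ]; nlinarith [mul_pos hr (hp0 j)]) (by nlinarith [hp1 j]) hσ hσr
        (fun v hv h1 h2 => by
          obtain ⟨y, b, t, e1, e2, e3, e4⟩ := hκ v hv
            (le_trans (measure_mono (inter_subset_inter_right _
              (ball_subset_ball (by nlinarith [hp0 (j + 1)])))) h1)
            (h2.trans (measure_mono (inter_subset_inter_right _
              (ball_subset_ball (by nlinarith [hp1 j])))))
          exact ⟨y, b, t, e1, e2, e3.mono_right (ball_subset_ball (by nlinarith [hp1 j])), e4⟩)
        (fun z hz => by
          have h8 : (2:ℝ) ^ (3 + K + 2 * j) * (r * (1 / 2) ^ (K + 2 * j)) = 8 * r := by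
            rw [add_assoc, pow_add, one_div, inv_pow]
            field_simp
            norm_num
          have hit := h.doubling_iter z hσ (3 + K + 2 * j) (by rw [h8]; nlinarith)
          rw [h8] at hit
          calc 2 * m (E ∩ ball x (r * (1 + (1 / 2) ^ j)))
              ≤ 2 * (2⁻¹ * a⁻¹ ^ (3 + K + 2 * j) * m (ball x (2 * r))) := by gcongr
            _ = a⁻¹ ^ (3 + K + 2 * j) * m (ball x (2 * r)) := by
                rw [← mul_assoc, ← mul_assoc, ENNReal.mul_inv_cancel (by simp) (by simp), one_mul]
            _ ≤ a⁻¹ ^ (3 + K + 2 * j) * m (ball z (8 * r)) := by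
                gcongr
                refine ball_subset_ball' ?_
                rw [mem_ball, dist_comm] at hz
                linarith
            _ ≤ a⁻¹ ^ (3 + K + 2 * j) *
                (a ^ (3 + K + 2 * j) * m (ball z (r * (1 / 2) ^ (K + 2 * j)))) := by gcongr
            _ = _ := by
                rw [← mul_assoc, ← mul_pow, ENNReal.inv_mul_cancel ha0 hat, one_pow, one_mul])
      have hfac : a ^ (k + 1) * ENNReal.ofReal (Cp * (r * (1 / 2) ^ (K + 2 * j))) *
          (ENNReal.ofReal (6 / (r * (1 + (1 / 2) ^ j) - r * (1 + (1 / 2) ^ (j + 1)))) + κ) ≤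
          a⁻¹ ^ 2 := by
        have e1 : ENNReal.ofReal (Cp * (r * (1 / 2) ^ (K + 2 * j))) *
            ENNReal.ofReal (6 / (r * (1 + (1 / 2) ^ j) - r * (1 + (1 / 2) ^ (j + 1)))) ≤
            ENNReal.ofReal (Cp * (1 / 2) ^ K * 12) := by
          rw [← ENNReal.ofReal_mul (by positivity)]
          refine ENNReal.ofReal_le_ofReal ?_
          have : Cp * (r * (1 / 2) ^ (K + 2 * j)) *
              (6 / (r * (1 + (1 / 2) ^ j) - r * (1 + (1 / 2) ^ (j + 1)))) =
              Cp * (1 / 2) ^ K * 12 * (1 / 2) ^ j := by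
            have hd : r * (1 + (1 / 2) ^ j) - r * (1 + (1 / 2) ^ (j + 1)) = r * (1 / 2) ^ j / 2 := by
              rw [pow_succ]; ring
            have := hp0 j
            rw [hd, pow_add, pow_mul, sq, mul_pow]
            field_simp
            norm_num
          rw [this]
          exact mul_le_of_le_one_right (by positivity) (hp1 j)
        have e2 : ENNReal.ofReal (Cp * (r * (1 / 2) ^ (K + 2 * j))) * κ ≤
            ENNReal.ofReal (Cp * (1 / 2) ^ K * M) := by
          have hle : (1 / 2 : ℝ) ^ (K + 2 * j) ≤ (1 / 2) ^ K :=
            pow_le_pow_of_le_one (by norm_num) (by norm_num) (by omega)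
          calc _ ≤ ENNReal.ofReal (Cp * (1 / 2) ^ K * r) * κ := by
                gcongr ENNReal.ofReal ?_ * κ
                nlinarith [mul_le_mul_of_nonneg_left hle (mul_pos hCp hr).le]
            _ = ENNReal.ofReal (Cp * (1 / 2) ^ K) * (ENNReal.ofReal r * κ) := by
                rw [ENNReal.ofReal_mul (by positivity), mul_assoc]
            _ ≤ ENNReal.ofReal (Cp * (1 / 2) ^ K) * ENNReal.ofReal M := by gcongr
            _ = _ := (ENNReal.ofReal_mul (by positivity)).symm
        calc _ ≤ a ^ (k + 1) * (ENNReal.ofReal (Cp * (1 / 2) ^ K * 12) +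
              ENNReal.ofReal (Cp * (1 / 2) ^ K * M)) := by
              rw [mul_assoc, mul_add]; gcongr
          _ = ENNReal.ofReal (D ^ (k + 1) * (Cp * (1 / 2) ^ K * (12 + M))) := by
              rw [← ENNReal.ofReal_add (by positivity) (by positivity), ha,
                ← ENNReal.ofReal_pow hD0.le, ← ENNReal.ofReal_mul (by positivity)]
              ring_nf
          _ ≤ ENNReal.ofReal ((D ^ 2)⁻¹) := ENNReal.ofReal_le_ofReal hK
          _ = a⁻¹ ^ 2 := by
              rw [ENNReal.ofReal_inv_of_pos (by positivity), ENNReal.ofReal_pow hD0.le,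
                ENNReal.inv_pow]
      calc f (j + 1) ≤ _ := hstep
        _ ≤ a⁻¹ ^ 2 * f j := by rw [← mul_assoc]; gcongr
        _ ≤ a⁻¹ ^ 2 * (2⁻¹ * a⁻¹ ^ (3 + K + 2 * j) * m (ball x (2 * r))) := by gcongr
        _ = _ := by ring
  have hlim : Tendsto (fun j : ℕ => 2⁻¹ * a⁻¹ ^ (3 + K + 2 * j) * m (ball x (2 * r))) atTop
      (𝓝 (2⁻¹ * 0 * m (ball x (2 * r)))) := by
    have ha1 : a⁻¹ < 1 := by
      rw [ENNReal.inv_lt_one, ha, ENNReal.one_lt_ofReal]; linarith [h.two_le_D]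
    have h1 := ENNReal.tendsto_pow_atTop_nhds_zero_of_lt_one ha1
    have h2 : Tendsto (fun j : ℕ => 3 + K + 2 * j) atTop atTop :=
      tendsto_atTop_mono (fun j => by dsimp; omega) tendsto_id
    exact ENNReal.Tendsto.mul_const (ENNReal.Tendsto.const_mul (h1.comp h2) (Or.inr (by simp)))
      (Or.inr hfin.ne)
  rw [mul_zero, zero_mul] at hlim
  refine le_antisymm (ge_of_tendsto' hlim fun j => le_trans (measure_mono
    (inter_subset_inter_right _ (ball_subset_ball ?_))) (key j)) zero_le
  nlinarith [hp0 j]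

end DensityEstimate


section Interior

variable [MetricSpace X] [MeasurableSpace X] [BorelSpace X] {m : Measure X} {E : Set X}
  {D lam Cp : ℝ}

lemma VolConstMin.compl [IsLocallyFiniteMeasure m] (hE : VolConstMin m E) :
    VolConstMin m Eᶜ := by
  refine ⟨hE.1.compl, fun x => ?_, fun F K hF hK h1 h2 => ?_⟩
  · obtain ⟨r, hr, h⟩ := hE.2.1 x
    exact ⟨r, hr, by rwa [Per_compl]⟩
  · have h3 := measure_inter_add_sdiff K hE.1 (μ := m)
    have h4 := measure_inter_add_sdiff K hF (μ := m)
    have hE' : m (K \ E) = m (Eᶜ ∩ K) := by rw [sdiff_eq, inter_comm]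
    have hF' : m (K ∩ F) = m (F ∩ K) := by rw [inter_comm]
    have hfin : m (F ∩ K) ≠ ∞ := ((measure_mono inter_subset_right).trans_lt hK.measure_lt_top).ne
    have h5 : m (E ∩ K) = m (Fᶜ ∩ K) := by
      refine (ENNReal.add_left_inj hfin).1 ?_
      rw [hE', inter_comm K E, h2] at h3
      rw [h3, ← h4, hF', add_comm, inter_comm Fᶜ K]
      rfl
    have := hE.2.2 Fᶜ K hF.compl hK (by rwa [← compl_symmDiff_compl, compl_compl]) h5
    rwa [Per_compl] at this ⊢

/-- Balls around a point where the deformation inequalities hold provide compensation. -/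
lemma RegularPI.compensates [ProperSpace X] [IsLocallyFiniteMeasure m]
    (h : RegularPI m D lam Cp) (hE : VolConstMin m E) {z y p x : X} {R C a a' b c ρ s : ℝ}
    (hdef : DeformIneq m E z R C) (hy : y ∈ ball z R) (ha : 0 < a) (haa : a ≤ a')
    (hab : a' < b) (hbR : b ≤ R) (hc : c < ρ) (hbp : closedBall y b ⊆ closedBall p c)
    (hdis : Disjoint (closedBall y b) (ball x s)) {v : ℝ≥0∞} (h1 : m (Eᶜ ∩ ball y a) ≤ v)
    (h2 : v ≤ m (Eᶜ ∩ ball y a')) (hC : 0 ≤ C) :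
    Compensates m E p c ρ x s (ENNReal.ofReal (C / a)) v := by
  obtain ⟨t, ht, htv⟩ := h.exists_measure_ball_eq hE.1.compl y ha haa h1 h2
  have ht0 : 0 < t := ha.trans_le ht.1
  have htb : t < b := ht.2.trans_lt hab
  have hv : m (ball y t \ E) = v := by rw [sdiff_eq, inter_comm]; exact htv
  refine ⟨y, b, t, htb, hbp, hdis, hv, ?_⟩
  have hbz : closedBall y b ⊆ ball z (2 * R) := fun w hw => by
    have e1 : dist w y ≤ b := hw
    have e2 : dist y z < R := hy
    exact mem_ball.2 ((dist_triangle w y z).trans_lt (by linarith))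
  refine Per_union_ball_transfer hE.1 isOpen_ball isOpen_ball
    (Per_open_ball_lt_top hE.1 hE.2.1 z (2 * R)) htb hbz
    (hbp.trans (closedBall_subset_ball hc)) ?_
  refine (hdef y hy t ⟨ht0, htb.trans_le hbR⟩).2.trans ?_
  rw [hv]
  gcongr
  rw [ENNReal.div_eq_inv_mul, ← mul_assoc, mul_comm (ENNReal.ofReal t)⁻¹, ← div_eq_mul_inv,
    ← ENNReal.ofReal_div_of_pos ht0]
  gcongr
  exact ht.1

/-- The set of points with a neighbourhood that `E` fills up to a null set. -/
def innerPart (m : Measure X) (E : Set X) : Set X := {x | ∃ t > 0, m (Eᶜ ∩ ball x t) = 0}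

lemma isOpen_innerPart : IsOpen (innerPart m E) := by
  refine Metric.isOpen_iff.2 fun x ⟨t, ht, h⟩ => ⟨t, ht, fun y hy => ?_⟩
  have hy' : dist y x < t := hy
  refine ⟨t - dist y x, by linarith, measure_mono_null ?_ h⟩
  exact inter_subset_inter_right _ (ball_subset_ball' (by linarith))

lemma PIConst.disjoint_innerPart (h : PIConst m D lam Cp) :
    Disjoint (innerPart m E) (innerPart m Eᶜ) := by
  refine disjoint_left.2 fun x ⟨t, ht, h1⟩ ⟨s, hs, h2⟩ => ?_
  have hts := lt_min ht hs
  refine (h.ball_pos x _ hts).ne' (measure_mono_null (t := Eᶜ ∩ ball x t ∪ Eᶜᶜ ∩ ball x s) ?_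
    (measure_union_null h1 h2))
  intro y hy
  by_cases hyE : y ∈ E
  · exact Or.inr ⟨by simpa using hyE, ball_subset_ball (min_le_right _ _) hy⟩
  · exact Or.inl ⟨hyE, ball_subset_ball (min_le_left _ _) hy⟩

lemma measure_compl_inter_innerPart [SecondCountableTopology X] :
    m (Eᶜ ∩ innerPart m E) = 0 := by
  refine measure_null_of_locally_null _ fun x hx => ?_
  obtain ⟨t, ht, h⟩ := hx.2
  exact ⟨Eᶜ ∩ ball x t, inter_mem (mem_of_superset self_mem_nhdsWithin inter_subset_left)
    (mem_nhdsWithin_of_mem_nhds (ball_mem_nhds x ht)), h⟩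

lemma PIConst.innerPart_subset_essInt (h : PIConst m D lam Cp) :
    innerPart m E ⊆ essInt m E := by
  rintro x ⟨t, ht, h0⟩
  refine tendsto_const_nhds.congr' ?_
  filter_upwards [Ioo_mem_nhdsGT ht] with r hr
  have h1 : m (ball x r) ≤ m (E ∩ ball x r) := by
    calc m (ball x r) ≤ m (E ∩ ball x r ∪ Eᶜ ∩ ball x t) := measure_mono fun y hy => by
          by_cases hyE : y ∈ E
          · exact Or.inl ⟨hyE, hy⟩
          · exact Or.inr ⟨hyE, ball_subset_ball hr.2.le hy⟩
      _ ≤ m (E ∩ ball x r) + 0 := h0 ▸ measure_union_le _ _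
      _ = _ := add_zero _
  rw [le_antisymm (measure_mono inter_subset_right) h1,
    ENNReal.div_self (h.ball_pos x r hr.1).ne' (h.ball_lt_top x r).ne]

lemma innerPart_compl_subset_essExt : innerPart m Eᶜ ⊆ essExt m E := by
  rintro x ⟨t, ht, h0⟩
  refine tendsto_const_nhds.congr' ?_
  filter_upwards [Ioo_mem_nhdsGT ht] with r hr
  rw [compl_compl] at h0
  rw [measure_mono_null (inter_subset_inter_right _ (ball_subset_ball hr.2.le)) h0,
    ENNReal.zero_div]

variable [ProperSpace X] [IsLocallyFiniteMeasure m]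

lemma RegularPI.measure_le_half (h : RegularPI m D lam Cp) (hE : VolConstMin m E) {x y : X}
    (hxy : x ≠ y) (hx : DensZero m E x) (hy : ∀ t > 0, m (Eᶜ ∩ ball y t) ≠ 0) {R : ℝ}
    (hdef : DeformAt m E y R) :
    ∃ r₀ > 0, ∀ r, 0 < r → r < r₀ → m (E ∩ ball x r) ≤ m (Eᶜ ∩ ball y (r / 2)) := by
  obtain ⟨hR, hR1, C, hC, hdef⟩ := hdef
  obtain ⟨k, hk⟩ := pow_unbounded_of_one_lt (8 + 2 * lam) (one_lt_two (α := ℝ))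
  obtain ⟨ε, hε, hDG⟩ := h.exists_density_threshold hk.le (M := 2 * C) (by positivity)
  obtain ⟨r₁, hr₁, hdens⟩ := hx ε hε
  have hd : 0 < dist x y := dist_pos.2 hxy
  set b := min R (dist x y / 2) with hb
  have hb0 : 0 < b := lt_min hR (by linarith)
  obtain ⟨r₂, hr₂, hsm⟩ := h.exists_uniform_small (isBounded_singleton (x := x))
    (pos_iff_ne_zero.2 (hy (b / 2) (by linarith)))
  have hk0 : (0:ℝ) < 2 ^ k := by positivity
  refine ⟨min (min (r₁ / 2) (r₂ / 2)) (min (1 / 2 ^ k) (min b (dist x y / 4))), by positivity, ?_⟩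
  intro r hr hr0
  simp only [lt_min_iff] at hr0
  obtain ⟨⟨h1, h2⟩, h3, h4, h5⟩ := hr0
  by_contra! hlt
  rw [lt_div_iff₀ hk0] at h3
  have hb2 : b ≤ dist x y / 2 := min_le_right _ _
  have hbR : b ≤ R := min_le_left _ _
  have key : m (E ∩ ball x r) = 0 := by
    refine hDG E hE y x (dist x y + 1) (dist x y + 2) r (ENNReal.ofReal (C / (r / 2)))
      (by linarith) hr (by linarith) (closedBall_subset_closedBall' (by linarith)) ?_ ?_
      (hdens _ (by linarith) (by linarith))
    · rw [← ENNReal.ofReal_mul hr.le]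
      refine ENNReal.ofReal_le_ofReal (le_of_eq ?_)
      field_simp
    · intro v _ hv1 hv2
      refine h.compensates hE hdef (mem_ball_self hR) (a' := b / 2) (b := b) (by linarith)
        (by linarith) (by linarith) hbR (by linarith) (closedBall_subset_closedBall (by linarith))
        ?_ (hlt.le.trans hv1) ?_ hC
      · refine disjoint_left.2 fun w hw hw' => ?_
        have e1 : dist w y ≤ b := hw
        have e2 : dist w x < 2 * r := hw'
        linarith [dist_triangle_left x y w]
      · exact hv2.trans ((measure_mono (inter_subset_right.trans
          (ball_subset_ball (by linarith)))).trans (hsm x rfl))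
  rw [key] at hlt
  exact _root_.not_lt_zero hlt

lemma RegularPI.innerPart_nonempty_or (h : RegularPI m D lam Cp) (hE : VolConstMin m E)
    (hdef : DeformationProperty m) {x y : X} (hxy : x ≠ y) (hx : DensZero m E x)
    (hy : DensZero m Eᶜ y) : (innerPart m E).Nonempty ∨ (innerPart m Eᶜ).Nonempty := by
  by_contra! hcon
  have hG : ∀ w, ∀ t > 0, m (Eᶜ ∩ ball w t) ≠ 0 := fun w t ht h0 =>
    (hcon.1 ▸ (⟨t, ht, h0⟩ : w ∈ innerPart m E) : w ∈ (∅ : Set X))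
  have hH : ∀ w, ∀ t > 0, m (Eᶜᶜ ∩ ball w t) ≠ 0 := fun w t ht h0 =>
    (hcon.2 ▸ (⟨t, ht, h0⟩ : w ∈ innerPart m Eᶜ) : w ∈ (∅ : Set X))
  have hE' := hE.compl
  obtain ⟨R, hR⟩ := hdef E hE.1 hE.2.1 y
  obtain ⟨R', hR'⟩ := hdef Eᶜ hE'.1 hE'.2.1 x
  obtain ⟨r₁, hr₁, h₁⟩ := h.measure_le_half hE hxy hx (hG y) hR
  obtain ⟨r₂, hr₂, h₂⟩ := h.measure_le_half hE' hxy.symm hy (hH x) hR'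
  simp only [compl_compl] at h₂ hH
  obtain ⟨r, hr, hrr⟩ := exists_between (lt_min hr₁ hr₂)
  have hr1 := hrr.trans_le (min_le_left _ _)
  have hr2 := hrr.trans_le (min_le_right _ _)
  have hiter : ∀ j : ℕ, m (E ∩ ball x r) ≤ m (E ∩ ball x (r / 4 ^ j)) := by
    intro j
    induction j with
    | zero => simp
    | succ j ih =>
      have e0 : 0 < r / 4 ^ j := by positivity
      have e1 : r / 4 ^ j ≤ r := div_le_self hr.le (one_le_pow₀ (by norm_num))
      refine ih.trans ((h₁ _ e0 (e1.trans_lt hr1)).trans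
        ((h₂ _ (by linarith) (by linarith)).trans (le_of_eq ?_)))
      congr 3
      rw [pow_succ]
      field_simp
      norm_num
  have hpos : 0 < m (E ∩ ball x r) := pos_iff_ne_zero.2 (hH x r hr)
  have hfin : m (E ∩ ball x r) ≠ ∞ :=
    ((measure_mono inter_subset_right).trans_lt (h.ball_lt_top x r)).ne
  obtain ⟨s, hs, hsm⟩ := h.exists_uniform_small (isBounded_singleton (x := x))
    (ENNReal.half_pos hpos.ne')
  obtain ⟨j, hj⟩ := pow_unbounded_of_one_lt (r / s) (show (1:ℝ) < 4 by norm_num)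
  have hj' : r / 4 ^ j ≤ s := by
    rw [div_lt_iff₀ hs] at hj
    rw [div_le_iff₀ (by positivity)]
    linarith
  exact (ENNReal.half_lt_self hpos.ne' hfin).not_ge ((hiter j).trans ((measure_mono
    (inter_subset_right.trans (ball_subset_ball hj'))).trans (hsm x rfl)))

/-- Uniform density and perimeter estimates away from a boundary point of the interior. -/
lemma RegularPI.estimates_away (h : RegularPI m D lam Cp) (hE : VolConstMin m E)
    (hdef : DeformationProperty m) {z : X} (hz : z ∈ frontier (innerPart m E)) {η : ℝ}
    (hη : 0 < η) {B : Set X} (hB : IsBounded B) :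
    ∃ ε : ℝ≥0∞, 0 < ε ∧ ∃ r₀ > (0:ℝ), ∃ A : ℝ, 0 ≤ A ∧ ∀ x ∈ B, η ≤ dist x z →
      ∀ r, 0 < r → r < r₀ →
      (m (E ∩ ball x (2 * r)) ≤ ε * m (ball x (2 * r)) → m (E ∩ ball x r) = 0) ∧
      Per m E (ball x r) ≤ ENNReal.ofReal (A / r) * m (ball x (2 * r)) := by
  obtain ⟨R, hR, hR1, C, hC, hdef⟩ := hdef E hE.1 hE.2.1 z
  set β := min (η / 8) (R / 4) with hβ
  have hβ0 : 0 < β := lt_min (by linarith) (by linarith)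
  have hβη : β ≤ η / 8 := min_le_left _ _
  have hβR : β ≤ R / 4 := min_le_right _ _
  have hzG : z ∈ (innerPart m E)ᶜ := by
    rw [frontier, isOpen_innerPart.interior_eq] at hz
    exact hz.2
  obtain ⟨y, hyG, hyz⟩ := Metric.mem_closure_iff.1 (frontier_subset_closure hz) β hβ0
  rw [dist_comm] at hyz
  set a := infDist y (innerPart m E)ᶜ with ha
  have ha0 : 0 < a := (isOpen_innerPart.isClosed_compl.notMem_iff_infDist_pos ⟨z, hzG⟩).1
    (fun hy => hy hyG)
  have haβ : a < β := (infDist_le_dist_of_mem hzG).trans_lt hyz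
  have hza : m (Eᶜ ∩ ball y a) = 0 :=
    measure_mono_null (inter_subset_inter_right _ (fun w hw => by
      by_contra hwG
      have := infDist_le_dist_of_mem (x := y) (show w ∈ (innerPart m E)ᶜ from hwG)
      rw [mem_ball, dist_comm] at hw
      linarith)) measure_compl_inter_innerPart
  have hv0 : 0 < m (Eᶜ ∩ ball y (2 * β)) := by
    obtain ⟨w, hw, hwy⟩ := (infDist_lt_iff ⟨z, hzG⟩).1 (show a < 2 * β by linarith)
    refine pos_iff_ne_zero.2 fun h0 => hw ⟨2 * β - dist y w, by linarith, ?_⟩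
    refine measure_mono_null (inter_subset_inter_right _ (ball_subset_ball' ?_)) h0
    rw [dist_comm]; linarith
  obtain ⟨k, hk⟩ := pow_unbounded_of_one_lt (8 + 2 * lam) (one_lt_two (α := ℝ))
  obtain ⟨ε, hε, hDG⟩ := h.exists_density_threshold hk.le (M := C / a) (by positivity)
  obtain ⟨s, hs, hsm⟩ := h.exists_uniform_small hB hv0
  obtain ⟨c₀, hc₀⟩ := hB.subset_closedBall z
  have hk0 : (0:ℝ) < 2 ^ k := by positivity
  have hk8 : (8:ℝ) ≤ 2 ^ k := by linarith [h.one_le_lam]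
  refine ⟨ε, hε, min (s / 2) (min (1 / 2 ^ k) (η / 4)), by positivity, 6 + C / a, by positivity, ?_⟩
  intro x hx hxz r hr hr0
  simp only [lt_min_iff] at hr0
  obtain ⟨h1, h2, h3⟩ := hr0
  rw [lt_div_iff₀ hk0] at h2
  have hr1 : r ≤ 1 := by nlinarith
  set c := max c₀ 0 + 1 with hc
  have hcc : c < c + 1 := by linarith
  have hc1 : 1 ≤ c := by linarith [le_max_right c₀ 0]
  have hxc : closedBall x (2 ^ k * r) ⊆ closedBall z c := by
    refine closedBall_subset_closedBall' ?_
    have : dist x z ≤ c₀ := hc₀ hx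
    linarith [le_max_left c₀ 0]
  have hcomp : ∀ v, v ≠ 0 → m (E ∩ ball x r) ≤ v → v ≤ m (E ∩ ball x (2 * r)) →
      Compensates m E z c (c + 1) x (2 * r) (ENNReal.ofReal (C / a)) v := by
    intro v _ _ hv2
    refine h.compensates hE hdef (y := y) (a' := 2 * β) (b := 3 * β) (mem_ball.2 (by linarith)) ha0
      (by linarith) (by linarith) (by linarith) hcc
      (closedBall_subset_closedBall' (by linarith)) ?_ (by rw [hza]; exact zero_le) ?_ hC
    · refine disjoint_left.2 fun w hw hw' => ?_
      have e1 : dist w y ≤ 3 * β := hw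
      have e2 : dist w x < 2 * r := hw'
      linarith [dist_triangle_left x z w, dist_triangle w y z]
    · exact hv2.trans ((measure_mono (inter_subset_right.trans
        (ball_subset_ball (by linarith)))).trans (hsm x hx))
  refine ⟨hDG E hE z x c (c + 1) r (ENNReal.ofReal (C / a)) hcc hr (by linarith) hxc ?_ hcomp, ?_⟩
  · rw [← ENNReal.ofReal_mul hr.le]
    exact ENNReal.ofReal_le_ofReal (mul_le_of_le_one_left (by positivity) hr1)
  · obtain ⟨t, ht, hP⟩ := hE.exists_Per_inter_le hcc (show r < 2 * r by linarith)
      ((closedBall_subset_closedBall (by nlinarith)).trans hxc) hcomp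
    have htV : ball x t ⊆ ball z (c + 1) := ((ball_subset_ball (ht.2.trans (by nlinarith))).trans
      ball_subset_closedBall).trans (hxc.trans (closedBall_subset_ball hcc))
    calc Per m E (ball x r) ≤ Per m E (ball x t) := Per_mono m E (ball_subset_ball ht.1)
      _ = Per m (E ∩ ball x t) (ball x t) := Per_congr_ae_on isOpen_ball
          (Eventually.of_forall fun w hw => by simp [hw])
      _ ≤ Per m (E ∩ ball x t) (ball z (c + 1)) := Per_mono m _ htV
      _ ≤ _ := hP
      _ ≤ ENNReal.ofReal (6 / (2 * r - r)) * m (ball x (2 * r)) +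
          ENNReal.ofReal (C / a) * m (ball x (2 * r)) := by
          gcongr
          · exact inter_subset_right
          · exact inter_subset_right.trans (ball_subset_ball ht.2)
      _ = ENNReal.ofReal (6 / r + C / a) * m (ball x (2 * r)) := by
          rw [ENNReal.ofReal_add (by positivity) (by positivity), add_mul,
            show 2 * r - r = r by ring]
      _ ≤ _ := by
          gcongr ENNReal.ofReal ?_ * _
          rw [add_div]
          refine add_le_add_right ?_ _
          exact le_div_self (by positivity) hr hr1

end Interior


section Doubling

variable [MetricSpace X] [MeasurableSpace X] [BorelSpace X] {m : Measure X} {E : Set X}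
  {D lam Cp : ℝ}

lemma Per_eq_zero_of_eventually {F V : Set X} (hV : IsOpen V)
    (h : ∀ x ∈ V, (∀ᶠ y in 𝓝 x, y ∈ F) ∨ ∀ᶠ y in 𝓝 x, y ∉ F) : Per m F V = 0 := by
  have hloc : ∀ x ∈ V, ∃ c : ℝ, F.indicator (fun _ => (1:ℝ)) =ᶠ[𝓝 x] fun _ => c := by
    intro x hx
    rcases h x hx with h1 | h1
    · exact ⟨1, h1.mono fun y hy => by simp [hy]⟩
    · exact ⟨0, h1.mono fun y hy => by simp [hy]⟩
  have hL : LocLipOn V (F.indicator fun _ => (1:ℝ)) := LocLipOn.of_nhds fun x hx => by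
    obtain ⟨c, hc⟩ := hloc x hx
    exact ⟨_, hc, 0, LipschitzOnWith.of_dist_le_mul fun y hy z hz => by
      rw [show F.indicator (fun _ => (1:ℝ)) y = c from hy,
        show F.indicator (fun _ => (1:ℝ)) z = c from hz]; simp⟩
  refine le_antisymm ((totVar_le_liminf hV (fun _ => hL)
    (fun K _ _ => by simp)).trans ?_) zero_le
  rw [liminf_const]
  refine (setLIntegral_congr_fun hV.measurableSet (g := fun _ => 0) fun x hx => ?_).trans_le
    (by simp)
  obtain ⟨c, hc⟩ := hloc x hx
  simp only [slopeOn_eq_mSlope hV hx, mSlope_congr hc, mSlope_const]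

lemma Per_ball_le_add [ProperSpace X] [IsLocallyFiniteMeasure m] (hE : MeasurableSet E) (x : X)
    {a r R : ℝ} (har : a < r) (hrR : r ≤ R) :
    Per m E (ball x R) ≤ Per m E (ball x r) + Per m E (ball x R \ closedBall x a) := by
  obtain ⟨b, hab, hbr⟩ := exists_between har
  obtain ⟨b', hbb, hbr'⟩ := exists_between hbr
  set d : X → ℝ := fun y => dist y x
  have hd : LipschitzWith 1 d := LipschitzWith.dist_left x
  have hG : GlueOn {y | b ≤ dist y x ∧ dist y x ≤ b'} (ball x r) (ball x R \ closedBall x a)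
      (cut d b b') (ball x R) := by
    intro y hy
    rcases lt_or_ge (d y) b with h1 | h1
    · exact Or.inr (Or.inl ⟨h1.trans hbr, cut_eventually_eq_one hd.continuous hbb h1⟩)
    rcases lt_or_ge b' (d y) with h2 | h2
    · exact Or.inr (Or.inr ⟨⟨hy, fun h => not_lt.2 (mem_closedBall.1 h) (hab.trans_le h1)⟩,
        cut_eventually_eq_zero hd.continuous hbb h2⟩)
    · exact Or.inl ⟨h1, h2⟩
  have key := totVar_gluing (m := m) (lipschitzWith_cut hd hbb) (cut_nonneg d b b')
    (cut_le_one d b b') isOpen_ball (isOpen_ball.sdiff isClosed_closedBall) isOpen_ball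
    (W' := ∅) isOpen_empty (isCompact_annulus x b b')
    (fun y hy => mem_ball.2 (hy.2.trans_lt hbr'))
    (fun y hy => ⟨mem_ball.2 ((hy.2.trans_lt hbr').trans_le hrR),
      fun h => not_lt.2 (mem_closedBall.1 h) (hab.trans_le hy.1)⟩)
    (measurable_indicator_one hE) (measurable_indicator_one hE) hG (fun y hy => hy.elim)
  have e : mix (cut d b b') (E.indicator fun _ => (1:ℝ)) (E.indicator fun _ => (1:ℝ)) =
      E.indicator fun _ => (1:ℝ) := by
    ext y
    rw [mix]
    ring
  rw [e] at key
  refine (le_self_add.trans key).trans (le_of_eq ?_)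
  simp [Per]

variable [ProperSpace X] [IsLocallyFiniteMeasure m]

/-- Points of `B` have a common scale below which the densities of `E` and of its complement near
essential boundary points are bounded from below and the perimeter is bounded from above. -/
lemma RegularPI.estimates_of_two_points (h : RegularPI m D lam Cp) (hE : VolConstMin m E)
    (hdef : DeformationProperty m) {z w : X} (hz : z ∈ frontier (innerPart m E))
    (hw : w ∈ frontier (innerPart m E)) (hzw : z ≠ w) {B : Set X} (hB : IsBounded B) :
    ∃ ε : ℝ≥0∞, 0 < ε ∧ ∃ r₀ > (0:ℝ), ∃ A : ℝ, 0 ≤ A ∧ ∀ x ∈ B, ∀ r, 0 < r → r < r₀ →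
      (m (E ∩ ball x (2 * r)) ≤ ε * m (ball x (2 * r)) → m (E ∩ ball x r) = 0) ∧
      Per m E (ball x r) ≤ ENNReal.ofReal (A / r) * m (ball x (2 * r)) := by
  have hd : 0 < dist z w / 2 := half_pos (dist_pos.2 hzw)
  obtain ⟨ε₁, hε₁, r₁, hr₁, A₁, hA₁, h₁⟩ := h.estimates_away hE hdef hz hd hB
  obtain ⟨ε₂, hε₂, r₂, hr₂, A₂, hA₂, h₂⟩ := h.estimates_away hE hdef hw hd hB
  refine ⟨min ε₁ ε₂, lt_min hε₁ hε₂, min r₁ r₂, lt_min hr₁ hr₂, max A₁ A₂,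
    hA₁.trans (le_max_left _ _), fun x hx r hr hr0 => ?_⟩
  obtain ⟨hr01, hr02⟩ := lt_min_iff.1 hr0
  have hor : dist z w / 2 ≤ dist x z ∨ dist z w / 2 ≤ dist x w := by
    by_contra! hcon
    linarith [dist_triangle_left z w x]
  rcases hor with hx' | hx'
  · obtain ⟨e1, e2⟩ := h₁ x hx hx' r hr hr01
    refine ⟨fun h' => e1 (h'.trans (by gcongr; exact min_le_left _ _)), e2.trans ?_⟩
    gcongr
    exact le_max_left _ _
  · obtain ⟨e1, e2⟩ := h₂ x hx hx' r hr hr02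
    refine ⟨fun h' => e1 (h'.trans (by gcongr; exact min_le_right _ _)), e2.trans ?_⟩
    gcongr
    exact le_max_right _ _

lemma RegularPI.mem_innerPart_compl (h : RegularPI m D lam Cp) (hE : VolConstMin m E)
    (hdef : DeformationProperty m) {z x : X} (hz : z ∈ frontier (innerPart m E)) (hxz : x ≠ z)
    (hx : DensZero m E x) : x ∈ innerPart m Eᶜ := by
  obtain ⟨ε, hε, r₀, hr₀, _, _, h'⟩ :=
    h.estimates_away hE hdef hz (dist_pos.2 hxz) (isBounded_singleton (x := x))
  obtain ⟨r₁, hr₁, hd⟩ := hx ε hε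
  obtain ⟨r, hr, hr'⟩ := exists_between (lt_min hr₀ (half_pos hr₁))
  obtain ⟨h1, h2⟩ := lt_min_iff.1 hr'
  refine ⟨r, hr, ?_⟩
  rw [compl_compl]
  exact (h' x rfl le_rfl r hr h1).1 (hd _ (by linarith) (by linarith))

lemma RegularPI.frontier_nonempty [PreconnectedSpace X] (hE : m Eᶜ ≠ 0)
    (hG : (innerPart m E).Nonempty) : (frontier (innerPart m E)).Nonempty := by
  rw [nonempty_iff_ne_empty]
  intro h0
  rcases isClopen_iff.1 (isClopen_iff_frontier_eq_empty.2 h0) with h1 | h1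
  · exact hG.ne_empty h1
  · have := measure_compl_inter_innerPart (m := m) (E := E)
    rw [h1, inter_univ] at this
    exact hE this

lemma RegularPI.measure_compl_singleton (h : RegularPI m D lam Cp) {F : Set X} (hF : m F ≠ 0)
    (z : X) : m (F ∩ {z}ᶜ) ≠ 0 := fun h0 => hF <| by
  refine measure_mono_null (t := F ∩ {z}ᶜ ∪ {z}) (fun x hx => ?_)
    (measure_union_null h0 (h.point_null z))
  by_cases hxz : x = z
  · exact Or.inr hxz
  · exact Or.inl ⟨hx, hxz⟩

lemma RegularPI.frontiers_nonempty [PreconnectedSpace X] (h : RegularPI m D lam Cp)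
    (hE : VolConstMin m E) (hdef : DeformationProperty m) (h1 : m E ≠ 0) (h0 : m Eᶜ ≠ 0) :
    (frontier (innerPart m E)).Nonempty ∧ (frontier (innerPart m Eᶜ)).Nonempty := by
  have key : ∀ {F : Set X}, VolConstMin m F → m F ≠ 0 → m Fᶜ ≠ 0 → (innerPart m F).Nonempty →
      (frontier (innerPart m F)).Nonempty ∧ (frontier (innerPart m Fᶜ)).Nonempty := by
    intro F hF hF1 hF0 hG
    have hne := RegularPI.frontier_nonempty hF0 hG
    refine ⟨hne, RegularPI.frontier_nonempty (by rwa [compl_compl]) ?_⟩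
    obtain ⟨z, hz⟩ := hne
    obtain ⟨x, hxz, hx⟩ := h.exists_densZero hF.1 (h.measure_compl_singleton hF0 z)
    exact ⟨x, h.mem_innerPart_compl hF hdef hz hxz hx⟩
  have hE' := hE.compl
  obtain ⟨x, -, hx⟩ := h.exists_densZero (U := univ) hE.1 (by rwa [inter_univ])
  obtain ⟨y, hyx, hy⟩ := h.exists_densZero hE'.1
    (h.measure_compl_singleton (z := x) (F := Eᶜᶜ) (by rwa [compl_compl]))
  rcases h.innerPart_nonempty_or hE hdef (Ne.symm hyx) hx hy with hG | hH
  · exact key hE h1 h0 hG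
  · have := key hE' h0 (by rwa [compl_compl]) hH
    rw [compl_compl] at this
    exact this.symm

lemma RegularPI.mem_frontier_innerPart (h : RegularPI m D lam Cp) (hE : VolConstMin m E)
    (hdef : DeformationProperty m) (hH : (frontier (innerPart m Eᶜ)).Nonempty) {x : X}
    (hxG : x ∉ innerPart m E) (hxH : x ∉ innerPart m Eᶜ) : x ∈ frontier (innerPart m E) := by
  obtain ⟨w, hw⟩ := hH
  rw [frontier, isOpen_innerPart.interior_eq]
  refine ⟨Metric.mem_closure_iff.2 fun r hr => ?_, hxG⟩
  have hpos : m (Eᶜᶜ ∩ ball x r) ≠ 0 := fun h0 => hxH ⟨r, hr, h0⟩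
  have hpos' := h.measure_compl_singleton hpos w
  rw [inter_assoc] at hpos'
  obtain ⟨y, ⟨hyx, hyw⟩, hy⟩ := h.exists_densZero hE.compl.1 hpos'
  have := h.mem_innerPart_compl hE.compl hdef hw hyw hy
  rw [compl_compl] at this
  exact ⟨y, this, by rw [dist_comm]; exact hyx⟩

lemma RegularPI.doubling_of_two_points (h : RegularPI m D lam Cp) (hE : VolConstMin m E)
    (hdef : DeformationProperty m) {z w : X} (hzw : z ≠ w)
    (hz : z ∈ frontier (innerPart m E)) (hw : w ∈ frontier (innerPart m E))
    (hz' : z ∈ frontier (innerPart m Eᶜ)) (hw' : w ∈ frontier (innerPart m Eᶜ))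
    {B : Set X} (hB : IsBounded B) :
    ∃ r₀ > (0:ℝ), ∃ A : ℝ≥0∞, A ≠ ∞ ∧ ∀ x ∈ B, x ∉ innerPart m E → x ∉ innerPart m Eᶜ →
      ∀ r, 0 < r → r < r₀ → Per m E (ball x (2 * r)) ≤ A * Per m E (ball x r) := by
  obtain ⟨ε₁, hε₁, r₁, hr₁, A, hA, h₁⟩ := h.estimates_of_two_points hE hdef hz hw hzw hB
  obtain ⟨ε₂, hε₂, r₂, hr₂, _, _, h₂⟩ := h.estimates_of_two_points hE.compl hdef hz' hw' hzw hB
  obtain ⟨k, hk⟩ := pow_unbounded_of_one_lt (16 * lam) (one_lt_two (α := ℝ))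
  have hk0 : (0:ℝ) < 2 ^ k := by positivity
  have hlam := h.one_le_lam
  have hCp := h.Cp_pos
  set δ := min 1 (min ε₁ ε₂) with hδ
  have hδ0 : δ ≠ 0 := (lt_min one_pos (lt_min hε₁ hε₂)).ne'
  have hδt : δ ≠ ∞ := ((min_le_left _ _).trans_lt ENNReal.one_lt_top).ne
  refine ⟨min (min (r₁ / 2) r₂) (1 / 2 ^ k), by positivity,
    ENNReal.ofReal (A * Cp / (8 * lam)) * ENNReal.ofReal D ^ k * δ⁻¹, ?_, ?_⟩
  · exact ENNReal.mul_ne_top (ENNReal.mul_ne_top ENNReal.ofReal_ne_top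
      (ENNReal.pow_ne_top ENNReal.ofReal_ne_top)) (ENNReal.inv_ne_top.2 hδ0)
  intro x hx hxG hxH r hr hr0
  simp only [lt_min_iff] at hr0
  obtain ⟨⟨e1, e2⟩, e3⟩ := hr0
  rw [lt_div_iff₀ hk0] at e3
  set σ := r / (4 * lam) with hσ
  have hσ0 : 0 < σ := by positivity
  have hσr : σ ≤ r := div_le_self hr.le (by linarith)
  have hσe : 4 * lam * σ = r := by rw [hσ]; field_simp
  have hk1 : (1:ℝ) < 2 ^ k := by linarith
  have hEσ : δ * m (ball x σ) ≤ m (E ∩ ball x σ) := by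
    by_contra! hlt
    refine hxH ⟨σ / 2, by linarith, ?_⟩
    rw [compl_compl]
    refine (h₁ x hx (σ / 2) (by linarith) (by linarith)).1 ?_
    rw [show 2 * (σ / 2) = σ by ring]
    refine hlt.le.trans ?_
    gcongr
    exact (min_le_right _ _).trans (min_le_left _ _)
  have hEσ' : δ * m (ball x σ) ≤ m (ball x σ \ E) := by
    rw [sdiff_eq, inter_comm]
    by_contra! hlt
    refine hxG ⟨σ / 2, by linarith, ?_⟩
    refine (h₂ x hx (σ / 2) (by linarith) (by linarith)).1 ?_
    rw [show 2 * (σ / 2) = σ by ring]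
    refine hlt.le.trans ?_
    gcongr
    exact (min_le_right _ _).trans (min_le_right _ _)
  have hPI := (le_min hEσ hEσ').trans (h.min_le_Per (Ω := ball x r) isOpen_ball hE.1 hσ0
    (by nlinarith) (closedBall_subset_ball (by nlinarith)))
  have hball : m (ball x σ) ≤ δ⁻¹ * (ENNReal.ofReal (Cp * σ) * Per m E (ball x r)) := by
    calc m (ball x σ) = δ⁻¹ * (δ * m (ball x σ)) := by
          rw [← mul_assoc, ENNReal.inv_mul_cancel hδ0 hδt, one_mul]
      _ ≤ _ := by gcongr
  calc Per m E (ball x (2 * r)) ≤ ENNReal.ofReal (A / (2 * r)) * m (ball x (2 * (2 * r))) :=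
        (h₁ x hx (2 * r) (by linarith) (by linarith)).2
    _ ≤ ENNReal.ofReal (A / (2 * r)) * m (ball x (2 ^ k * σ)) := by
        refine mul_le_mul_right (measure_mono (ball_subset_ball ?_)) _
        nlinarith
    _ ≤ ENNReal.ofReal (A / (2 * r)) * (ENNReal.ofReal D ^ k * m (ball x σ)) := by
        gcongr
        exact h.doubling_iter x hσ0 k (by nlinarith)
    _ ≤ ENNReal.ofReal (A / (2 * r)) * (ENNReal.ofReal D ^ k *
        (δ⁻¹ * (ENNReal.ofReal (Cp * σ) * Per m E (ball x r)))) := by gcongr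
    _ = ENNReal.ofReal (A / (2 * r)) * ENNReal.ofReal (Cp * σ) * ENNReal.ofReal D ^ k * δ⁻¹ *
        Per m E (ball x r) := by ring
    _ = _ := by
        rw [← ENNReal.ofReal_mul (by positivity)]
        congr 4
        rw [hσ]
        field_simp
        ring

lemma PIConst.Per_ball_le_of_unique (h : PIConst m D lam Cp) (hE : MeasurableSet E) {x : X}
    (hx : ∀ y, y ≠ x → y ∈ innerPart m E ∪ innerPart m Eᶜ) {r R : ℝ} (hr : 0 < r) (hrR : r ≤ R) :
    Per m E (ball x R) ≤ Per m E (ball x r) := by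
  refine (Per_ball_le_add hE x (half_lt_self hr) hrR).trans (le_of_eq ?_)
  have hV : IsOpen (ball x R \ closedBall x (r / 2)) := isOpen_ball.sdiff isClosed_closedBall
  have hVx : ∀ y ∈ ball x R \ closedBall x (r / 2), y ∈ innerPart m E ∪ innerPart m Eᶜ :=
    fun y hy => hx y fun hyx => hy.2 (hyx ▸ mem_closedBall_self (by linarith))
  rw [Per_congr_ae_on (F := innerPart m E) hV, Per_eq_zero_of_eventually hV, add_zero]
  · intro y hy
    rcases hVx y hy with h1 | h1
    · exact Or.inl (isOpen_innerPart.mem_nhds h1)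
    · exact Or.inr (mem_of_superset (isOpen_innerPart.mem_nhds h1) fun w hw hw' =>
        disjoint_left.1 h.disjoint_innerPart hw' hw)
  · have n1 := measure_compl_inter_innerPart (m := m) (E := E)
    have n2 := measure_compl_inter_innerPart (m := m) (E := Eᶜ)
    filter_upwards [measure_eq_zero_iff_ae_notMem.1 n1, measure_eq_zero_iff_ae_notMem.1 n2]
      with y h1 h2 hy
    refine ⟨fun hyE => (hVx y hy).resolve_right fun hyH => h2 ⟨by simpa using hyE, hyH⟩,
      fun hyG => ?_⟩
    by_contra hyE
    exact h1 ⟨hyE, hyG⟩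

lemma RegularPI.exists_perimeter_doubling [PreconnectedSpace X] (h : RegularPI m D lam Cp)
    (hE : VolConstMin m E) (hdef : DeformationProperty m) (h1 : m E ≠ 0) (h0 : m Eᶜ ≠ 0)
    {B : Set X} (hB : IsBounded B) :
    ∃ r₀ > (0:ℝ), ∃ A : ℝ≥0∞, A ≠ ∞ ∧ ∀ x ∈ B, x ∉ innerPart m E → x ∉ innerPart m Eᶜ →
      ∀ r, 0 < r → r < r₀ → Per m E (ball x (2 * r)) ≤ A * Per m E (ball x r) := by
  obtain ⟨hG, hH⟩ := h.frontiers_nonempty hE hdef h1 h0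
  have hfG : ∀ x, x ∉ innerPart m E → x ∉ innerPart m Eᶜ → x ∈ frontier (innerPart m E) :=
    fun x => h.mem_frontier_innerPart hE hdef hH
  have hfH : ∀ x, x ∉ innerPart m E → x ∉ innerPart m Eᶜ → x ∈ frontier (innerPart m Eᶜ) :=
    fun x hx hx' => h.mem_frontier_innerPart hE.compl hdef (by rwa [compl_compl]) hx'
      (by rwa [compl_compl])
  by_cases htwo : ∃ z w, z ≠ w ∧ z ∉ innerPart m E ∪ innerPart m Eᶜ ∧
      w ∉ innerPart m E ∪ innerPart m Eᶜ
  · obtain ⟨z, w, hzw, hz, hw⟩ := htwo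
    simp only [mem_union, not_or] at hz hw
    exact h.doubling_of_two_points hE hdef hzw (hfG z hz.1 hz.2) (hfG w hw.1 hw.2)
      (hfH z hz.1 hz.2) (hfH w hw.1 hw.2) hB
  · push Not at htwo
    refine ⟨1, one_pos, 1, ENNReal.one_ne_top, fun x _ hxG hxH r hr _ => ?_⟩
    rw [one_mul]
    exact h.Per_ball_le_of_unique hE.1
      (fun y hy => by_contra fun hy' => hy' (htwo x y hy.symm (by simp [hxG, hxH]))) hr
      (by linarith)

end Doubling

/-- **Doubling of the perimeter measure at boundary points** (Theorem 3.10, second part):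
for a volume-constrained minimizer `E` and a bounded set `B` there are `r̄ > 0` and
`C̃ ≥ 1` with `P(E, B_{2r}(x)) ≤ C̃ P(E, B_r(x))` for all `x ∈ ∂^e E ∩ B`, `r ∈ (0, r̄/2)`. -/
theorem perimeter_doubling_at_boundary
    {X : Type*} [MetricSpace X] [CompleteSpace X] [TopologicalSpace.SeparableSpace X]
    [MeasurableSpace X] [BorelSpace X] (m : Measure X)
    (hbf : BoundedlyFinite m) (hPI : IsPIspace m) (hlen : IsLengthSpace X)
    (hdef : DeformationProperty m) (E : Set X) (hE : VolConstMin m E)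
    (B : Set X) (hB : Bornology.IsBounded B) :
    ∃ rbar > (0:ℝ), ∃ Ct : ℝ, 1 ≤ Ct ∧
      ∀ x ∈ essBdry m E ∩ B, ∀ r : ℝ, 0 < r → r < rbar / 2 →
        Per m E (Metric.ball x (2 * r)) ≤ ENNReal.ofReal Ct * Per m E (Metric.ball x r) := by
  classical
  by_cases htriv : ∀ x ∈ essBdry m E ∩ B, False
  · exact ⟨1, one_pos, 1, le_rfl, fun x hx => (htriv x hx).elim⟩
  by_cases hpos : ∀ x r, 0 < r → 0 < m (ball x r)
  swap
  · push Not at hpos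
    obtain ⟨x, r, hr, h0⟩ := hpos
    obtain ⟨⟨C, -, hC⟩, -⟩ := hPI
    have hm : m = 0 := hC.measure_eq_zero hr (le_antisymm h0 zero_le)
    refine ⟨1, one_pos, 1, le_rfl, fun y _ s _ _ => ?_⟩
    have hE0 : E =ᵐ[m] (∅ : Set X) := by
      rw [hm, ae_zero]
      exact Filter.eventually_bot
    rw [Per_congr_ae hE0, Per]
    simp [totVar_const]
  have hfin : ∀ x r, m (ball x r) < ∞ := fun x r => hbf _ isBounded_ball
  obtain ⟨D, lam, Cp, h⟩ := piConst_of_isPI hfin hpos hPI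
  obtain ⟨⟨C, -, hC⟩, -⟩ := hPI
  have := hC.properSpace hfin hpos
  have := h.isLocallyFiniteMeasure
  have := hlen.preconnectedSpace
  obtain ⟨x₀, hx₀⟩ : (essBdry m E ∩ B).Nonempty := by
    by_contra h'
    exact htriv fun x hx => h' ⟨x, hx⟩
  have hbdry : ∀ x ∈ essBdry m E, x ∉ innerPart m E ∧ x ∉ innerPart m Eᶜ := fun x hx =>
    ⟨fun h' => hx (Or.inl (h.innerPart_subset_essInt h')),
      fun h' => hx (Or.inr (innerPart_compl_subset_essExt h'))⟩
  have h1 : m E ≠ 0 := fun h0 => (hbdry x₀ hx₀.1).2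
    ⟨1, one_pos, by rw [compl_compl]; exact measure_mono_null inter_subset_left h0⟩
  have h0 : m Eᶜ ≠ 0 := fun h0 => (hbdry x₀ hx₀.1).1
    ⟨1, one_pos, measure_mono_null inter_subset_left h0⟩
  obtain ⟨p, hp⟩ := nonempty_of_measure_ne_zero h1
  obtain ⟨q, hq⟩ := nonempty_of_measure_ne_zero h0
  have : Nontrivial X := ⟨p, q, fun hpq => hq (hpq ▸ hp)⟩
  obtain ⟨r₀, hr₀, A, hA, hdoub⟩ :=
    (h.regularPI hlen).exists_perimeter_doubling hE hdef h1 h0 hB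
  refine ⟨2 * r₀, by positivity, max 1 A.toReal, le_max_left _ _, fun x hx r hr hr' => ?_⟩
  obtain ⟨hxG, hxH⟩ := hbdry x hx.1
  refine (hdoub x hx.2 hxG hxH r hr (by linarith)).trans ?_
  gcongr
  exact (ENNReal.le_ofReal_iff_toReal_le hA (by positivity)).2 (le_max_right _ _)

end
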